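/- Let G be a finite connected simple bipartite graph with no bridge (an edge whose deletion disconnects the graph). Then G does not have the {0,1}-property if and only if G is a simple odd multi-cactus. -/

import Mathlib

open scoped Classical

/-- The weighted degree of vertex `v` under edge-weighting `w`:
the sum of the weights of the edges incident with `v`. -/
noncomputable def wdeg {V : Type} [Fintype V] (G : SimpleGraph V) (w : Sym2 V → ℕ) (v : V) : ℕ :=
  ∑ u ∈ Finset.univ.filter (fun u => G.Adj v u), w s(v, u)

/-- `w` is a `{0,1}`-weighting of `G`: every edge gets weight `0` or `1`. -/
def Is01Weighting {V : Type} (G : SimpleGraph V) (w : Sym2 V → ℕ) : Prop :=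
  ∀ e ∈ G.edgeSet, w e = 0 ∨ w e = 1

/-- `G` has the `{0,1}`-property: it admits a proper (neighbour sum-distinguishing)
`{0,1}`-edge-weighting. A graph without this property is called *bad*. -/
def HasZeroOneProperty {V : Type} [Fintype V] (G : SimpleGraph V) : Prop :=
  ∃ w : Sym2 V → ℕ, Is01Weighting G w ∧
    ∀ ⦃u v : V⦄, G.Adj u v → wdeg G w u ≠ wdeg G w v
/-- The `i`-th vertex of a path from `u` to `v` with `n` fresh internal vertices. -/
def pathVert {V : Type} (u v : V) (n : ℕ) (i : Fin (n + 2)) : V ⊕ Fin n :=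
  if h0 : i.1 = 0 then Sum.inl u
  else if hn : i.1 ≤ n then Sum.inr ⟨i.1 - 1, by omega⟩
  else Sum.inl v

/-- The edges of a path of length `n + 1` from `u` to `v` with `n` fresh internal vertices. -/
def pathEdges {V : Type} (u v : V) (n : ℕ) : Set (Sym2 (V ⊕ Fin n)) :=
  {e | ∃ i : Fin (n + 1), e = s(pathVert u v n i.castSucc, pathVert u v n i.succ)}

/-- The green edges of such a path, coloured alternately red, green, …, green, red
(so the `i`-th edge is green exactly when `i` is odd). -/
def greenPathEdges {V : Type} (u v : V) (n : ℕ) : Set (Sym2 (V ⊕ Fin n)) :=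
  {e | ∃ i : Fin (n + 1), Odd i.1 ∧ e = s(pathVert u v n i.castSucc, pathVert u v n i.succ)}

/-- The graph obtained from `G` by adding a path of length `n + 1` from `u` to `v`,
internally disjoint from `G` (its `n` internal vertices are fresh). -/
def addPathGraph {V : Type} (G : SimpleGraph V) (u v : V) (n : ℕ) :
    SimpleGraph (V ⊕ Fin n) :=
  SimpleGraph.fromEdgeSet ((Sym2.map Sum.inl '' G.edgeSet) ∪ pathEdges u v n)

/-- The recursion building simple odd multi-cacti together with their red-green
edge-colouring (given by the set of green edges): `K₂` with its unique edge green is a simple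
odd multi-cactus, and one may repeatedly add, along a green edge `uv`, a new internally
disjoint path of length `l ≡ 1 [MOD 4]`, `l ≥ 5` (here `l = 4 * k + 5`), whose edges are
coloured alternately red, green, …, green, red. -/
inductive OMC : ∀ (V : Type), SimpleGraph V → Set (Sym2 V) → Prop
  | k2 : OMC (Fin 2) ⊤ ((⊤ : SimpleGraph (Fin 2)).edgeSet)
  | addPath {V : Type} {G : SimpleGraph V} {green : Set (Sym2 V)} (h : OMC V G green)
      (u v : V) (hadj : G.Adj u v) (hgreen : s(u, v) ∈ green) (k : ℕ) :
      OMC (V ⊕ Fin (4 * k + 4)) (addPathGraph G u v (4 * k + 4))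
        (Sym2.map Sum.inl '' green ∪ greenPathEdges u v (4 * k + 4))

/-- `G` is a simple odd multi-cactus: it is isomorphic to a graph produced by the
recursion `OMC`. -/
def IsSimpleOddMultiCactus {V : Type} (G : SimpleGraph V) : Prop :=
  ∃ (W : Type) (H : SimpleGraph W) (green : Set (Sym2 W)),
    OMC W H green ∧ Nonempty (G ≃g H)

set_option linter.unusedSectionVars false

namespace ZeroOne

open Finset

section Weightings

variable {V : Type} [Fintype V]

/-- The number of `H`-neighbours of `u` in `R`. -/
noncomputable def dg (H : SimpleGraph V) (R : Finset V) (u : V) : ℕ := #{v ∈ R | H.Adj u v}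

/-- The number of `w`-ones on `G`-edges from `v` to `R`. -/
noncomputable def sdOn (G : SimpleGraph V) (w : Sym2 V → ZMod 2) (R : Finset V) (v : V) : ℕ :=
  #{u ∈ R | G.Adj v u ∧ w s(v, u) = 1}

/-- The weighted degree of `v`. -/
noncomputable def sd (G : SimpleGraph V) (w : Sym2 V → ZMod 2) (v : V) : ℕ := sdOn G w univ v

/-- The parity of the weighted degree, restricted to edges going to `R`. -/
noncomputable def bdOn (G : SimpleGraph V) (w : Sym2 V → ZMod 2) (R : Finset V) (v : V) : ZMod 2 :=
  ∑ u ∈ R with G.Adj v u, w s(v, u)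

/-- The parity of the weighted degree. -/
noncomputable def bd (G : SimpleGraph V) (w : Sym2 V → ZMod 2) (v : V) : ZMod 2 :=
  bdOn G w univ v

/-- `G` has a neighbour sum-distinguishing weighting with values in `ZMod 2 = {0, 1}`. -/
def Good (G : SimpleGraph V) : Prop :=
  ∃ w : Sym2 V → ZMod 2, ∀ ⦃u v : V⦄, G.Adj u v → sd G w u ≠ sd G w v

/-- `R` is connected in `H`: a nonempty subset of `R` closed under adjacency in `R` is `R`. -/
def ConnOn (H : SimpleGraph V) (R : Finset V) : Prop :=
  ∀ X ⊆ R, X.Nonempty → (∀ u ∈ X, ∀ v ∈ R, H.Adj u v → v ∈ X) → X = R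

lemma zmod2_cases (a : ZMod 2) : a = 0 ∨ a = 1 := by
  revert a; decide

lemma zmod2_ne_zero {a : ZMod 2} : a ≠ 0 ↔ a = 1 := by
  revert a; decide

lemma zmod2_ne {a b : ZMod 2} : a ≠ b ↔ a = b + 1 := by
  revert a b; decide

lemma zmod2_add_self (a : ZMod 2) : a + a = 0 := by
  revert a; decide

lemma zmod2_cancel (a κ : ZMod 2) : a + 1 + (κ + 1) = a + κ := by
  revert a κ; decide

lemma bdOn_eq_sdOn (G : SimpleGraph V) (w : Sym2 V → ZMod 2) (R : Finset V) (v : V) :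
    bdOn G w R v = (sdOn G w R v : ZMod 2) := by
  unfold bdOn sdOn
  rw [← filter_filter, ← sum_boole]
  refine sum_congr rfl fun u _ => ?_
  rcases zmod2_cases (w s(v, u)) with h | h <;> simp [h]

lemma bd_eq_sd (G : SimpleGraph V) (w : Sym2 V → ZMod 2) (v : V) :
    bd G w v = (sd G w v : ZMod 2) := bdOn_eq_sdOn G w univ v

lemma sdOn_le_dg (G : SimpleGraph V) (w : Sym2 V → ZMod 2) (R : Finset V) (v : V) :
    sdOn G w R v ≤ dg G R v :=
  card_le_card fun u hu => by simp at hu ⊢; tauto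

lemma sdOn_union (G : SimpleGraph V) (w : Sym2 V → ZMod 2) {R S : Finset V} (h : Disjoint R S)
    (v : V) : sdOn G w (R ∪ S) v = sdOn G w R v + sdOn G w S v := by
  unfold sdOn
  rw [filter_union, card_union_of_disjoint (disjoint_filter_filter h)]

lemma dg_union (G : SimpleGraph V) {R S : Finset V} (h : Disjoint R S)
    (v : V) : dg G (R ∪ S) v = dg G R v + dg G S v := by
  unfold dg
  rw [filter_union, card_union_of_disjoint (disjoint_filter_filter h)]

lemma sdOn_add_compl (G : SimpleGraph V) (w : Sym2 V → ZMod 2) (R : Finset V)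
    (v : V) : sdOn G w R v + sdOn G w Rᶜ v = sd G w v := by
  rw [← sdOn_union G w disjoint_compl_right, union_compl]; rfl

lemma dg_add_compl (G : SimpleGraph V) (R : Finset V) (v : V) :
    dg G R v + dg G Rᶜ v = dg G univ v := by
  rw [← dg_union G disjoint_compl_right, union_compl]

lemma dg_mono (G : SimpleGraph V) {R S : Finset V} (h : R ⊆ S) (v : V) : dg G R v ≤ dg G S v :=
  card_le_card (filter_subset_filter _ h)

lemma dg_mono_left {H G : SimpleGraph V} (h : H ≤ G) (R : Finset V) (v : V) :
    dg H R v ≤ dg G R v :=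
  card_le_card fun u hu => by simp at hu ⊢; exact ⟨hu.1, h hu.2⟩

lemma bdOn_add_compl (G : SimpleGraph V) (w : Sym2 V → ZMod 2) (R : Finset V)
    (v : V) : bdOn G w R v + bdOn G w Rᶜ v = bd G w v := by
  simp only [bd_eq_sd, bdOn_eq_sdOn, ← sdOn_add_compl G w R v]
  push_cast; rfl

lemma bdOn_add (G : SimpleGraph V) (w g : Sym2 V → ZMod 2) (R : Finset V) (v : V) :
    bdOn G (w + g) R v = bdOn G w R v + bdOn G g R v := by
  simp [bdOn, sum_add_distrib]

lemma bd_add (G : SimpleGraph V) (w g : Sym2 V → ZMod 2) (v : V) :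
    bd G (w + g) v = bd G w v + bd G g v := bdOn_add G w g univ v

/-- Swapping the order of summation over the edges between two vertex sets. -/
lemma sum_bdOn_comm (G : SimpleGraph V) (w : Sym2 V → ZMod 2) (R S : Finset V) :
    ∑ v ∈ R, bdOn G w S v = ∑ v ∈ S, bdOn G w R v := by
  simp only [bdOn, sum_filter]
  rw [sum_comm]
  refine sum_congr rfl fun u _ => sum_congr rfl fun v _ => ?_
  rw [G.adj_comm, Sym2.eq_swap]

lemma sum_bdOn_self (G : SimpleGraph V) (w : Sym2 V → ZMod 2) (R : Finset V) :
    ∑ v ∈ R, bdOn G w R v = 0 := by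
  induction R using Finset.induction_on with
  | empty => simp
  | insert a R ha ih =>
    have key : ∀ v, bdOn G w (insert a R) v = bdOn G w {a} v + bdOn G w R v := by
      intro v
      simp only [bdOn, sum_filter]
      rw [sum_insert ha, sum_singleton]
    rw [sum_insert ha]
    simp only [key, sum_add_distrib, ih, add_zero]
    rw [sum_bdOn_comm G w R {a}]
    have : bdOn G w {a} a = 0 := by simp [bdOn, sum_filter]
    simp [this, zmod2_add_self]

/-- Handshake lemma on a vertex set. -/
lemma sum_bd (G : SimpleGraph V) (w : Sym2 V → ZMod 2) (R : Finset V) :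
    ∑ v ∈ R, bd G w v = ∑ v ∈ R, bdOn G w Rᶜ v := by
  simp only [← bdOn_add_compl G w R, sum_add_distrib, sum_bdOn_self, zero_add]

/-- In a connected set any two vertices are the boundary of some set of edges. -/
lemma ConnOn.exists_path {H G : SimpleGraph V} {R : Finset V} (hH : H ≤ G) (hR : ConnOn H R)
    {a b : V} (ha : a ∈ R) (hb : b ∈ R) :
    ∃ g : Sym2 V → ZMod 2, (∀ u v, ¬ (H.Adj u v ∧ u ∈ R ∧ v ∈ R) → g s(u, v) = 0) ∧
      ∀ v, bd G g v = (if v = a then 1 else 0) + (if v = b then 1 else 0) := by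
  let X : Finset V := {b ∈ R | ∃ g : Sym2 V → ZMod 2,
    (∀ u v, ¬ (H.Adj u v ∧ u ∈ R ∧ v ∈ R) → g s(u, v) = 0) ∧
      ∀ v, bd G g v = (if v = a then 1 else 0) + (if v = b then 1 else 0)}
  have hX : X = R := by
    apply hR X (filter_subset _ _)
    · refine ⟨a, ?_⟩
      simp only [X, mem_filter]
      refine ⟨ha, 0, by simp, fun v => ?_⟩
      rw [zmod2_add_self]; simp [bd, bdOn]
    · intro u hu v hv huv
      simp only [X, mem_filter] at hu ⊢
      obtain ⟨huR, g, hg, hgb⟩ := hu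
      refine ⟨hv, g + Pi.single s(u, v) 1, ?_, ?_⟩
      · intro p q hpq
        rw [Pi.add_apply, hg p q hpq, zero_add, Pi.single_apply, if_neg]
        intro h
        rcases Sym2.eq_iff.1 h with ⟨rfl, rfl⟩ | ⟨rfl, rfl⟩
        · exact hpq ⟨huv, huR, hv⟩
        · exact hpq ⟨huv.symm, hv, huR⟩
      · intro p
        rw [bd_add, hgb]
        have : bd G (Pi.single s(u, v) 1) p =
            (if p = u then 1 else 0) + (if p = v then 1 else 0) := by
          have hne := huv.ne
          have hG := hH huv
          simp only [bd, bdOn, sum_filter]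
          by_cases hpu : p = u
          · subst hpu
            rw [sum_eq_single v]
            · simp [hG, hne]
            · intro q _ hq
              simp only [Pi.single_apply]
              split_ifs <;> simp_all
            · simp
          · by_cases hpv : p = v
            · subst hpv
              rw [sum_eq_single u]
              · simp [hG.symm, hne.symm, Sym2.eq_swap]
              · intro q _ hq
                simp only [Pi.single_apply]
                split_ifs <;> simp_all
              · simp
            · rw [sum_eq_zero]
              · simp [hpu, hpv]
              · intro q _
                simp only [Pi.single_apply]
                split_ifs <;> simp_all
        rw [this]
        generalize (if p = a then (1 : ZMod 2) else 0) = x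
        generalize (if p = u then (1 : ZMod 2) else 0) = y
        generalize (if p = v then (1 : ZMod 2) else 0) = z
        revert x y z; decide
  have : b ∈ X := hX ▸ hb
  simpa only [X, mem_filter, hb, true_and] using this

/-- Prescribing parities on a connected set, the weights of edges outside being given. -/
lemma ConnOn.exists_join {H G : SimpleGraph V} {R : Finset V} (hH : H ≤ G) (hR : ConnOn H R)
    (w₀ : Sym2 V → ZMod 2) (t : V → ZMod 2) (ht : ∑ v ∈ R, t v = ∑ v ∈ R, bdOn G w₀ Rᶜ v) :
    ∃ w : Sym2 V → ZMod 2, (∀ u v, ¬ (H.Adj u v ∧ u ∈ R ∧ v ∈ R) → w s(u, v) = w₀ s(u, v)) ∧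
      ∀ v ∈ R, bd G w v = t v := by
  rcases R.eq_empty_or_nonempty with rfl | ⟨a, ha⟩
  · exact ⟨w₀, by simp, by simp⟩
  choose! g hg hgb using fun b (hb : b ∈ R) => hR.exists_path hH ha hb
  let D : V → ZMod 2 := fun b => t b + bd G w₀ b
  have hD : ∑ b ∈ R, D b = 0 := by
    simp only [D, sum_add_distrib, sum_bd, ht, zmod2_add_self]
  have hsum : ∀ v, bd G (∑ b ∈ R, D b • g b) v = ∑ b ∈ R, D b * bd G (g b) v := by
    intro v
    simp only [bd, bdOn, Finset.sum_apply, Pi.smul_apply, smul_eq_mul]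
    rw [sum_comm]
    simp only [mul_sum]
  refine ⟨w₀ + ∑ b ∈ R, D b • g b, ?_, ?_⟩
  · intro u v h
    rw [Pi.add_apply, Finset.sum_apply, sum_eq_zero, add_zero]
    intro b hb
    rw [Pi.smul_apply, hg b hb u v h, smul_zero]
  · intro v hv
    rw [bd_add, hsum]
    have : ∑ b ∈ R, D b * bd G (g b) v =
        ∑ b ∈ R, D b * ((if v = a then 1 else 0) + (if v = b then 1 else 0)) :=
      sum_congr rfl fun b hb => by rw [hgb b hb]
    rw [this]
    have h1 : ∑ b ∈ R, D b * (if v = a then 1 else 0) = 0 := by rw [← sum_mul, hD, zero_mul]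
    simp only [mul_add, sum_add_distrib]
    rw [h1]
    simp only [zero_add, mul_ite, mul_one, mul_zero, sum_ite_eq, if_pos hv, D]
    rw [add_comm, add_assoc, zmod2_add_self, add_zero]

/-- `C` is a connected component of `H` on `R`. -/
def IsComp (H : SimpleGraph V) (R C : Finset V) : Prop :=
  C ⊆ R ∧ C.Nonempty ∧ (∀ u ∈ C, ∀ v ∈ R, H.Adj u v → v ∈ C) ∧ ConnOn H C

/-- The connected components of `H` on `R`. -/
noncomputable def comps (H : SimpleGraph V) (R : Finset V) : Finset (Finset V) :=
  univ.filter (IsComp H R)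

lemma mem_comps {H : SimpleGraph V} {R C : Finset V} : C ∈ comps H R ↔ IsComp H R C := by
  simp [comps]

lemma exists_mem_comps (H : SimpleGraph V) {R : Finset V} {v : V} (hv : v ∈ R) :
    ∃ C ∈ comps H R, v ∈ C := by
  obtain ⟨C, hC, hmin⟩ := exists_min_image
    ((univ : Finset (Finset V)).filter fun C =>
      C ⊆ R ∧ v ∈ C ∧ ∀ u ∈ C, ∀ v ∈ R, H.Adj u v → v ∈ C) card
    ⟨R, by simp [hv]; tauto⟩
  simp only [mem_filter, mem_univ, true_and] at hC hmin
  obtain ⟨hCR, hvC, hcl⟩ := hC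
  refine ⟨C, mem_comps.2 ⟨hCR, ⟨v, hvC⟩, hcl, ?_⟩, hvC⟩
  intro X hXC hX hXcl
  by_cases hvX : v ∈ X
  · refine eq_of_subset_of_card_le hXC (hmin X ⟨hXC.trans hCR, hvX, ?_⟩)
    intro u hu z hz huz
    exact hXcl u hu z (hcl u (hXC hu) z hz huz) huz
  · exfalso
    have := hmin (C \ X) ⟨sdiff_subset.trans hCR, by simp [hvC, hvX], ?_⟩
    · have h2 := card_sdiff_add_card_eq_card hXC
      have := hX.card_pos
      omega
    · intro u hu z hz huz
      simp only [mem_sdiff] at hu ⊢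
      refine ⟨hcl u hu.1 z hz huz, fun hzX => hu.2 (hXcl z hzX u hu.1 huz.symm)⟩

lemma IsComp.eq_of_mem {H : SimpleGraph V} {R C D : Finset V} (hC : IsComp H R C)
    (hD : IsComp H R D) {v : V} (hvC : v ∈ C) (hvD : v ∈ D) : C = D := by
  have key : ∀ {C D : Finset V}, IsComp H R C → IsComp H R D → v ∈ C → v ∈ D → C ∩ D = C := by
    intro C D hC hD hvC hvD
    refine hC.2.2.2 _ inter_subset_left ⟨v, by simp [hvC, hvD]⟩ fun u hu z hz huz => ?_
    simp only [mem_inter] at hu ⊢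
    exact ⟨hz, hD.2.2.1 u hu.2 z (hC.1 hz) huz⟩
  rw [← key hC hD hvC hvD, inter_comm, key hD hC hvD hvC]

lemma comps_disjoint (H : SimpleGraph V) (R : Finset V) :
    (↑(comps H R) : Set (Finset V)).PairwiseDisjoint id := by
  intro C hC D hD hne
  rw [Function.onFun, Finset.disjoint_left]
  intro v hvC hvD
  exact hne ((mem_comps.1 hC).eq_of_mem (mem_comps.1 hD) hvC hvD)

lemma comps_biUnion (H : SimpleGraph V) (R : Finset V) : (comps H R).biUnion id = R := by
  ext v
  simp only [mem_biUnion, id]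
  constructor
  · rintro ⟨C, hC, hv⟩
    exact (mem_comps.1 hC).1 hv
  · exact fun hv => exists_mem_comps H hv

lemma sum_comps (H : SimpleGraph V) (R : Finset V) {M : Type*} [AddCommMonoid M] (f : V → M) :
    ∑ C ∈ comps H R, ∑ v ∈ C, f v = ∑ v ∈ R, f v := by
  conv_rhs => rw [← comps_biUnion H R, sum_biUnion (comps_disjoint H R)]
  rfl

end Weightings

section Rado

variable {K M E ι : Type*} [Field K] [AddCommGroup M] [Module K M] [FiniteDimensional K M]
  [Fintype ι] [DecidableEq E] [DecidableEq ι]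

/-- Rado's theorem on independent transversals, for families of finite sets of vectors. -/
lemma exists_linearIndependent_transversal (φ : E → M) (A : ι → Finset E)
    (h : ∀ S : Finset ι, #S ≤ Module.finrank K (Submodule.span K (φ '' (S.biUnion A : Set E)))) :
    ∃ e : ι → E, (∀ i, e i ∈ A i) ∧ LinearIndependent K (φ ∘ e) := by
  induction hn : ∑ i, #(A i) using Nat.strong_induction_on generalizing A with
  | _ n ih =>
  by_cases hA : ∀ i, ∀ e ∈ A i, ∀ f ∈ A i, e = f
  · have hne : ∀ i, (A i).Nonempty := by
      intro i
      by_contra hi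
      have := h {i}
      rw [not_nonempty_iff_eq_empty] at hi
      simp [hi] at this
    choose e he using hne
    refine ⟨e, he, ?_⟩
    rw [linearIndependent_iff_card_le_finrank_span]
    have h1 := h univ
    have h2 : φ '' ((univ : Finset ι).biUnion A : Set E) = Set.range (φ ∘ e) := by
      rw [Set.range_comp]
      congr 1
      ext x
      simp only [coe_biUnion, Set.mem_iUnion, Set.mem_range, mem_coe, mem_univ, exists_prop,
        true_and]
      constructor
      · rintro ⟨i, hx⟩
        exact ⟨i, hA i _ (he i) _ hx⟩
      · rintro ⟨i, rfl⟩
        exact ⟨i, he i⟩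
    rw [h2] at h1
    exact h1
  · push Not at hA
    obtain ⟨i, e, he, f, hf, hef⟩ := hA
    have hlt : ∀ x ∈ A i, ∑ j, #(Function.update A i ((A i).erase x) j) < n := by
      intro x hx
      rw [← hn]
      refine sum_lt_sum (fun j _ => ?_) ⟨i, mem_univ _, ?_⟩
      · by_cases hj : j = i
        · subst hj; simpa using card_le_card (erase_subset _ _)
        · simp [hj]
      · simpa using card_erase_lt_of_mem hx
    have hstep : ∀ x ∈ A i, (∀ S : Finset ι, #S ≤ Module.finrank K (Submodule.span K
        (φ '' (S.biUnion (Function.update A i ((A i).erase x)) : Set E)))) →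
        ∃ e : ι → E, (∀ i, e i ∈ A i) ∧ LinearIndependent K (φ ∘ e) := by
      intro x hx hS
      obtain ⟨g, hg, hl⟩ := ih _ (hlt x hx) _ hS rfl
      refine ⟨g, fun j => ?_, hl⟩
      have := hg j
      by_cases hj : j = i
      · subst hj
        simp only [Function.update_self] at this
        exact mem_of_mem_erase this
      · simpa [hj] using this
    by_contra hcon
    have hfail : ∀ x ∈ A i, ∃ J : Finset ι, i ∉ J ∧ Module.finrank K (Submodule.span K
        (φ '' ((insert i J).biUnion (Function.update A i ((A i).erase x)) : Set E))) ≤ #J := by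
      intro x hx
      have := mt (hstep x hx) hcon
      push Not at this
      obtain ⟨S, hS⟩ := this
      have hiS : i ∈ S := by
        by_contra hiS
        have : S.biUnion (Function.update A i ((A i).erase x)) = S.biUnion A :=
          biUnion_congr rfl fun j hj => by
            rw [Function.update_of_ne]
            rintro rfl
            exact hiS hj
        rw [this] at hS
        exact absurd (h S) (not_le.2 hS)
      refine ⟨S.erase i, notMem_erase _ _, ?_⟩
      rw [insert_erase hiS, card_erase_of_mem hiS]
      omega
    obtain ⟨J₁, hi₁, h₁⟩ := hfail e he
    obtain ⟨J₂, hi₂, h₂⟩ := hfail f hf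
    set P := Submodule.span K
        (φ '' ((insert i J₁).biUnion (Function.update A i ((A i).erase e)) : Set E)) with hP
    set Q := Submodule.span K
        (φ '' ((insert i J₂).biUnion (Function.update A i ((A i).erase f)) : Set E)) with hQ
    have hmemP : ∀ j ∈ insert i J₁, ∀ x ∈ A j, (j = i → x ≠ e) → φ x ∈ P := by
      intro j hj x hx hje
      refine Submodule.subset_span ⟨x, ?_, rfl⟩
      simp only [coe_biUnion, Set.mem_iUnion, mem_coe, exists_prop]
      refine ⟨j, hj, ?_⟩
      by_cases hji : j = i
      · subst hji; simp [hx, hje]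
      · simp [hji, hx]
    have hmemQ : ∀ j ∈ insert i J₂, ∀ x ∈ A j, (j = i → x ≠ f) → φ x ∈ Q := by
      intro j hj x hx hje
      refine Submodule.subset_span ⟨x, ?_, rfl⟩
      simp only [coe_biUnion, Set.mem_iUnion, mem_coe, exists_prop]
      refine ⟨j, hj, ?_⟩
      by_cases hji : j = i
      · subst hji; simp [hx, hje]
      · simp [hji, hx]
    have hsup := h (insert i (J₁ ∪ J₂))
    have hinf := h (J₁ ∩ J₂)
    have hsup' : Submodule.span K (φ '' ((insert i (J₁ ∪ J₂)).biUnion A : Set E)) ≤ P ⊔ Q := by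
      rw [Submodule.span_le]
      rintro _ ⟨x, hx, rfl⟩
      simp only [coe_biUnion, Set.mem_iUnion, mem_coe, exists_prop] at hx
      obtain ⟨j, hj, hx⟩ := hx
      simp only [SetLike.mem_coe]
      by_cases hji : j = i
      · by_cases hxe : x = e
        · exact Submodule.mem_sup_right (hmemQ j (by simp [hji]) x hx fun _ => hxe ▸ hef)
        · exact Submodule.mem_sup_left (hmemP j (by simp [hji]) x hx fun _ => hxe)
      · simp only [mem_insert, hji, mem_union, false_or] at hj
        rcases hj with hj | hj
        · exact Submodule.mem_sup_left (hmemP j (by simp [hj]) x hx fun h => absurd h hji)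
        · exact Submodule.mem_sup_right (hmemQ j (by simp [hj]) x hx fun h => absurd h hji)
    have hinf' : Submodule.span K (φ '' ((J₁ ∩ J₂).biUnion A : Set E)) ≤ P ⊓ Q := by
      rw [Submodule.span_le]
      rintro _ ⟨x, hx, rfl⟩
      simp only [coe_biUnion, Set.mem_iUnion, mem_coe, exists_prop, mem_inter] at hx
      obtain ⟨j, ⟨hj₁, hj₂⟩, hx⟩ := hx
      have hji : j ≠ i := fun h => hi₁ (h ▸ hj₁)
      exact ⟨hmemP j (by simp [hj₁]) x hx fun h => absurd h hji,
        hmemQ j (by simp [hj₂]) x hx fun h => absurd h hji⟩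
    have e1 := Submodule.finrank_mono hsup'
    have e2 := Submodule.finrank_mono hinf'
    have e3 := Submodule.finrank_sup_add_finrank_inf_eq P Q
    have e4 := card_union_add_card_inter J₁ J₂
    rw [card_insert_of_notMem (by simp [hi₁, hi₂])] at hsup
    omega

end Rado

section Cuts

variable {V : Type} [Fintype V]

/-- The cut vector of a vertex function, on the edges of `H` inside `R`. -/
noncomputable def cutMap (H : SimpleGraph V) (R : Finset V) :
    (V → ZMod 2) →ₗ[ZMod 2] (Sym2 V → ZMod 2) where
  toFun f e := if e ∈ H.edgeSet ∧ ∀ v ∈ e, v ∈ R then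
    Sym2.lift ⟨fun a b => f a + f b, fun a b => add_comm _ _⟩ e else 0
  map_add' f g := by
    ext e
    induction e with | _ a b
    simp only [Sym2.lift_mk, Pi.add_apply]
    split_ifs <;> ring
  map_smul' c f := by
    ext e
    induction e with | _ a b
    simp only [Sym2.lift_mk, Pi.smul_apply, smul_eq_mul, RingHom.id_apply]
    split_ifs <;> ring

lemma cutMap_apply (H : SimpleGraph V) (R : Finset V) (f : V → ZMod 2) (a b : V) :
    cutMap H R f s(a, b) = if H.Adj a b ∧ a ∈ R ∧ b ∈ R then f a + f b else 0 := by
  simp [cutMap]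

/-- The edges of `H` inside `R` with an end in `S`. -/
noncomputable def edgesAt (H : SimpleGraph V) (R : Finset V) (u : V) : Finset (Sym2 V) :=
  image (fun v => s(u, v)) {v ∈ R | H.Adj u v}

lemma mem_edgesAt {H : SimpleGraph V} {R : Finset V} {u : V} {e : Sym2 V} :
    e ∈ edgesAt H R u ↔ ∃ v ∈ R, H.Adj u v ∧ e = s(u, v) := by
  simp [edgesAt, and_assoc, eq_comm]

lemma card_edgesAt (H : SimpleGraph V) (R : Finset V) (u : V) : #(edgesAt H R u) = dg H R u := by
  refine card_image_of_injective _ fun a b h => ?_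
  rcases Sym2.eq_iff.1 h with ⟨-, h⟩ | ⟨rfl, rfl⟩
  · exact h
  · rfl

lemma card_biUnion_edgesAt {H : SimpleGraph V} {R S : Finset V}
    (hind : ∀ u ∈ S, ∀ v ∈ S, ¬ H.Adj u v) :
    #(S.biUnion (edgesAt H R)) = ∑ u ∈ S, dg H R u := by
  rw [card_biUnion, sum_congr rfl fun u _ => card_edgesAt H R u]
  intro u hu v hv huv
  rw [Function.onFun, Finset.disjoint_left]
  intro e h1 h2
  obtain ⟨a, -, ha, rfl⟩ := mem_edgesAt.1 h1
  obtain ⟨b, -, hb, h⟩ := mem_edgesAt.1 h2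
  rcases Sym2.eq_iff.1 h with ⟨h, -⟩ | ⟨rfl, rfl⟩
  · exact huv h
  · exact hind _ hu _ hv ha

lemma ConnOn.const_of_cut {H : SimpleGraph V} {C : Finset V} (hC : ConnOn H C) {f : V → ZMod 2}
    (hf : ∀ u ∈ C, ∀ v ∈ C, H.Adj u v → f u = f v) {a b : V} (ha : a ∈ C) (hb : b ∈ C) :
    f a = f b := by
  have := hC {v ∈ C | f a = f v} (filter_subset _ _) ⟨a, by simp [ha]⟩ (by
    intro u hu v hv huv
    simp only [mem_filter] at hu ⊢
    exact ⟨hv, hu.2.trans (hf u hu.1 v hv huv)⟩)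
  rw [← this] at hb
  exact (mem_filter.1 hb).2

/-- The cuts consisting of edges at `S` span a space of dimension less than `|S|` plus the number
of components left after deleting `S`. -/
lemma finrank_cuts {H : SimpleGraph V} {R S : Finset V} (hne : S.Nonempty)
    (B : Submodule (ZMod 2) (Sym2 V → ZMod 2)) (hB : B ≤ LinearMap.range (cutMap H R))
    (hBS : ∀ b ∈ B, ∀ u ∈ R \ S, ∀ v ∈ R \ S, b s(u, v) = 0) :
    Module.finrank (ZMod 2) B + 1 ≤ #(comps H (R \ S)) + #S := by
  obtain ⟨v₀, hv₀⟩ := hne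
  have hrep : ∀ C : Finset V, ∃ r, C ∈ comps H (R \ S) → r ∈ C := by
    intro C
    by_cases hC : C ∈ comps H (R \ S)
    · obtain ⟨r, hr⟩ := (mem_comps.1 hC).2.1
      exact ⟨r, fun _ => hr⟩
    · exact ⟨v₀, fun h => absurd h hC⟩
  choose rep hrep using hrep
  let P : Finset V := S.erase v₀ ∪ image rep (comps H (R \ S))
  let T : Submodule (ZMod 2) (V → ZMod 2) :=
    { carrier := {f | (∀ v ∉ R, f v = 0) ∧ f v₀ = 0 ∧
        ∀ u ∈ R \ S, ∀ v ∈ R \ S, H.Adj u v → f u = f v}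
      add_mem' := by
        rintro f g ⟨h1, h2, h3⟩ ⟨h1', h2', h3'⟩
        refine ⟨fun v hv => ?_, ?_, fun u hu v hv huv => ?_⟩
        · simp [h1 v hv, h1' v hv]
        · simp [h2, h2']
        · simp [h3 u hu v hv huv, h3' u hu v hv huv]
      zero_mem' := by simp
      smul_mem' := by
        rintro c f ⟨h1, h2, h3⟩
        refine ⟨fun v hv => ?_, ?_, fun u hu v hv huv => ?_⟩
        · simp [h1 v hv]
        · simp [h2]
        · simp [h3 u hu v hv huv] }
  have hBT : B ≤ T.map (cutMap H R) := by
    intro b hb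
    obtain ⟨f, rfl⟩ := hB hb
    refine ⟨fun v => if v ∈ R then f v + f v₀ else 0, ⟨?_, ?_, ?_⟩, ?_⟩
    · intro v hv; simp [hv]
    · simp [zmod2_add_self]
    · intro u hu v hv huv
      have := hBS _ hb u hu v hv
      rw [mem_sdiff] at hu hv
      rw [cutMap_apply, if_pos ⟨huv, hu.1, hv.1⟩] at this
      simp only [hu.1, hv.1, if_true]
      congr 1
      revert this
      generalize f u = x
      generalize f v = y
      revert x y
      decide
    · ext e
      induction e with | _ a b
      simp only [cutMap_apply]
      by_cases h1 : H.Adj a b ∧ a ∈ R ∧ b ∈ R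
      · simp only [h1, if_true, true_and]
        generalize f a = x
        generalize f b = y
        generalize f v₀ = z
        revert x y z
        decide
      · simp only [h1, if_false]
  let ev : T →ₗ[ZMod 2] (P → ZMod 2) :=
    { toFun := fun f p => f.1 p.1
      map_add' := fun _ _ => rfl
      map_smul' := fun _ _ => rfl }
  have hev : Function.Injective ev := by
    rw [injective_iff_map_eq_zero]
    rintro ⟨f, hf1, hf2, hf3⟩ h
    have hP : ∀ p ∈ P, f p = 0 := fun p hp => congrFun h ⟨p, hp⟩
    ext v
    by_cases hvR : v ∈ R
    · by_cases hvS : v ∈ S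
      · by_cases hv : v = v₀
        · subst hv; exact hf2
        · exact hP v (mem_union_left _ (mem_erase.2 ⟨hv, hvS⟩))
      · obtain ⟨C, hC, hvC⟩ := exists_mem_comps H (mem_sdiff.2 ⟨hvR, hvS⟩)
        have h1 := mem_comps.1 hC
        have := h1.2.2.2.const_of_cut (f := f)
          (fun u hu v hv huv => hf3 u (h1.1 hu) v (h1.1 hv) huv) hvC (hrep C hC)
        refine this.trans (hP _ (mem_union_right _ (mem_image_of_mem _ hC)))
    · exact hf1 v hvR
  have h1 := Submodule.finrank_mono hBT
  have h2 := Submodule.finrank_map_le (cutMap H R) T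
  have h3 := LinearMap.finrank_le_finrank_of_injective hev
  rw [Module.finrank_fintype_fun_eq_card, Fintype.card_coe] at h3
  have h4 : #P ≤ #(S.erase v₀) + #(comps H (R \ S)) :=
    (card_union_le _ _).trans (Nat.add_le_add_left card_image_le _)
  rw [card_erase_of_mem hv₀] at h4
  have := card_pos.2 ⟨v₀, hv₀⟩
  omega

/-- Either one edge at each vertex of an independent set `U` can be deleted keeping `R` connected,
or deleting some nonempty subset of `U` leaves many components. -/
lemma ConnOn.exists_deletable {H : SimpleGraph V} {R U : Finset V} (hR : ConnOn H R)
    (hind : ∀ u ∈ U, ∀ v ∈ U, ¬ H.Adj u v) :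
    (∃ e : V → V, (∀ u ∈ U, e u ∈ R ∧ H.Adj u (e u)) ∧
      ConnOn (H.deleteEdges {z | ∃ u ∈ U, z = s(u, e u)}) R) ∨
    ∃ S ⊆ U, S.Nonempty ∧ ∑ u ∈ S, dg H R u + 2 ≤ #(comps H (R \ S)) + 2 * #S := by
  by_contra hcon
  push Not at hcon
  obtain ⟨hcon1, hcon2⟩ := hcon
  let B := LinearMap.range (cutMap H R)
  let φ : Sym2 V → (Sym2 V → ZMod 2) ⧸ B := fun e => B.mkQ (Pi.single e 1)
  obtain ⟨e, he, hli⟩ := exists_linearIndependent_transversal (K := ZMod 2) (ι := U) φ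
    (fun u => edgesAt H R u.1) (by
      intro S'
      let S : Finset V := S'.map ⟨Subtype.val, Subtype.val_injective⟩
      have hcard : #S = #S' := card_map _
      have hSU : S ⊆ U := by
        intro v hv
        simp only [S, mem_map, Function.Embedding.coeFn_mk] at hv
        obtain ⟨a, -, rfl⟩ := hv
        exact a.2
      rcases S.eq_empty_or_nonempty with h0 | hne
      · rw [← hcard, h0]; simp
      have h1 := hcon2 S hSU hne
      have hF : (S'.biUnion fun u => edgesAt H R u.1) = S.biUnion (edgesAt H R) := by
        simp only [S, map_eq_image, image_biUnion]
        rfl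
      rw [hF]
      set F := S.biUnion (edgesAt H R) with hFdef
      have hFcard : #F = ∑ u ∈ S, dg H R u :=
        card_biUnion_edgesAt fun u hu v hv => hind u (hSU hu) v (hSU hv)
      let WF : Submodule (ZMod 2) (Sym2 V → ZMod 2) :=
        Submodule.span (ZMod 2) ((fun e => Pi.single e 1) '' (F : Set (Sym2 V)))
      have hWF : Module.finrank (ZMod 2) WF = #F := by
        have hl : LinearIndependent (ZMod 2)
            (fun e : F => (Pi.single e.1 1 : Sym2 V → ZMod 2)) := by
          have := (Pi.basisFun (ZMod 2) (Sym2 V)).linearIndependent.comp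
            (Subtype.val : F → Sym2 V) Subtype.val_injective
          convert this using 1
          ext e
          simp
        have := finrank_span_eq_card hl
        rw [Fintype.card_coe] at this
        have hr : (fun e => Pi.single e 1 : Sym2 V → Sym2 V → ZMod 2) '' (F : Set (Sym2 V)) =
            Set.range (fun e : F => (Pi.single e.1 1 : Sym2 V → ZMod 2)) := by
          ext x
          simp
        rw [← this, ← hr]
      have hmap : Submodule.span (ZMod 2) (φ '' (F : Set (Sym2 V))) = WF.map B.mkQ := by
        rw [Submodule.map_span, ← Set.image_comp]
        rfl
      have hsupp : ∀ b ∈ WF, ∀ z ∉ F, b z = 0 := by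
        intro b hb
        induction hb using Submodule.span_induction with
        | mem x hx =>
          obtain ⟨y, hy, rfl⟩ := hx
          intro z hz
          refine Pi.single_eq_of_ne ?_ _
          rintro rfl
          exact hz hy
        | zero => simp
        | add x y _ _ hx hy => intro z hz; simp [hx z hz, hy z hz]
        | smul c x _ hx => intro z hz; simp [hx z hz]
      have hrk := LinearMap.finrank_range_add_finrank_ker (B.mkQ.domRestrict WF)
      rw [LinearMap.range_domRestrict, hWF] at hrk
      have hker : Module.finrank (ZMod 2) (LinearMap.ker (B.mkQ.domRestrict WF)) =
          Module.finrank (ZMod 2) ((LinearMap.ker (B.mkQ.domRestrict WF)).map WF.subtype) :=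
        (LinearEquiv.finrank_eq (Submodule.equivMapOfInjective _ WF.injective_subtype _))
      have hcut := finrank_cuts (H := H) hne
        ((LinearMap.ker (B.mkQ.domRestrict WF)).map WF.subtype) (by
          rintro _ ⟨⟨x, hx⟩, hxk, rfl⟩
          have : B.mkQ x = 0 := hxk
          rwa [Submodule.mkQ_apply, Submodule.Quotient.mk_eq_zero] at this) (by
          rintro _ ⟨⟨x, hx⟩, hxk, rfl⟩ u hu v hv
          refine hsupp x hx _ fun hF => ?_
          simp only [F, mem_biUnion, mem_edgesAt] at hF
          obtain ⟨a, haS, b, -, -, h⟩ := hF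
          rw [mem_sdiff] at hu hv
          rcases Sym2.eq_iff.1 h with ⟨rfl, -⟩ | ⟨-, rfl⟩
          · exact hu.2 haS
          · exact hv.2 haS)
      rw [hmap]
      omega)
  have he' : ∀ u (hu : u ∈ U), ∃ v, v ∈ R ∧ H.Adj u v ∧ e ⟨u, hu⟩ = s(u, v) := by
    intro u hu
    obtain ⟨v, h1, h2, h3⟩ := mem_edgesAt.1 (he ⟨u, hu⟩)
    exact ⟨v, h1, h2, h3⟩
  choose! p hpR hpA hpe using he'
  refine hcon1 p (fun u hu => ⟨hpR u hu, hpA u hu⟩) fun X hXR hX hXcl => ?_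
  have hinj : Function.Injective e := fun a b h => hli.injective (by simp [h])
  refine hR X hXR hX ?_
  let f : V → ZMod 2 := fun v => if v ∈ X then 1 else 0
  have hcut : ∀ z, (∀ u : U, z ≠ e u) → cutMap H R f z = 0 := by
    intro z hz
    induction z with | _ a b
    rw [cutMap_apply]
    split_ifs with h
    · have hadj : (H.deleteEdges {z | ∃ u ∈ U, z = s(u, p u)}).Adj a b := by
        rw [SimpleGraph.deleteEdges_adj]
        refine ⟨h.1, ?_⟩
        rintro ⟨u, hu, hab⟩
        exact hz ⟨u, hu⟩ (hab.trans (hpe u hu).symm)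
      have h1 := fun ha => hXcl a ha b h.2.2 hadj
      have h2 := fun hb => hXcl b hb a h.2.1 hadj.symm
      simp only [f]
      by_cases ha : a ∈ X
      · simp [ha, h1 ha, zmod2_add_self]
      · by_cases hb : b ∈ X
        · exact absurd (h2 hb) ha
        · simp [ha, hb]
    · rfl
  have hsum : cutMap H R f = ∑ u : U, cutMap H R f (e u) • (Pi.single (e u) 1 : Sym2 V → ZMod 2) := by
    ext z
    rw [Finset.sum_apply]
    by_cases hz : ∃ u : U, z = e u
    · obtain ⟨u, rfl⟩ := hz
      rw [sum_eq_single u]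
      · simp
      · intro v _ hv
        have : e u ≠ e v := fun h => hv (hinj h).symm
        simp [this]
      · simp
    · push Not at hz
      rw [hcut z hz, sum_eq_zero]
      intro u _
      simp [hz u]
  have hzero : ∑ u : U, cutMap H R f (e u) • (φ ∘ e) u = 0 := by
    have : B.mkQ (cutMap H R f) = 0 := by
      rw [Submodule.mkQ_apply, Submodule.Quotient.mk_eq_zero]
      exact LinearMap.mem_range_self _ _
    rw [hsum, map_sum] at this
    simpa [φ] using this
  have hcoef := Fintype.linearIndependent_iff.1 hli _ hzero
  have hall : ∀ z, cutMap H R f z = 0 := by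
    intro z
    by_cases hz : ∃ u : U, z = e u
    · obtain ⟨u, rfl⟩ := hz
      exact hcoef u
    · exact hcut z (by push Not at hz; exact hz)
  intro u hu v hv huv
  have := hall s(u, v)
  rw [cutMap_apply, if_pos ⟨huv, hXR hu, hv⟩] at this
  by_contra hvX
  simp [f, hu, hvX] at this

end Cuts

section Threads

variable {V : Type} [Fintype V]

/-- The degree of `v`. -/
noncomputable abbrev deg (G : SimpleGraph V) (v : V) : ℕ := dg G univ v

/-- The number of edges leaving `C`. -/
noncomputable def ebd (G : SimpleGraph V) (C : Finset V) : ℕ := ∑ v ∈ C, dg G Cᶜ v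

/-- `v` is not a cut vertex. -/
def NonCut (G : SimpleGraph V) (v : V) : Prop := ConnOn G {v}ᶜ

/-- `C` is connected and exactly two edges leave it, namely `px` and `qu`, with `x ≠ u`. -/
structure TwoExit (G : SimpleGraph V) (C : Finset V) (p x q u : V) : Prop where
  hp : p ∈ C
  hq : q ∈ C
  hx : x ∉ C
  hu : u ∉ C
  ne : x ≠ u
  px : G.Adj p x
  qu : G.Adj q u
  exit : ∀ v ∈ C, ∀ z, z ∉ C → G.Adj v z → v = p ∧ z = x ∨ v = q ∧ z = u
  conn : ConnOn G C

/-- `C` consists of the internal vertices of an induced path from `x` to `u`, all of degree two. -/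
def Thread (G : SimpleGraph V) (C : Finset V) (x u : V) : Prop :=
  (∃ p q, TwoExit G C p x q u) ∧ ∀ v ∈ C, deg G v = 2

/-- `c` is a proper two-colouring. -/
def Bip (G : SimpleGraph V) (c : V → ZMod 2) : Prop := ∀ ⦃u v⦄, G.Adj u v → c v = c u + 1

/-- Every proper nonempty vertex set has at least two leaving edges. -/
def BL (G : SimpleGraph V) : Prop := ∀ X : Finset V, X.Nonempty → Xᶜ.Nonempty → 2 ≤ ebd G X

variable {G H : SimpleGraph V} {c : V → ZMod 2}

lemma TwoExit.symm {C : Finset V} {p x q u : V} (h : TwoExit G C p x q u) :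
    TwoExit G C q u p x :=
  ⟨h.hq, h.hp, h.hu, h.hx, h.ne.symm, h.qu, h.px,
    fun v hv z hz hvz => (h.exit v hv z hz hvz).symm, h.conn⟩

lemma Thread.symm {C : Finset V} {x u : V} (h : Thread G C x u) : Thread G C u x := by
  obtain ⟨⟨p, q, h1⟩, h2⟩ := h
  exact ⟨⟨q, p, h1.symm⟩, h2⟩

lemma ConnOn.mono (h : H ≤ G) {R : Finset V} (hR : ConnOn H R) : ConnOn G R :=
  fun X hX hne hcl => hR X hX hne fun u hu v hv huv => hcl u hu v hv (h huv)

lemma BL.connOn (h : BL G) : ConnOn G univ := by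
  intro X _ hX hcl
  by_contra hne
  have h1 := h X hX (by
    rw [nonempty_iff_ne_empty, Ne, compl_eq_empty_iff]
    exact hne)
  have : ebd G X = 0 := by
    refine sum_eq_zero fun v hv => ?_
    rw [dg, card_eq_zero, filter_eq_empty_iff]
    intro z hz hvz
    exact (mem_compl.1 hz) (hcl v hv z (mem_univ _) hvz)
  omega

lemma dg_pos {R : Finset V} {u v : V} (hv : v ∈ R) (h : H.Adj u v) : 0 < dg H R u :=
  card_pos.2 ⟨v, by simp [hv, h]⟩

lemma dg_eq_zero {R : Finset V} {u : V} : dg H R u = 0 ↔ ∀ v ∈ R, ¬ H.Adj u v := by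
  simp [dg, filter_eq_empty_iff]

lemma exists_adj_of_dg_pos {R : Finset V} {u : V} (h : 0 < dg H R u) : ∃ v ∈ R, H.Adj u v := by
  obtain ⟨v, hv⟩ := card_pos.1 h
  exact ⟨v, by simpa using hv⟩

lemma dg_singleton (u v : V) : dg H {v} u = if H.Adj u v then 1 else 0 := by
  by_cases h : H.Adj u v <;> simp [dg, filter_singleton, h]

lemma dg_insert {R : Finset V} {v : V} (hv : v ∉ R) (u : V) :
    dg H (insert v R) u = (if H.Adj u v then 1 else 0) + dg H R u := by
  rw [insert_eq, dg_union _ (by simpa using hv), dg_singleton]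

lemma sum_dg_comm (H : SimpleGraph V) (R S : Finset V) :
    ∑ u ∈ R, dg H S u = ∑ u ∈ S, dg H R u := by
  simp only [dg, card_filter]
  rw [sum_comm]
  simp only [H.adj_comm]

lemma dg_sdiff_add {R S : Finset V} (h : S ⊆ R) (u : V) :
    dg H (R \ S) u + dg H S u = dg H R u := by
  rw [← dg_union _ sdiff_disjoint, sdiff_union_of_subset h]

lemma dg_compl_singleton (x u : V) :
    dg H {x}ᶜ u + (if H.Adj u x then 1 else 0) = deg H u := by
  rw [deg, ← dg_add_compl H {x}, dg_singleton, add_comm]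

lemma ebd_pos (h : BL G) {X : Finset V} {u v : V} (hu : u ∈ X) (hv : v ∉ X) : 2 ≤ ebd G X :=
  h X ⟨u, hu⟩ ⟨v, by simpa using hv⟩

lemma ebd_singleton (v : V) : ebd G {v} = deg G v := by
  rw [ebd, sum_singleton, ← dg_compl_singleton v v]
  simp

lemma BL.two_le_deg (h : BL G) {v z : V} (hz : z ≠ v) : 2 ≤ deg G v := by
  rw [← ebd_singleton]
  exact ebd_pos h (mem_singleton_self v) (by simpa using hz)

/-- If the edges leaving a set are among two, the set is not separated further. -/
lemma ebd_le_of_exit {X : Finset V} {p x q u : V}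
    (h : ∀ v ∈ X, ∀ z, z ∉ X → G.Adj v z → v = p ∧ z = x ∨ v = q ∧ z = u) : ebd G X ≤ 2 := by
  have : ebd G X = #(X.sigma fun v => {z ∈ Xᶜ | G.Adj v z}) := by
    rw [card_sigma]; rfl
  rw [this]
  refine (card_le_card (t := {⟨p, x⟩, ⟨q, u⟩}) ?_).trans card_le_two
  rintro ⟨v, z⟩ hvz
  simp only [mem_sigma, mem_filter, mem_compl] at hvz
  rcases h v hvz.1 z hvz.2.1 hvz.2.2 with ⟨rfl, rfl⟩ | ⟨rfl, rfl⟩ <;> simp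

/-- A set with exactly two leaving edges. -/
lemma exists_exits {X : Finset V} (h : ebd G X = 2) : ∃ p x q u, p ∈ X ∧ q ∈ X ∧ x ∉ X ∧ u ∉ X ∧
    G.Adj p x ∧ G.Adj q u ∧ (p ≠ q ∨ x ≠ u) ∧
    ∀ v ∈ X, ∀ z, z ∉ X → G.Adj v z → v = p ∧ z = x ∨ v = q ∧ z = u := by
  have h1 : ebd G X = #(X.sigma fun v => {z ∈ Xᶜ | G.Adj v z}) := by
    rw [card_sigma]; rfl
  rw [h1, card_eq_two] at h
  obtain ⟨⟨p, x⟩, ⟨q, u⟩, hne, hS⟩ := h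
  have hm : ∀ v z, (v ∈ X ∧ z ∉ X ∧ G.Adj v z) ↔ (v = p ∧ z = x ∨ v = q ∧ z = u) := by
    intro v z
    have := congrArg (fun s => (⟨v, z⟩ : Σ _ : V, V) ∈ s) hS
    simpa using this
  have hpx := (hm p x).2 (Or.inl ⟨rfl, rfl⟩)
  have hqu := (hm q u).2 (Or.inr ⟨rfl, rfl⟩)
  refine ⟨p, x, q, u, hpx.1, hqu.1, hpx.2.1, hqu.2.1, hpx.2.2, hqu.2.2, ?_, ?_⟩
  · by_contra hcon
    push Not at hcon
    exact hne (by rw [hcon.1, hcon.2])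
  · intro v hv z hz hvz
    exact (hm v z).1 ⟨hv, hz, hvz⟩

lemma TwoExit.ebd_eq (hbl : BL G) {C : Finset V} {p x q u : V} (h : TwoExit G C p x q u) :
    ebd G C = 2 :=
  le_antisymm (ebd_le_of_exit h.exit) (ebd_pos hbl h.hp h.hx)

/-- The complement of a set with two exits is connected. -/
lemma TwoExit.connOn_compl (hbl : BL G) {C : Finset V} {p x q u : V} (h : TwoExit G C p x q u) :
    ConnOn G Cᶜ := by
  intro X hX hne hcl
  have hout : ∀ v ∈ X, ∀ z, z ∉ X → G.Adj v z → v = x ∧ z = p ∨ v = u ∧ z = q := by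
    intro v hv z hz hvz
    have hzC : z ∈ C := by
      by_contra hzC
      exact hz (hcl v hv z (mem_compl.2 hzC) hvz)
    rcases h.exit z hzC v (mem_compl.1 (hX hv)) hvz.symm with h | h
    · exact Or.inl h.symm
    · exact Or.inr h.symm
  by_contra hneq
  obtain ⟨y, hy, hyX⟩ := exists_of_ssubset (hX.ssubset_of_ne hneq)
  obtain ⟨a, ha⟩ := hne
  have key : ∀ Y : Finset V, Y ⊆ Cᶜ → Y.Nonempty →
      (∀ v ∈ Y, ∀ z, z ∉ Y → G.Adj v z → v = x ∧ z = p ∨ v = u ∧ z = q) → x ∈ Y ∧ u ∈ Y := by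
    intro Y hY ⟨a, ha⟩ hout
    have h2 := ebd_pos hbl ha (fun hp => (mem_compl.1 (hY hp)) h.hp)
    by_contra hcon
    have hone : ∃ s t, ∀ v ∈ Y, ∀ z, z ∉ Y → G.Adj v z → v = s ∧ z = t := by
      by_cases hx : x ∈ Y
      · have hu : u ∉ Y := fun hu => hcon ⟨hx, hu⟩
        refine ⟨x, p, fun v hv z hz hvz => ?_⟩
        rcases hout v hv z hz hvz with h | ⟨rfl, -⟩
        · exact h
        · exact absurd hv hu
      · refine ⟨u, q, fun v hv z hz hvz => ?_⟩
        rcases hout v hv z hz hvz with ⟨rfl, -⟩ | h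
        · exact absurd hv hx
        · exact h
    obtain ⟨s, t, hst⟩ := hone
    have : ebd G Y = #(Y.sigma fun v => {z ∈ Yᶜ | G.Adj v z}) := by
      rw [card_sigma]; rfl
    rw [this] at h2
    have h3 : #(Y.sigma fun v => {z ∈ Yᶜ | G.Adj v z}) ≤ #{(⟨s, t⟩ : Σ _ : V, V)} := by
      refine card_le_card ?_
      rintro ⟨v, z⟩ hvz
      simp only [mem_sigma, mem_filter, mem_compl] at hvz
      obtain ⟨rfl, rfl⟩ := hst v hvz.1 z hvz.2.1 hvz.2.2
      simp
    rw [card_singleton] at h3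
    omega
  have h1 := key X hX ⟨a, ha⟩ hout
  have h2 := key (Cᶜ \ X) sdiff_subset ⟨y, mem_sdiff.2 ⟨hy, hyX⟩⟩ (by
    intro v hv z hz hvz
    rw [mem_sdiff] at hv hz
    push Not at hz
    have hzC : z ∈ C := by
      by_contra hzC
      exact hv.2 (hcl z (hz (mem_compl.2 hzC)) v hv.1 hvz.symm)
    rcases h.exit z hzC v (mem_compl.1 hv.1) hvz.symm with h | h
    · exact Or.inl h.symm
    · exact Or.inr h.symm)
  exact (mem_sdiff.1 h2.1).2 h1.1

lemma IsComp.ebd_eq {R C : Finset V} (h : IsComp G R C) : ebd G C = ∑ v ∈ C, dg G Rᶜ v := by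
  refine sum_congr rfl fun v hv => ?_
  refine congrArg card ?_
  ext z
  simp only [mem_filter, mem_compl]
  constructor
  · rintro ⟨hz, hvz⟩
    exact ⟨fun hzR => hz (h.2.2.1 v hv z hzR hvz), hvz⟩
  · rintro ⟨hz, hvz⟩
    exact ⟨fun hzC => hz (h.1 hzC), hvz⟩

/-- Counting the edges leaving the components. -/
lemma sum_ebd_comps (G : SimpleGraph V) (R : Finset V) :
    ∑ C ∈ comps G R, ebd G C = ∑ u ∈ Rᶜ, dg G R u := by
  rw [sum_congr rfl fun C hC => (mem_comps.1 hC).ebd_eq, sum_comps, sum_dg_comm]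

lemma comps_eq_of_closed (hHG : H ≤ G) {R : Finset V}
    (hcl : ∀ C ∈ comps H R, ∀ u ∈ C, ∀ v ∈ R, G.Adj u v → v ∈ C) : comps H R = comps G R := by
  have hsub : ∀ C ∈ comps H R, C ∈ comps G R := by
    intro C hC
    have h := mem_comps.1 hC
    exact mem_comps.2 ⟨h.1, h.2.1, hcl C hC, h.2.2.2.mono hHG⟩
  refine Subset.antisymm hsub fun D hD => ?_
  obtain ⟨v, hv⟩ := (mem_comps.1 hD).2.1
  obtain ⟨C, hC, hvC⟩ := exists_mem_comps H ((mem_comps.1 hD).1 hv)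
  rw [(mem_comps.1 hD).eq_of_mem (mem_comps.1 (hsub C hC)) hv hvC]
  exact hC

/-! ### Weighted degrees -/

lemma bd_eq_of_eq_off {w w₀ : Sym2 V → ZMod 2} {R : Finset V}
    (h : ∀ u v, ¬ (H.Adj u v ∧ u ∈ R ∧ v ∈ R) → w s(u, v) = w₀ s(u, v)) {v : V} (hv : v ∉ R) :
    bd G w v = bd G w₀ v :=
  sum_congr rfl fun u _ => h v u fun h => hv h.2.1

lemma sd_ne_of_bd_ne {w : Sym2 V → ZMod 2} {u v : V} (h : bd G w u ≠ bd G w v) :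
    sd G w u ≠ sd G w v := fun he => h (by rw [bd_eq_sd, bd_eq_sd, he])

lemma sd_parity {w : Sym2 V → ZMod 2} {v : V} {n : ℕ} (h : bd G w v = (n : ZMod 2)) :
    sd G w v % 2 = n % 2 := by
  rw [bd_eq_sd] at h
  exact (ZMod.natCast_eq_natCast_iff _ _ 2).1 h

lemma Bip.ne (hc : Bip G c) {u v : V} (h : G.Adj u v) : c u ≠ c v := by
  rw [hc h]; generalize c u = a; revert a; decide

lemma Bip.symm_sum (hc : Bip G c) {u v : V} (h : G.Adj u v) (κ : ZMod 2) :
    c u + κ ≠ c v + κ := fun he => hc.ne h (add_right_cancel he)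

lemma sd_le_deg (w : Sym2 V → ZMod 2) (v : V) : sd G w v ≤ deg G v := sdOn_le_dg G w univ v

lemma sdOn_le_of_zero {w : Sym2 V → ZMod 2} {R : Finset V} {u v : V} (hu : u ∈ R)
    (h : G.Adj v u) (hw : w s(v, u) = 0) : sdOn G w R v + 1 ≤ dg G R v := by
  refine Nat.succ_le_of_lt (card_lt_card ?_)
  rw [ssubset_iff_of_subset (fun u hu => by simp at hu ⊢; tauto)]
  exact ⟨u, by simp [hu, h], by simp [hw]⟩

lemma sd_le_of_zero {w : Sym2 V → ZMod 2} {u v : V}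
    (h : G.Adj v u) (hw : w s(v, u) = 0) : sd G w v + 1 ≤ deg G v :=
  sdOn_le_of_zero (mem_univ _) h hw

lemma one_le_sd {w : Sym2 V → ZMod 2} {u v : V}
    (h : G.Adj v u) (hw : w s(v, u) = 1) : 1 ≤ sd G w v :=
  card_pos.2 ⟨u, by simp [h, hw]⟩

lemma two_le_sd {w : Sym2 V → ZMod 2} {u u' v : V} (hne : u ≠ u')
    (h : G.Adj v u) (hw : w s(v, u) = 1) (h' : G.Adj v u') (hw' : w s(v, u') = 1) :
    2 ≤ sd G w v := by
  rw [← card_pair hne]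
  refine card_le_card fun z hz => ?_
  simp only [mem_insert, mem_singleton] at hz
  rcases hz with rfl | rfl <;> simp [*]

/-- A bipartite graph with a part of even size is good. -/
lemma good_of_even (hc : Bip G c) (hG : ConnOn G univ) (κ : ZMod 2) (h : ∑ v, (c v + κ) = 0) :
    Good G := by
  obtain ⟨w, -, hw⟩ := hG.exists_join le_rfl 0 (fun v => c v + κ) (by simp [bdOn, h])
  exact ⟨w, fun u v huv => sd_ne_of_bd_ne (by
    rw [hw u (mem_univ _), hw v (mem_univ _)]; exact hc.symm_sum huv κ)⟩

lemma sum_eq_one_of_bad (hc : Bip G c) (hG : ConnOn G univ) (hbad : ¬ Good G) (κ : ZMod 2) :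
    ∑ v, (c v + κ) = 1 :=
  zmod2_ne_zero.1 fun h => hbad (good_of_even hc hG κ h)

/-! ### Colour counts -/

lemma sum_c_add (c : V → ZMod 2) (R : Finset V) (κ : ZMod 2) :
    ∑ v ∈ R, (c v + κ) = ∑ v ∈ R, c v + #R * κ := by
  rw [sum_add_distrib, sum_const, nsmul_eq_mul]

lemma sum_c_eq_card (c : V → ZMod 2) (R : Finset V) :
    ∑ v ∈ R, c v = (#{v ∈ R | c v = 1} : ZMod 2) := by
  rw [← sum_boole]
  refine sum_congr rfl fun v _ => ?_
  rcases zmod2_cases (c v) with h | h <;> simp [h]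

lemma TwoExit.filter_compl {C : Finset V} {p x q u : V} (h : TwoExit G C p x q u) {v : V}
    (hv : v ∈ C) : {z ∈ Cᶜ | G.Adj v z} =
      (if v = p then {x} else ∅) ∪ (if v = q then {u} else ∅) := by
  ext z
  simp only [mem_filter, mem_compl, mem_union]
  constructor
  · rintro ⟨hz, hvz⟩
    rcases h.exit v hv z hz hvz with ⟨rfl, rfl⟩ | ⟨rfl, rfl⟩ <;> simp
  · intro hz
    split_ifs at hz with h1 h2 h2
    · simp at hz
      rcases hz with rfl | rfl
      · exact ⟨h.hx, h1 ▸ h.px⟩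
      · exact ⟨h.hu, h2 ▸ h.qu⟩
    · simp at hz; subst hz; exact ⟨h.hx, h1 ▸ h.px⟩
    · simp at hz; subst hz; exact ⟨h.hu, h2 ▸ h.qu⟩
    · simp at hz

lemma TwoExit.dg_compl {C : Finset V} {p x q u : V} (h : TwoExit G C p x q u) {v : V}
    (hv : v ∈ C) : dg G Cᶜ v = (if v = p then 1 else 0) + if v = q then 1 else 0 := by
  rw [dg, h.filter_compl hv, card_union_of_disjoint]
  · split_ifs <;> simp
  · split_ifs <;> simp [h.ne]

lemma TwoExit.sum_bdOn {C : Finset V} {p x q u : V} (h : TwoExit G C p x q u)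
    (w : Sym2 V → ZMod 2) : ∑ v ∈ C, bdOn G w Cᶜ v = w s(p, x) + w s(q, u) := by
  have : ∀ v ∈ C, bdOn G w Cᶜ v =
      (if v = p then w s(p, x) else 0) + if v = q then w s(q, u) else 0 := by
    intro v hv
    rw [bdOn, h.filter_compl hv, sum_union]
    · congr 1
      · split_ifs with h2 <;> simp [h2]
      · split_ifs with h2 <;> simp [h2]
    · split_ifs <;> simp [h.ne]
  rw [sum_congr rfl this, sum_add_distrib]
  simp [h.hp, h.hq]

/-- Edge count in a thread: every edge joins the two colour classes. -/
lemma TwoExit.count (hc : Bip G c) {C : Finset V} {p x q u : V} (h : TwoExit G C p x q u)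
    (h2 : ∀ v ∈ C, deg G v = 2) :
    2 * #{v ∈ C | c v = 1} + ((if c p = 0 then 1 else 0) + if c q = 0 then 1 else 0) =
    2 * #{v ∈ C | c v = 0} + ((if c p = 1 then 1 else 0) + if c q = 1 then 1 else 0) := by
  have hsplit : ∀ (a : ZMod 2), ∑ v ∈ C with c v = a, dg G C v +
      ((if c p = a then 1 else 0) + if c q = a then 1 else 0) = 2 * #{v ∈ C | c v = a} := by
    intro a
    have h3 : ∀ v ∈ C, dg G C v + ((if v = p then 1 else 0) + if v = q then 1 else 0) = 2 := by
      intro v hv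
      rw [← h.dg_compl hv, dg_add_compl]
      exact h2 v hv
    have h4 : ∑ v ∈ C with c v = a, (dg G C v +
        ((if v = p then 1 else 0) + if v = q then 1 else 0)) = 2 * #{v ∈ C | c v = a} := by
      rw [sum_congr rfl fun v hv => h3 v (mem_filter.1 hv).1, sum_const, smul_eq_mul, mul_comm]
    rw [← h4, sum_add_distrib, sum_add_distrib]
    simp [sum_ite_eq', h.hp, h.hq]
  have hsw : ∑ v ∈ C with c v = 1, dg G C v = ∑ v ∈ C with c v = 0, dg G C v := by
    have e : ∀ (a : ZMod 2), ∑ v ∈ C with c v = a, dg G C v =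
        ∑ v ∈ C with c v = a, dg G {v ∈ C | c v = a + 1} v := by
      intro a
      refine sum_congr rfl fun v hv => congrArg card ?_
      ext z
      simp only [mem_filter] at hv ⊢
      constructor
      · rintro ⟨hz, hvz⟩
        exact ⟨⟨hz, by rw [hc hvz, hv.2]⟩, hvz⟩
      · rintro ⟨⟨hz, -⟩, hvz⟩
        exact ⟨hz, hvz⟩
    rw [e 1, e 0, sum_dg_comm]
    rfl
  have h0 := hsplit 0
  have h1 := hsplit 1
  omega

lemma card_color_split (c : V → ZMod 2) (C : Finset V) :
    #{v ∈ C | c v = 1} + #{v ∈ C | c v = 0} = #C := by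
  rw [← card_filter_add_card_filter_not (s := C) (fun v => c v = 1)]
  congr 2
  ext v
  rcases zmod2_cases (c v) with h | h <;> simp [h]

/-- A thread between vertices of different colours is even and balanced. -/
lemma Thread.balanced (hc : Bip G c) {C : Finset V} {x u : V} (h : Thread G C x u)
    (hxu : c x ≠ c u) : #C = 2 * #{v ∈ C | c v = 1} := by
  obtain ⟨⟨p, q, h1⟩, h2⟩ := h
  have := h1.count hc h2
  have hs := card_color_split c C
  have hp := hc h1.px
  have hq := hc h1.qu
  rcases zmod2_cases (c p) with h | h <;> rcases zmod2_cases (c q) with h' | h' <;>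
    simp_all <;> omega

/-- A thread between vertices of the same colour is odd. -/
lemma Thread.odd (hc : Bip G c) {C : Finset V} {x u : V} (h : Thread G C x u)
    (hxu : c x = c u) : Odd #C := by
  obtain ⟨⟨p, q, h1⟩, h2⟩ := h
  have := h1.count hc h2
  have hs := card_color_split c C
  have hp := hc h1.px
  have hq := hc h1.qu
  rw [Nat.odd_iff]
  rcases zmod2_cases (c p) with h | h <;> rcases zmod2_cases (c q) with h' | h' <;>
    simp_all <;> omega

end Threads

section Reductions

variable {V : Type} [Fintype V] {G H : SimpleGraph V} {c : V → ZMod 2}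

/-- All edges at `x` have weight one and all other vertices have parities normal for a common
convention, chosen such that the neighbours of `x` have the parity of the degree of `x`. -/
def IsFull (G : SimpleGraph V) (c : V → ZMod 2) (x : V) (w : Sym2 V → ZMod 2) : Prop :=
  (∀ u, G.Adj x u → w s(x, u) = 1) ∧ ∀ v, v ≠ x → bd G w v = c v + (c x + deg G x + 1)

lemma sd_eq_deg {w : Sym2 V → ZMod 2} {v : V} (h : ∀ u, G.Adj v u → w s(v, u) = 1) :
    sd G w v = deg G v := by
  refine congrArg card ?_
  ext u
  simp only [mem_filter, mem_univ, true_and]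
  exact ⟨fun h => h.1, fun hu => ⟨hu, h u hu⟩⟩

/-- In a full state only neighbours of `x` can have the weighted degree of a neighbour. -/
lemma IsFull.exists_conflict (hc : Bip G c) (hbad : ¬ Good G) {x : V} {w : Sym2 V → ZMod 2}
    (h : IsFull G c x w) : ∃ u, G.Adj x u ∧ sd G w u = deg G x := by
  by_contra hcon
  push Not at hcon
  have hx := sd_eq_deg h.1
  refine hbad ⟨w, fun u v huv => ?_⟩
  by_cases hu : u = x
  · subst hu; rw [hx]; exact (hcon v huv).symm
  · by_cases hv : v = x
    · subst hv; rw [hx]; exact hcon u huv.symm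
    · exact sd_ne_of_bd_ne (by rw [h.2 u hu, h.2 v hv]; exact hc.symm_sum huv _)

/-- Existence of full states, or a set of neighbours of `x` leaving many components. -/
lemma exists_full (hc : Bip G c) (hodd : ∀ κ, ∑ v, (c v + κ) = 1) (hHG : H ≤ G) {x : V}
    (hx : ConnOn H {x}ᶜ) {U : Finset V} (hU : ∀ u ∈ U, G.Adj x u) :
    (∃ w, IsFull G c x w ∧ (∀ u, G.Adj x u → sd G w u ≤ dg H {x}ᶜ u + 1) ∧
      ∀ u ∈ U, sd G w u ≤ dg H {x}ᶜ u) ∨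
    ∃ S ⊆ U, S.Nonempty ∧
      ∑ u ∈ S, dg H {x}ᶜ u + 2 ≤ #(comps H ({x}ᶜ \ S)) + 2 * #S := by
  have hcol : ∀ u ∈ U, c u = c x + 1 := fun u hu => hc (hU u hu)
  rcases hx.exists_deletable (U := U) (fun u hu v hv huv => hc.ne (hHG huv)
    ((hcol u hu).trans (hcol v hv).symm)) with ⟨e, he, hconn⟩ | h
  · left
    set H' := H.deleteEdges {z | ∃ u ∈ U, z = s(u, e u)} with hH'
    have hH'G : H' ≤ G := (SimpleGraph.deleteEdges_le _).trans hHG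
    obtain ⟨w, hw, hwb⟩ := hconn.exists_join hH'G (fun z => if x ∈ z then 1 else 0)
      (fun v => c v + (c x + deg G x + 1)) (by
        have h1 := hodd (c x + deg G x + 1)
        rw [← sum_compl_add_sum {x}, sum_singleton] at h1
        rw [sum_bdOn_comm, compl_compl, sum_singleton]
        have h2 : bdOn G (fun z => if x ∈ z then 1 else 0) {x}ᶜ x = (deg G x : ZMod 2) := by
          rw [bdOn_eq_sdOn]
          refine congrArg Nat.cast (congrArg card ?_)
          ext u
          simp only [mem_filter, mem_compl, mem_singleton, mem_univ, true_and]
          constructor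
          · rintro ⟨-, h, -⟩; exact h
          · intro h; exact ⟨h.ne', h, by simp⟩
        rw [h2]
        revert h1
        generalize ∑ i ∈ {x}ᶜ, (c i + (c x + ↑(deg G x) + 1)) = s
        generalize (deg G x : ZMod 2) = a
        generalize c x = b
        revert s a b; decide)
    have hzero : ∀ a b, a ≠ x → b ≠ x → ¬ H'.Adj a b → w s(a, b) = 0 := by
      intro a b ha hb hab
      rw [hw a b (by tauto), if_neg]
      simp [ha.symm, hb.symm]
    have hle : ∀ u, G.Adj x u → sd G w u ≤ sdOn G w {x}ᶜ u + 1 := by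
      intro u hu
      rw [← sdOn_add_compl G w {x}]
      have : sdOn G w {x} u ≤ 1 := (sdOn_le_dg _ _ _ _).trans (by rw [dg_singleton]; split_ifs <;> simp)
      omega
    have hsd : ∀ u, u ≠ x → sdOn G w {x}ᶜ u ≤ dg H' {x}ᶜ u := by
      intro u hu
      refine card_le_card fun z hz => ?_
      simp only [mem_filter, mem_compl, mem_singleton] at hz ⊢
      refine ⟨hz.1, ?_⟩
      by_contra hcon
      rw [hzero u z hu hz.1 hcon] at hz
      simp at hz
    refine ⟨w, ⟨fun u hu => ?_, fun v hv => hwb v (by simpa using hv)⟩, fun u hu => ?_,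
      fun u hu => ?_⟩
    · rw [hw x u (by simp)]
      simp
    · have h1 := hle u hu
      have h2 := hsd u hu.ne'
      have h3 := dg_mono_left (SimpleGraph.deleteEdges_le (G := H) {z | ∃ u ∈ U, z = s(u, e u)}) {x}ᶜ u
      rw [← hH'] at h3
      omega
    · have h1 := hle u (hU u hu)
      have h2 := hsd u (hU u hu).ne'
      have h3 : dg H' {x}ᶜ u + 1 ≤ dg H {x}ᶜ u := by
        refine Nat.succ_le_of_lt (card_lt_card ?_)
        rw [ssubset_iff_of_subset (fun z hz => by
          simp only [mem_filter] at hz ⊢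
          exact ⟨hz.1, SimpleGraph.deleteEdges_le _ hz.2⟩)]
        refine ⟨e u, by simpa using he u hu, ?_⟩
        simp only [mem_filter, not_and]
        intro _ h
        rw [hH', SimpleGraph.deleteEdges_adj] at h
        exact h.2 ⟨u, hu, rfl⟩
      omega
  · exact Or.inr h

/-- In a full state, a thread from `x` of length two modulo four has weight zero at its end. -/
lemma IsFull.sd_lt_of_thread (hc : Bip G c) {x u : V} {w : Sym2 V → ZMod 2} (h : IsFull G c x w)
    (hxu : G.Adj x u) {C : Finset V} (hC : Thread G C x u) (hC4 : ¬ 4 ∣ #C) :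
    sd G w u + 1 ≤ deg G u := by
  have hb := hC.balanced hc (hc.ne hxu)
  obtain ⟨⟨p, q, h1⟩, -⟩ := hC
  have hxC : ∀ v ∈ C, v ≠ x := by rintro v hv rfl; exact h1.hx hv
  have e1 := sum_bd G w C
  rw [sum_congr rfl fun v hv => h.2 v (hxC v hv), sum_c_add, sum_c_eq_card] at e1
  have hcard : (#C : ZMod 2) = 0 := by
    rw [hb]; push_cast
    generalize (#{v ∈ C | c v = 1} : ZMod 2) = a
    revert a; decide
  have hodd : (#{v ∈ C | c v = 1} : ZMod 2) = 1 := by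
    have : #{v ∈ C | c v = 1} % 2 = 1 := by omega
    exact (ZMod.natCast_eq_natCast_iff _ 1 2).2 this
  rw [h1.sum_bdOn, hcard, hodd, Sym2.eq_swap, h.1 p h1.px.symm] at e1
  have : w s(u, q) = 0 := by
    rw [Sym2.eq_swap (a := u)]
    revert e1
    generalize w s(q, u) = a
    generalize (c x + ↑(deg G x) + 1) = b
    revert a b; decide
  exact sd_le_of_zero h1.qu.symm this

lemma Thread.eq_color (hc : Bip G c) {C : Finset V} {x u : V} (h : Thread G C x u)
    (hodd : Odd #C) : c x = c u := by
  by_contra hne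
  have := h.balanced hc hne
  rw [Nat.odd_iff] at hodd
  omega

/-- The ends of an odd thread, carrying a heavy edge each. -/
lemma sd_ne_of_thread_end {w : Sym2 V → ZMod 2} {y p y' : V} {α : ZMod 2} (hne : y' ≠ p)
    (hp : G.Adj y p) (hy' : G.Adj y y') (hwp : w s(y, p) = α) (hwy : w s(y, y') = 1)
    (hby : bd G w y = α) (hbp : bd G w p = α) (hdeg : deg G p = 2) : sd G w y ≠ sd G w p := by
  rcases zmod2_cases α with rfl | rfl
  · have h1 := one_le_sd hy' hwy
    have h2 := sd_le_of_zero hp.symm (by rwa [Sym2.eq_swap])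
    have h3 := sd_parity (n := 0) (by simpa using hby)
    have h4 := sd_parity (n := 0) (by simpa using hbp)
    omega
  · have h1 := two_le_sd hne hy' hwy hp hwp
    have h2 := sd_le_deg (G := G) w p
    have h3 := sd_parity (n := 1) (by simpa using hby)
    omega

/-- A graph with an odd thread whose complement stays connected after deleting an edge at each
end of the thread is good. -/
lemma good_of_odd_thread (hc : Bip G c) (hG : ConnOn G univ) {C : Finset V} {p y q z y' z' : V}
    (h : TwoExit G C p y q z) (h2 : ∀ v ∈ C, deg G v = 2) (hodd : Odd #C) (hy'C : y' ∉ C)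
    (hz'C : z' ∉ C) (hy' : G.Adj y y') (hz' : G.Adj z z')
    (hconn : ConnOn (G.deleteEdges {s(y, y'), s(z, z')}) Cᶜ) : Good G := by
  by_contra hbad
  have hsum := sum_eq_one_of_bad hc hG hbad
  have hcol : c y = c z := Thread.eq_color hc ⟨⟨p, q, h⟩, h2⟩ hodd
  have hcardC : (#C : ZMod 2) = 1 := by
    rw [Nat.odd_iff] at hodd
    exact (ZMod.natCast_eq_natCast_iff _ 1 2).2 hodd
  obtain ⟨κ, hκ⟩ : ∃ κ : ZMod 2, ∑ v ∈ C, (c v + (κ + 1)) = 0 := by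
    simp only [sum_c_add, hcardC]
    refine ⟨∑ v ∈ C, c v + 1, ?_⟩
    generalize ∑ v ∈ C, c v = a
    revert a; decide
  have hκC : ∑ v ∈ C, (c v + κ) = 1 := by
    rw [sum_c_add, hcardC] at hκ ⊢
    revert hκ
    generalize ∑ v ∈ C, c v = a
    revert a κ; decide
  have hκR : ∑ v ∈ Cᶜ, (c v + κ) = 0 := by
    have := hsum κ
    rw [← sum_add_sum_compl C, hκC] at this
    simpa using this
  set α := c y + κ with hα
  set H := G.deleteEdges {s(y, y'), s(z, z')} with hH
  let w₀ : Sym2 V → ZMod 2 := fun e => if ∃ a ∈ C, a ∈ e then α else 1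
  have hsym := h.symm
  have hw₀C : ∀ v ∈ C, ∀ u, w₀ s(v, u) = α := fun v hv u => if_pos ⟨v, hv, by simp⟩
  have hw₀R : ∀ v ∉ C, ∀ u ∉ C, w₀ s(v, u) = 1 := by
    intro v hv u hu
    refine if_neg ?_
    rintro ⟨a, ha, hav⟩
    rcases Sym2.mem_iff.1 hav with rfl | rfl
    · exact hv ha
    · exact hu ha
  have hcross : ∑ v ∈ C, bdOn G w₀ Cᶜ v = 0 := by
    rw [h.sum_bdOn, hw₀C p h.hp, hw₀C q h.hq, zmod2_add_self]
  obtain ⟨w₁, hw₁, hb₁⟩ := hconn.exists_join (SimpleGraph.deleteEdges_le _) w₀ (fun v => c v + κ) (by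
    rw [hκR, sum_bdOn_comm, compl_compl, hcross])
  have hC₁ : ∀ v ∈ C, ∀ u, w₁ s(v, u) = α := fun v hv u =>
    (hw₁ v u fun h => (mem_compl.1 h.2.1) hv).trans (hw₀C v hv u)
  obtain ⟨w, hw, hb⟩ := h.conn.exists_join le_rfl w₁ (fun v => c v + (κ + 1)) (by
    rw [hκ, h.sum_bdOn, hC₁ p h.hp, hC₁ q h.hq, zmod2_add_self])
  have hbR : ∀ v ∉ C, bd G w v = c v + κ := fun v hv =>
    (bd_eq_of_eq_off hw hv).trans (hb₁ v (mem_compl.2 hv))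
  have hend : ∀ {p y q z y' z' : V}, TwoExit G C p y q z → y' ∉ C → G.Adj y y' → c y + κ = α →
      ¬ H.Adj y y' → sd G w y ≠ sd G w p := by
    intro p y q z y' z' h hy'C hy' hα hH
    refine sd_ne_of_thread_end (α := α) (y' := y') (by rintro rfl; exact hy'C h.hp) h.px.symm hy' ?_ ?_
      (by rw [hbR y h.hx, hα]) (by rw [hb p h.hp, hc h.px.symm, zmod2_cancel, hα])
      (h2 p h.hp)
    · rw [hw _ _ (fun hh => h.hx hh.2.1), Sym2.eq_swap, hC₁ p h.hp]
    · rw [hw _ _ (fun hh => h.hx hh.2.1), hw₁ _ _ (fun hh => hH hh.1), hw₀R _ h.hx _ hy'C]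
  have hy := hend (z' := z') h hy'C hy' rfl (by simp [hH])
  have hz := hend (z' := y') hsym hz'C hz' (by rw [← hcol]) (by simp [hH])
  refine hbad ⟨w, ?_⟩
  have hmain : ∀ u v, G.Adj u v → u ∈ C → sd G w u ≠ sd G w v := by
    intro u v huv hu
    by_cases hv : v ∈ C
    · exact sd_ne_of_bd_ne (by rw [hb u hu, hb v hv]; exact hc.symm_sum huv _)
    · rcases h.exit u hu v hv huv with ⟨rfl, rfl⟩ | ⟨rfl, rfl⟩
      · exact hy.symm
      · exact hz.symm
  intro u v huv
  by_cases hu : u ∈ C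
  · exact hmain u v huv hu
  · by_cases hv : v ∈ C
    · exact (hmain v u huv.symm hv).symm
    · exact sd_ne_of_bd_ne (by rw [hbR u hu, hbR v hv]; exact hc.symm_sum huv _)

/-- The properties of a minimal counterexample. -/
structure Env (G : SimpleGraph V) (c : V → ZMod 2) : Prop where
  bip : Bip G c
  bl : BL G
  bad : ¬ Good G
  noEar : ∀ x u C, G.Adj x u → NonCut G x → NonCut G u → 3 ≤ deg G x → 3 ≤ deg G u →
    Thread G C x u → 4 ∣ #C → False

namespace Env

lemma conn (E : Env G c) : ConnOn G univ := E.bl.connOn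

lemma odd (E : Env G c) (κ : ZMod 2) : ∑ v, (c v + κ) = 1 :=
  sum_eq_one_of_bad E.bip E.conn E.bad κ

/-- If `x` is not a cut vertex then a connected set whose leaving edges all go to `x` is
everything else. -/
lemma eq_compl_of_exit {x : V} (hx : NonCut G x) {C : Finset V} (hC : C.Nonempty) (hxC : x ∉ C)
    (h : ∀ v ∈ C, ∀ z ∉ C, G.Adj v z → z = x) : C = {x}ᶜ := by
  refine hx C (fun v hv => ?_) hC fun u hu v hv huv => ?_
  · simp only [mem_compl, mem_singleton]; rintro rfl; exact hxC hv
  · by_contra hvC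
    simp [h u hu v hvC huv] at hv

/-- A set cannot be left by two edges at `x` only. -/
lemma not_ebd_eq_two {x y z : V} (hx : NonCut G x) (hdx : 3 ≤ deg G x) {D : Finset V}
    (hxD : x ∈ D) (hyD : y ∉ D) (hzD : z ∉ D) (hyz : y ≠ z) (hxy : G.Adj x y) (hxz : G.Adj x z)
    (hD : ebd G D = 2) : False := by
  obtain ⟨p, a, q, b, -, -, -, -, -, -, -, hex⟩ := exists_exits hD
  have hall : ∀ v ∈ D, ∀ t ∉ D, G.Adj v t → v = x := by
    intro v hv t ht hvt
    have h1 := hex x hxD y hyD hxy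
    have h2 := hex x hxD z hzD hxz
    have h3 := hex v hv t ht hvt
    grind
  by_cases hne : (D.erase x).Nonempty
  · have := eq_compl_of_exit hx hne (notMem_erase x D) fun v hv t ht hvt => by
      by_contra htx
      have htD : t ∉ D := fun htD => ht (mem_erase.2 ⟨htx, htD⟩)
      exact (mem_erase.1 hv).1 (hall v (mem_of_mem_erase hv) t htD hvt)
    have hy : y ∈ D.erase x := by rw [this]; simp [hxy.ne']
    exact hyD (mem_of_mem_erase hy)
  · rw [not_nonempty_iff_eq_empty, erase_eq_empty_iff] at hne
    rcases hne with rfl | rfl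
    · simp at hxD
    · rw [ebd_singleton] at hD; omega

/-- No odd thread joins two neighbours of a vertex that is not a cut vertex. -/
lemma no_odd_thread (E : Env G c) {x y z : V} (hx : NonCut G x) (hdx : 3 ≤ deg G x)
    (hxy : G.Adj x y) (hxz : G.Adj x z) (hdy : 3 ≤ deg G y) (hdz : 3 ≤ deg G z)
    {C : Finset V} (h : Thread G C y z) : False := by
  have hcol : c y = c z := (E.bip hxy).trans (E.bip hxz).symm
  have hodd := h.odd E.bip hcol
  obtain ⟨⟨p, q, h1⟩, h2⟩ := h
  have hxC : x ∉ C := fun hxC => by have := h2 x hxC; omega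
  have hconn := h1.connOn_compl E.bl
  have hd : ∀ {p y q z}, TwoExit G C p y q z → dg G Cᶜ y + 1 = deg G y := by
    intro p y q z h1
    rw [deg, ← dg_add_compl G C, add_comm]
    congr 1
    rw [dg, card_eq_one.2 ⟨p, ?_⟩]
    ext v
    simp only [mem_filter, mem_singleton]
    constructor
    · rintro ⟨hv, hyv⟩
      rcases h1.exit v hv y h1.hx hyv.symm with h | h
      · exact h.1
      · exact absurd h.2 h1.ne
    · rintro rfl; exact ⟨h1.hp, h1.px.symm⟩
  have hdy' := hd h1
  have hdz' := hd h1.symm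
  rcases hconn.exists_deletable (U := {y, z}) (by
    intro u hu v hv huv
    refine E.bip.ne huv ?_
    simp only [mem_insert, mem_singleton] at hu hv
    rcases hu with rfl | rfl <;> rcases hv with rfl | rfl <;> simp [hcol]) with ⟨e, he, hconn'⟩ | h
  · refine E.bad (good_of_odd_thread E.bip E.conn h1 h2 hodd (y' := e y) (z' := e z) ?_ ?_ ?_ ?_ ?_)
    · exact mem_compl.1 (he y (by simp)).1
    · exact mem_compl.1 (he z (by simp)).1
    · exact (he y (by simp)).2
    · exact (he z (by simp)).2
    · convert hconn' using 2
      ext e'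
      simp
  · obtain ⟨S, hSU, hS, hle⟩ := h
    have hSC : S ⊆ Cᶜ := fun v hv => by
      have := hSU hv
      simp only [mem_insert, mem_singleton] at this
      rcases this with rfl | rfl
      · exact mem_compl.2 h1.hx
      · exact mem_compl.2 h1.hu
    have hbig : ∀ D ∈ comps G (Cᶜ \ S), 2 ≤ ebd G D := by
      intro D hD
      obtain ⟨a, ha⟩ := (mem_comps.1 hD).2.1
      exact ebd_pos E.bl (v := p) ha fun hp => by
        have := (mem_comps.1 hD).1 hp
        simp [h1.hp] at this
    have hcount := sum_ebd_comps G (Cᶜ \ S)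
    have hsum := card_nsmul_le_sum _ (fun D => ebd G D) _ hbig
    have hcompl : (Cᶜ \ S)ᶜ = C ∪ S := by ext; simp; tauto
    have hdisj : Disjoint C S := by
      rw [Finset.disjoint_left]
      exact fun v hv hvS => mem_compl.1 (hSC hvS) hv
    rw [hcompl, sum_union hdisj] at hcount
    rw [smul_eq_mul] at hsum
    have hSind : ∀ u ∈ S, dg G S u = 0 := fun u hu => dg_eq_zero.2 fun v hv huv => by
      have h3 := hSU hu
      have h4 := hSU hv
      simp only [mem_insert, mem_singleton] at h3 h4
      refine E.bip.ne huv ?_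
      rcases h3 with rfl | rfl <;> rcases h4 with rfl | rfl <;> simp [hcol]
    have hS2 : ∑ u ∈ S, dg G (Cᶜ \ S) u = ∑ u ∈ S, dg G Cᶜ u := sum_congr rfl fun u hu => by
      rw [← dg_sdiff_add hSC, hSind u hu, add_zero]
    have hC2 : ∑ u ∈ C, dg G (Cᶜ \ S) u + #S ≤ 2 := by
      have h3 := h1.ebd_eq E.bl
      rw [ebd, sum_congr rfl fun u _ => (dg_sdiff_add hSC u).symm, sum_add_distrib,
        sum_dg_comm G C S] at h3
      have h4 : ∑ u ∈ S, 1 ≤ ∑ u ∈ S, dg G C u := sum_le_sum fun u hu => by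
        have := hSU hu
        simp only [mem_insert, mem_singleton] at this
        rcases this with rfl | rfl
        · exact dg_pos h1.hp h1.px.symm
        · exact dg_pos h1.hq h1.qu.symm
      rw [sum_const, smul_eq_mul, mul_one] at h4
      omega
    have hlow : ∑ u ∈ S, 2 ≤ ∑ u ∈ S, dg G Cᶜ u := sum_le_sum fun u hu => by
      have := hSU hu
      simp only [mem_insert, mem_singleton] at this
      rcases this with rfl | rfl <;> omega
    rw [sum_const, smul_eq_mul] at hlow
    rw [hS2] at hcount
    have hS1 := hS.card_pos
    have hxS : x ∉ S := fun hxS => by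
      have := hSU hxS
      simp only [mem_insert, mem_singleton] at this
      rcases this with rfl | rfl
      · exact hxy.ne rfl
      · exact hxz.ne rfl
    obtain ⟨D, hD, hxD⟩ := exists_mem_comps G (R := Cᶜ \ S) (v := x) (by simp [hxC, hxS])
    have hScard : #S = 2 := by omega
    have hSeq : S = {y, z} := eq_of_subset_of_card_le hSU (by rw [card_pair h1.ne, hScard])
    have hD2 : ebd G D = 2 := by
      have h3 := sum_erase_add _ (fun D => ebd G D) hD
      have h4 := card_nsmul_le_sum ((comps G (Cᶜ \ S)).erase D) (fun D => ebd G D) _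
        fun D' hD' => hbig D' (mem_of_mem_erase hD')
      rw [card_erase_of_mem hD, smul_eq_mul] at h4
      have := hbig D hD
      omega
    have hyD : y ∉ D := fun hy => by have := (mem_comps.1 hD).1 hy; simp [hSeq] at this
    have hzD : z ∉ D := fun hz => by have := (mem_comps.1 hD).1 hz; simp [hSeq] at this
    exact not_ebd_eq_two hx hdx hxD hyD hzD h1.ne hxy hxz hD2

end Env

/-! ### Connected sets -/

lemma ConnOn.congr {R : Finset V} (hR : ConnOn G R) (h : ∀ u ∈ R, ∀ v ∈ R, G.Adj u v → H.Adj u v) :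
    ConnOn H R :=
  fun X hX hne hcl => hR X hX hne fun u hu v hv huv => hcl u hu v hv (h u (hX hu) v hv huv)

lemma connOn_singleton (v : V) : ConnOn G {v} := by
  intro X hX hne _
  exact (subset_singleton_iff.1 hX).resolve_left hne.ne_empty

lemma ConnOn.subset_of_closed {R C Q : Finset V} (hR : ConnOn H R) (hRQ : R ⊆ Q)
    (hC : ∀ u ∈ C, ∀ v ∈ Q, H.Adj u v → v ∈ C) {v : V} (hvR : v ∈ R) (hvC : v ∈ C) : R ⊆ C := by
  have := hR (R ∩ C) inter_subset_left ⟨v, by simp [hvR, hvC]⟩ fun u hu z hz huz => by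
    simp only [mem_inter] at hu ⊢
    exact ⟨hz, hC u hu.2 z (hRQ hz) huz⟩
  exact inter_eq_left.1 this

lemma ConnOn.union {A B : Finset V} (hA : ConnOn H A) (hB : ConnOn H B) {a b : V} (ha : a ∈ A)
    (hb : b ∈ B) (hab : H.Adj a b) : ConnOn H (A ∪ B) := by
  intro X hX hne hcl
  have hA' : ∀ v ∈ A, v ∈ X → A ⊆ X := fun v hv hvX =>
    hA.subset_of_closed subset_union_left hcl hv hvX
  have hB' : ∀ v ∈ B, v ∈ X → B ⊆ X := fun v hv hvX =>
    hB.subset_of_closed subset_union_right hcl hv hvX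
  obtain ⟨v, hv⟩ := hne
  refine subset_antisymm hX (union_subset_iff.2 ?_)
  rcases mem_union.1 (hX hv) with hvA | hvB
  · have h1 := hA' v hvA hv
    exact ⟨h1, hB' b hb (hcl a (h1 ha) b (by simp [hb]) hab)⟩
  · have h1 := hB' v hvB hv
    exact ⟨hA' a ha (hcl b (h1 hb) a (by simp [ha]) hab.symm), h1⟩

lemma ConnOn.insert {A : Finset V} (hA : ConnOn H A) {a b : V} (ha : a ∈ A)
    (hab : H.Adj a b) : ConnOn H (insert b A) := by
  rw [insert_eq, union_comm]
  exact hA.union (connOn_singleton b) ha (mem_singleton_self b) hab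

/-- Removing a non-cut exit keeps a set with two exits connected. -/
lemma TwoExit.connOn_erase {C : Finset V} {p x q u : V} (h : TwoExit G C p x q u)
    (hp : NonCut G p) : ConnOn G (C.erase p) := by
  have key : ∀ Z ⊆ C.erase p, Z.Nonempty → (∀ u ∈ Z, ∀ v ∈ C.erase p, G.Adj u v → v ∈ Z) →
      q ∈ Z := by
    intro Z hZ hne hcl
    by_contra hq
    have := hp Z (fun v hv => by simpa using (mem_erase.1 (hZ hv)).1) hne fun a ha b hb hab => by
      have haC := mem_erase.1 (hZ ha)
      by_cases hbC : b ∈ C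
      · exact hcl a ha b (mem_erase.2 ⟨by simpa using hb, hbC⟩) hab
      · rcases h.exit a haC.2 b hbC hab with h1 | h1
        · exact absurd h1.1 haC.1
        · exact absurd (h1.1 ▸ ha) hq
    have hx : x ∈ Z := by rw [this]; simpa using h.px.ne'
    exact h.hx (mem_of_mem_erase (hZ hx))
  intro Z hZ hne hcl
  by_contra hZne
  have h1 := key Z hZ hne hcl
  have h2 := key (C.erase p \ Z) sdiff_subset (by
    rw [sdiff_nonempty]; exact fun h => hZne (subset_antisymm hZ h)) fun a ha b hb hab => by
      refine mem_sdiff.2 ⟨hb, fun hbZ => (mem_sdiff.1 ha).2 ?_⟩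
      exact hcl b hbZ a (mem_sdiff.1 ha).1 hab.symm
  exact (mem_sdiff.1 h2).2 h1

lemma TwoExit.compl (hbl : BL G) {C : Finset V} {p x q u : V} (h : TwoExit G C p x q u)
    (hpq : p ≠ q) : TwoExit G Cᶜ x p u q where
  hp := mem_compl.2 h.hx
  hq := mem_compl.2 h.hu
  hx := by simpa using h.hp
  hu := by simpa using h.hq
  ne := hpq
  px := h.px.symm
  qu := h.qu.symm
  exit v hv z hz hvz := by
    rw [mem_compl] at hv hz
    rcases h.exit z (not_not.1 hz) v hv hvz.symm with h1 | h1
    · exact Or.inl h1.symm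
    · exact Or.inr h1.symm
  conn := h.connOn_compl hbl

lemma ebd_compl (G : SimpleGraph V) (C : Finset V) : ebd G Cᶜ = ebd G C := by
  rw [ebd, ebd, compl_compl, sum_dg_comm]

namespace Env

/-- A connected set attached to a vertex `x` and to neighbours of `x` has three leaving edges. -/
lemma three_le_ebd (E : Env G c) {x : V} {S C : Finset V} (hx : NonCut G x) (hdx : 3 ≤ deg G x)
    (hS : ∀ u ∈ S, G.Adj x u ∧ NonCut G u ∧ 3 ≤ deg G u ∧ ∀ C, ¬ Thread G C x u)
    (hne : C.Nonempty) (hconn : ConnOn G C) (hxC : x ∉ C)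
    (hexit : ∀ v ∈ C, ∀ z ∉ C, G.Adj v z → z = x ∨ z ∈ S)
    (hreg : ∀ p a q b, TwoExit G C p a q b → (a = x ∨ a ∈ S) → (b = x ∨ b ∈ S) →
      (∃ v ∈ C, 3 ≤ deg G v) → False) : 3 ≤ ebd G C := by
  by_contra hlt
  obtain ⟨v₀, hv₀⟩ := hne
  have hge := ebd_pos E.bl hv₀ hxC
  obtain ⟨p, a, q, b, hp, hq, ha, hb, hpa, hqb, hne, hex⟩ := exists_exits (G := G) (X := C) (by omega)
  have ha' := hexit p hp a ha hpa
  have hb' := hexit q hq b hb hqb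
  by_cases hab : a = b
  · subst hab
    have hprop : NonCut G a ∧ 3 ≤ deg G a := by
      rcases ha' with rfl | h
      · exact ⟨hx, hdx⟩
      · exact ⟨(hS a h).2.1, (hS a h).2.2.1⟩
    have := eq_compl_of_exit hprop.1 ⟨v₀, hv₀⟩ ha fun v hv z hz hvz => by
      rcases hex v hv z hz hvz with h | h <;> exact h.2
    rw [this, ebd_compl, ebd_singleton] at hlt
    omega
  · have htwo : TwoExit G C p a q b := ⟨hp, hq, ha, hb, hab, hpa, hqb, hex, hconn⟩
    by_cases h3 : ∃ v ∈ C, 3 ≤ deg G v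
    · exact hreg p a q b htwo ha' hb' h3
    · push Not at h3
      have hthread : Thread G C a b := ⟨⟨p, q, htwo⟩, fun v hv => by
        have h1 := h3 v hv
        have h2 := E.bl.two_le_deg (v := v) (z := x) (by rintro rfl; exact hxC hv)
        omega⟩
      rcases ha' with rfl | ha' <;> rcases hb' with rfl | hb'
      · exact hab rfl
      · exact (hS b hb').2.2.2 C hthread
      · exact (hS a ha').2.2.2 C hthread.symm
      · exact E.no_odd_thread hx hdx (hS a ha').1 (hS b hb').1 (hS a ha').2.2.1
          (hS b hb').2.2.1 hthread

/-- Either some full state keeps the weighted degrees in `Y` below that of `x`, or there is an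
obstruction `S ⊆ Y`. -/
lemma full_or_violator (E : Env G c) (hHG : H ≤ G) {x : V} (hxH : ConnOn H {x}ᶜ)
    (hx : NonCut G x) (hdx : 3 ≤ deg G x) {Y : Finset V}
    (hY : ∀ u ∈ Y, G.Adj x u ∧ NonCut G u ∧ dg H {x}ᶜ u + 1 ≤ deg G x ∧
      (dg H {x}ᶜ u + 2 ≤ deg G x ∨ deg G u ≤ deg G x)) :
    (∃ w, IsFull G c x w ∧ ∀ u ∈ Y, sd G w u < deg G x) ∨
    ∃ S ⊆ Y, S.Nonempty ∧ (∀ u ∈ S, G.Adj x u ∧ NonCut G u ∧ 3 ≤ deg G u ∧ ∀ C, ¬ Thread G C x u) ∧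
      (∀ u ∈ S, dg H {x}ᶜ u + 1 = deg G x ∧ deg G u = deg G x) ∧
      #S * deg G x + 2 ≤ #(comps H ({x}ᶜ \ S)) + 3 * #S := by
  have hbig : ∀ u ∈ Y, ¬ (dg H {x}ᶜ u + 2 ≤ deg G x) →
      dg H {x}ᶜ u + 1 = deg G x ∧ deg G u = deg G x := by
    intro u hu hn
    obtain ⟨h1, h2, h3, h4⟩ := hY u hu
    have h5 := dg_mono_left hHG {x}ᶜ u
    have h6 := dg_compl_singleton (H := G) x u
    rw [if_pos h1.symm] at h6
    omega
  rcases exists_full (U := {u ∈ Y | ¬ (dg H {x}ᶜ u + 2 ≤ deg G x) ∧ ∀ C, ¬ Thread G C x u})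
    E.bip E.odd hHG hxH (fun u hu => (hY u (mem_filter.1 hu).1).1) with
    ⟨w, hw, hw1, hwU⟩ | ⟨S, hSU, hS, hle⟩
  · refine Or.inl ⟨w, hw, fun u hu => ?_⟩
    obtain ⟨h1, h2, h3, h4⟩ := hY u hu
    have h5 := hw1 u h1
    by_cases hn : dg H {x}ᶜ u + 2 ≤ deg G x
    · omega
    by_cases ht : ∀ C, ¬ Thread G C x u
    · have := hwU u (mem_filter.2 ⟨hu, hn, ht⟩)
      omega
    · push Not at ht
      obtain ⟨C, hC⟩ := ht
      have h6 := hbig u hu hn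
      have := hw.sd_lt_of_thread E.bip h1 hC
        (E.noEar x u C h1 hx h2 hdx (by omega) hC)
      omega
  · have hSY : S ⊆ Y := fun u hu => (mem_filter.1 (hSU hu)).1
    have hSb : ∀ u ∈ S, dg H {x}ᶜ u + 1 = deg G x ∧ deg G u = deg G x := fun u hu =>
      hbig u (hSY hu) (mem_filter.1 (hSU hu)).2.1
    refine Or.inr ⟨S, hSY, hS, fun u hu => ?_, hSb, ?_⟩
    · have := hSb u hu
      exact ⟨(hY u (hSY hu)).1, (hY u (hSY hu)).2.1, by omega, (mem_filter.1 (hSU hu)).2.2⟩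
    · have h1 : ∑ u ∈ S, (dg H {x}ᶜ u + 1) = ∑ u ∈ S, deg G x :=
        sum_congr rfl fun u hu => (hSb u hu).1
      rw [sum_add_distrib, sum_const, sum_const] at h1
      simp only [smul_eq_mul, mul_one] at h1
      omega

/-- The number of edges leaving the components of `G - x - S`. -/
lemma sum_ebd_violator (E : Env G c) {x : V} {S : Finset V}
    (hS : ∀ u ∈ S, G.Adj x u ∧ deg G u = deg G x) :
    ∑ C ∈ comps G ({x}ᶜ \ S), ebd G C + 2 * #S = #S * deg G x + deg G x := by
  have hxS : x ∉ S := fun h => (hS x h).1.ne rfl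
  have hcompl : ({x}ᶜ \ S)ᶜ = insert x S := by ext; simp; tauto
  have hSx : S ⊆ {x}ᶜ := fun v hv => by simpa using (hS v hv).1.ne'
  rw [sum_ebd_comps, hcompl, sum_insert hxS]
  have h1 : dg G ({x}ᶜ \ S) x + #S = deg G x := by
    have h2 := dg_sdiff_add (H := G) hSx x
    have h3 : dg G S x = #S := congrArg card (filter_true_of_mem fun u hu => (hS u hu).1)
    have h4 := dg_compl_singleton (H := G) x x
    simp only [SimpleGraph.irrefl, if_false] at h4
    omega
  have h2 : ∑ u ∈ S, (dg G ({x}ᶜ \ S) u + 1) = ∑ u ∈ S, deg G x := by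
    refine sum_congr rfl fun u hu => ?_
    have h2 := dg_sdiff_add (H := G) hSx u
    have h3 : dg G S u = 0 := dg_eq_zero.2 fun v hv huv =>
      E.bip.ne huv ((E.bip (hS u hu).1).trans (E.bip (hS v hv).1).symm)
    have h4 := dg_compl_singleton (H := G) x u
    rw [if_pos (hS u hu).1.symm] at h4
    have := (hS u hu).2
    omega
  rw [sum_add_distrib, sum_const, sum_const] at h2
  simp only [smul_eq_mul, mul_one] at h2
  omega

end Env

lemma three_mul_card_le {ι : Type*} {s : Finset ι} {f : ι → ℕ} {i : ι} (hi : i ∈ s)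
    (h : ∀ j ∈ s, j ≠ i → 3 ≤ f j) : 3 * #s + f i ≤ ∑ j ∈ s, f j + 3 := by
  have h1 := sum_erase_add s f hi
  have h2 := card_nsmul_le_sum (s.erase i) (fun j => f j) 3 fun j hj =>
    h j (mem_of_mem_erase hj) (mem_erase.1 hj).1
  have h3 := card_erase_add_one hi
  rw [smul_eq_mul] at h2
  omega

lemma three_mul_card_le_of_two {ι : Type*} {s : Finset ι} {f : ι → ℕ} {i k : ι} (hi : i ∈ s)
    (hk : k ∈ s) (hki : k ≠ i) (h : ∀ j ∈ s, j ≠ i → 3 ≤ f j) :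
    3 * #s + f i + f k ≤ ∑ j ∈ s, f j + 6 := by
  have h1 := sum_erase_add s f hi
  have h2 := three_mul_card_le (f := f) (mem_erase.2 ⟨hki, hk⟩) fun j hj _ =>
    h j (mem_of_mem_erase hj) (mem_erase.1 hj).1
  have h3 := card_erase_add_one hi
  omega

lemma IsComp.exit {x : V} {S C : Finset V} (hC : IsComp G ({x}ᶜ \ S) C) {v z : V} (hv : v ∈ C)
    (hz : z ∉ C) (hvz : G.Adj v z) : z = x ∨ z ∈ S := by
  by_contra hn
  push Not at hn
  exact hz (hC.2.2.1 v hv z (by simp [hn.1, hn.2]) hvz)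

lemma IsComp.notMem {x : V} {S C : Finset V} (hC : IsComp G ({x}ᶜ \ S) C) : x ∉ C := fun hx => by
  simpa using hC.1 hx

lemma IsComp.notMem_of_mem {x : V} {S C : Finset V} (hC : IsComp G ({x}ᶜ \ S) C) {u : V}
    (hu : u ∈ S) : u ∉ C := fun hx => by
  simpa [hu] using hC.1 hx

/-- Adjoining a vertex with two neighbours in `C`. -/
lemma TwoExit.of_insert {C : Finset V} {x u u' : V} (hC : ConnOn G C) (hxC : x ∉ C) (huC : u ∉ C)
    (hu'C : u' ∉ C) (huu' : u ≠ u') (hxu' : x ≠ u') (hxu : G.Adj x u) (hdeg : deg G u = 3)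
    (h2 : dg G C u = 2) (h1 : dg G C u' = 1)
    (hexit : ∀ v ∈ C, ∀ z ∉ C, G.Adj v z → z = u ∨ z = u') :
    ∃ t, TwoExit G (insert u C) u x t u' := by
  obtain ⟨s, hs, hus⟩ := exists_adj_of_dg_pos (H := G) (R := C) (u := u) (by omega)
  obtain ⟨t, ht⟩ := card_eq_one.1 h1
  have ht' : ∀ v, v ∈ C ∧ G.Adj u' v ↔ v = t := fun v => by
    simpa using Finset.ext_iff.1 ht v
  obtain ⟨htC, htu⟩ := (ht' t).2 rfl
  have hnb : ∀ z, G.Adj u z → z ∉ C → z = x := by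
    intro z huz hz
    by_contra hzx
    have h4 : dg G ({x, z} : Finset V) u = 2 := by
      rw [dg, filter_true_of_mem, card_pair (Ne.symm hzx)]
      intro v hv
      simp only [mem_insert, mem_singleton] at hv
      rcases hv with rfl | rfl
      · exact hxu.symm
      · exact huz
    have h5 : dg G (C ∪ {x, z}) u = _ := dg_union G (by
      rw [Finset.disjoint_left]; intro v hv hv'
      simp only [mem_insert, mem_singleton] at hv'
      rcases hv' with rfl | rfl
      · exact hxC hv
      · exact hz hv) u
    have h6 := dg_mono G (subset_univ (C ∪ {x, z})) u
    rw [deg] at hdeg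
    omega
  refine ⟨t, ⟨mem_insert_self _ _, mem_insert_of_mem htC, ?_, ?_, hxu', hxu.symm, htu.symm, ?_, ?_⟩⟩
  · simp [hxC, hxu.ne]
  · simp [hu'C, huu'.symm]
  · intro v hv z hz hvz
    simp only [mem_insert, not_or] at hv hz
    rcases hv with rfl | hv
    · exact Or.inl ⟨rfl, hnb z hvz hz.2⟩
    · rcases hexit v hv z hz.2 hvz with rfl | rfl
      · exact absurd rfl hz.1
      · exact Or.inr ⟨(ht' v).1 ⟨hv, hvz.symm⟩, rfl⟩
  · exact hC.insert hs hus.symm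

lemma IsComp.exists_twoExit_insert {x u₁ u₂ : V} {C : Finset V}
    (hC : IsComp G ({x}ᶜ \ {u₁, u₂}) C) (hu12 : u₁ ≠ u₂)
    (hS : ∀ u ∈ ({u₁, u₂} : Finset V), G.Adj x u ∧ deg G u = 3)
    (hxnb : ∀ v ∈ C, ¬ G.Adj v x) (hC3 : ebd G C = 3) :
    ∃ u ∈ ({u₁, u₂} : Finset V), ∃ u' ∈ ({u₁, u₂} : Finset V), ∃ t,
      TwoExit G (insert u C) u x t u' := by
  have hxC := hC.notMem
  have hxS : x ∉ ({u₁, u₂} : Finset V) := fun hx => (hS x hx).1.ne rfl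
  have hexit : ∀ v ∈ C, ∀ z ∉ C, G.Adj v z → z = u₁ ∨ z = u₂ := fun v hv z hz hvz => by
    rcases hC.exit hv hz hvz with rfl | hz
    · exact absurd hvz (hxnb v hv)
    · simpa using hz
  have hcount : dg G C u₁ + dg G C u₂ = ebd G C := by
    rw [hC.ebd_eq, sum_dg_comm]
    have hcompl : ({x}ᶜ \ {u₁, u₂})ᶜ = ({x, u₁, u₂} : Finset V) := by ext; simp; tauto
    rw [hcompl, sum_insert hxS, sum_pair hu12,
      dg_eq_zero.2 fun v hv hxv => hxnb v hv hxv.symm, zero_add]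
  have hle2 : ∀ u ∈ ({u₁, u₂} : Finset V), dg G C u ≤ 2 := fun u hu => by
    have h1 := dg_mono G (fun v hv => by
      simp only [mem_compl, mem_singleton]; rintro rfl; exact hxC hv : C ⊆ {x}ᶜ) u
    have h2 := dg_compl_singleton (H := G) x u
    rw [if_pos (hS u hu).1.symm] at h2
    have := (hS u hu).2
    omega
  have h₁ : u₁ ∈ ({u₁, u₂} : Finset V) := by simp
  have h₂ : u₂ ∈ ({u₁, u₂} : Finset V) := by simp
  have h1 := hle2 u₁ h₁
  have h2 := hle2 u₂ h₂
  rcases (by omega : dg G C u₁ = 2 ∧ dg G C u₂ = 1 ∨ dg G C u₂ = 2 ∧ dg G C u₁ = 1) with hh | hh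
  · obtain ⟨t, ht⟩ := TwoExit.of_insert hC.2.2.2 hxC (hC.notMem_of_mem h₁)
      (hC.notMem_of_mem h₂) hu12 (hS u₂ h₂).1.ne (hS u₁ h₁).1 (hS u₁ h₁).2 hh.1 hh.2 hexit
    exact ⟨u₁, h₁, u₂, h₂, t, ht⟩
  · obtain ⟨t, ht⟩ := TwoExit.of_insert hC.2.2.2 hxC (hC.notMem_of_mem h₂)
      (hC.notMem_of_mem h₁) hu12.symm (hS u₁ h₁).1.ne (hS u₂ h₂).1 (hS u₂ h₂).2 hh.1 hh.2
      fun v hv z hz hvz => (hexit v hv z hz hvz).symm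
    exact ⟨u₂, h₂, u₁, h₁, t, ht⟩

/-- A region: a set left by exactly two edges, with a vertex of degree at least three, none of
whose vertices or exits is a cut vertex. -/
structure Region (G : SimpleGraph V) (R : Finset V) (a a' b b' : V) : Prop where
  two : TwoExit G R a a' b b'
  branch : ∃ v ∈ R, 3 ≤ deg G v
  noncut : ∀ v ∈ R, NonCut G v
  noncut_left : NonCut G a'
  noncut_right : NonCut G b'

namespace Region

lemma symm {R : Finset V} {a a' b b' : V} (h : Region G R a a' b b') : Region G R b b' a a' :=
  ⟨h.two.symm, h.branch, h.noncut, h.noncut_right, h.noncut_left⟩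

lemma ne {R : Finset V} {a a' b b' : V} (h : Region G R a a' b b') : a ≠ b := by
  rintro rfl
  have hRa : R = {a} := by
    by_contra hne
    have hne' : (R.erase a).Nonempty := by
      by_contra hn
      rw [not_nonempty_iff_eq_empty, erase_eq_empty_iff] at hn
      rcases hn with hn | hn
      · have := h.two.hp; simp [hn] at this
      · exact hne hn
    have := Env.eq_compl_of_exit (h.noncut a h.two.hp) hne' (notMem_erase a R)
      fun v hv z hz hvz => by
        by_contra hza
        have hzR : z ∉ R := fun hzR => hz (mem_erase.2 ⟨hza, hzR⟩)
        rcases h.two.exit v (mem_of_mem_erase hv) z hzR hvz with h | h <;>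
        exact (mem_erase.1 hv).1 h.1
    have ha' : a' ∈ R.erase a := by rw [this]; simpa using h.two.px.ne'
    exact h.two.hx (mem_of_mem_erase ha')
  have h1 := h.two.dg_compl h.two.hp
  obtain ⟨v, hv, h3⟩ := h.branch
  have hva : v = a := by rwa [hRa, mem_singleton] at hv
  rw [hva, deg, ← dg_add_compl G R, h1, hRa, dg_singleton] at h3
  simp at h3

/-- A region whose first attachment vertex has degree two can be shrunk. -/
lemma shrink {R : Finset V} {a a' b b' : V} (h : Region G R a a' b b') (ha : deg G a < 3) :
    ∃ a₁, Region G (R.erase a) a₁ a b b' := by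
  have hab := h.ne
  have h1 := h.two.dg_compl h.two.hp
  simp only [if_true, hab, if_false, add_zero] at h1
  have h2 := dg_add_compl G R a
  have hb : b ∈ R.erase a := mem_erase.2 ⟨hab.symm, h.two.hq⟩
  have hpos : 0 < dg G R a := by
    by_contra hz
    have hz := dg_eq_zero.1 (Nat.eq_zero_of_not_pos hz)
    have := h.two.conn {a} (by simpa using h.two.hp) (singleton_nonempty a) fun u hu v hv huv => by
      rw [mem_singleton] at hu
      subst hu
      exact absurd huv (hz v hv)
    have hb' := h.two.hq
    rw [← this, mem_singleton] at hb'
    exact hab hb'.symm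
  have h3 : dg G R a = 1 := by unfold deg at ha; omega
  obtain ⟨a₁, ha₁⟩ := card_eq_one.1 h3
  have ha₁' : ∀ v, v ∈ R ∧ G.Adj a v ↔ v = a₁ := fun v => by
    simpa using Finset.ext_iff.1 ha₁ v
  obtain ⟨ha₁R, haa₁⟩ := (ha₁' a₁).2 rfl
  refine ⟨a₁, ⟨⟨mem_erase.2 ⟨haa₁.ne', ha₁R⟩, hb, notMem_erase a R,
    fun hb' => h.two.hu (mem_of_mem_erase hb'), ?_, haa₁.symm, h.two.qu, ?_,
    h.two.connOn_erase (h.noncut a h.two.hp)⟩, ?_, fun v hv => h.noncut v (mem_of_mem_erase hv),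
    h.noncut a h.two.hp, h.noncut_right⟩⟩
  · rintro rfl; exact h.two.hu h.two.hp
  · intro v hv z hz hvz
    by_cases hza : z = a
    · subst hza
      exact Or.inl ⟨(ha₁' v).1 ⟨mem_of_mem_erase hv, hvz.symm⟩, rfl⟩
    · have hzR : z ∉ R := fun hzR => hz (mem_erase.2 ⟨hza, hzR⟩)
      exact (h.two.exit v (mem_of_mem_erase hv) z hzR hvz).imp_left
        fun h1 => absurd h1.1 (mem_erase.1 hv).1
  · obtain ⟨v, hv, hv3⟩ := h.branch
    exact ⟨v, mem_erase.2 ⟨by rintro rfl; omega, hv⟩, hv3⟩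

end Region

lemma ConnOn.exists_adj {R : Finset V} (hR : ConnOn H R) {a b : V} (ha : a ∈ R) (hb : b ∈ R)
    (hab : a ≠ b) : ∃ v ∈ R, H.Adj a v := by
  by_contra hz
  push Not at hz
  have := hR {a} (by simpa using ha) (singleton_nonempty a) fun u hu v hv huv => by
    rw [mem_singleton] at hu
    subst hu
    exact absurd huv (hz v hv)
  rw [← this, mem_singleton] at hb
  exact hab hb.symm

/-- The edges at an exit of a region can be thinned out. -/
lemma Region.exists_thin (hbl : BL G) {R : Finset V} {a a' b b' : V} (h : Region G R a a' b b') :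
    ∃ H ≤ G, ConnOn H {a}ᶜ ∧ ConnOn H Rᶜ ∧
      (∀ u v, G.Adj u v → ¬ H.Adj u v → u ∉ R ∧ v ∉ R) ∧ dg H {a}ᶜ a' ≤ 1 := by
  have hab := h.ne
  have hc := h.two.compl hbl hab
  obtain ⟨o, ho, hao⟩ := hc.conn.exists_adj hc.hp hc.hq h.two.ne
  have hoR := mem_compl.1 ho
  let H := G.deleteEdges {e | ∃ v ∉ R, v ≠ o ∧ e = s(a', v)}
  have hH : ∀ {u v}, H.Adj u v ↔ G.Adj u v ∧ ¬ ∃ t ∉ R, t ≠ o ∧ s(u, v) = s(a', t) := by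
    intro u v; rw [SimpleGraph.deleteEdges_adj]; rfl
  have hR1 : ∀ {u v}, G.Adj u v → u ∈ R → H.Adj u v := by
    intro u v huv hu
    refine hH.2 ⟨huv, ?_⟩
    rintro ⟨t, ht, -, he⟩
    rcases Sym2.eq_iff.1 he with ⟨rfl, -⟩ | ⟨rfl, -⟩
    · exact h.two.hx hu
    · exact ht hu
  have hO1 : ConnOn H (Rᶜ.erase a') := by
    refine (hc.connOn_erase h.noncut_left).congr fun u hu v hv huv => hH.2 ⟨huv, ?_⟩
    rintro ⟨t, ht, -, he⟩
    rcases Sym2.eq_iff.1 he with ⟨rfl, -⟩ | ⟨-, rfl⟩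
    · exact (mem_erase.1 hu).1 rfl
    · exact (mem_erase.1 hv).1 rfl
  have hao' : H.Adj o a' := by
    refine (hH.2 ⟨hao, ?_⟩).symm
    rintro ⟨t, ht, hto, he⟩
    rcases Sym2.eq_iff.1 he with ⟨-, h1⟩ | ⟨-, h1⟩
    · exact hto h1.symm
    · exact hao.ne' h1
  have hO : ConnOn H Rᶜ := by
    have := hO1.insert (mem_erase.2 ⟨hao.ne', ho⟩) hao'
    rwa [insert_erase hc.hp] at this
  refine ⟨H, SimpleGraph.deleteEdges_le _, ?_, hO, fun u v huv hn =>
    ⟨fun hu => hn (hR1 huv hu), fun hv => hn (hR1 huv.symm hv).symm⟩, ?_⟩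
  · have hRa : ConnOn H (R.erase a) := (h.two.connOn_erase (h.noncut a h.two.hp)).congr
      fun u hu v _ huv => hR1 huv (mem_of_mem_erase hu)
    have := hRa.union hO (mem_erase.2 ⟨hab.symm, h.two.hq⟩) hc.hq (hR1 h.two.qu h.two.hq)
    convert this using 1
    ext v
    have := h.two.hp
    by_cases hv : v = a
    · simp [hv, this]
    · simp [hv, em]
  · rw [dg, ← card_singleton o]
    refine card_le_card fun v hv => ?_
    simp only [mem_filter, mem_compl, mem_singleton] at hv ⊢
    obtain ⟨hva, hv⟩ := hv
    obtain ⟨hv1, hv2⟩ := hH.1 hv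
    by_contra hvo
    refine hv2 ⟨v, fun hvR => ?_, hvo, rfl⟩
    rcases h.two.exit v hvR a' h.two.hx hv1.symm with h1 | h1
    · exact hva h1.1
    · exact h.two.ne h1.2

namespace Env

lemma no_region_of_max (E : Env G c) {R : Finset V} {a a' b b' : V} (h : Region G R a a' b b')
    (ih : ∀ R' : Finset V, #R' < #R → ∀ p x q u, ¬ Region G R' p x q u) (ha : 3 ≤ deg G a) {x : V}
    (hxR : x ∈ R) (hmax : ∀ v ∈ R, deg G v ≤ deg G x) (hxb : x ≠ b) (h3 : deg G x = 3 → x = a) :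
    False := by
  have hab := h.ne
  have hdx : 3 ≤ deg G x := ha.trans (hmax a h.two.hp)
  have hx := h.noncut x hxR
  have hOG := h.two.connOn_compl E.bl
  obtain ⟨H, hHG, hHx, hHO, hHR, hHa⟩ : ∃ H ≤ G, ConnOn H {x}ᶜ ∧ ConnOn H Rᶜ ∧
      (∀ u v, G.Adj u v → ¬ H.Adj u v → u ∉ R ∧ v ∉ R) ∧ (G.Adj x a' → dg H {x}ᶜ a' ≤ 1) := by
    by_cases hxa : x = a
    · subst hxa
      obtain ⟨H, h1, h2, h3, h4, h5⟩ := h.exists_thin E.bl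
      exact ⟨H, h1, h2, h3, h4, fun _ => h5⟩
    · refine ⟨G, le_rfl, hx, hOG, fun u v h1 h2 => absurd h1 h2, fun hxa' => ?_⟩
      rcases h.two.exit x hxR a' h.two.hx hxa' with h1 | h1
      · exact absurd h1.1 hxa
      · exact absurd h1.1 hxb
  have hout : ∀ u, G.Adj x u → u ∉ R → u = a' := fun u hxu hu => by
    rcases h.two.exit x hxR u hu hxu with h1 | h1
    · exact h1.2
    · exact absurd h1.1 hxb
  have hdg : ∀ u, G.Adj x u → dg H {x}ᶜ u + 1 ≤ deg G u := fun u hxu => by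
    have h5 := dg_mono_left hHG {x}ᶜ u
    have h6 := dg_compl_singleton (H := G) x u
    rw [if_pos hxu.symm] at h6
    omega
  rcases E.full_or_violator hHG hHx hx hdx (Y := {u | G.Adj x u}) (fun u hu => by
    have hxu : G.Adj x u := by simpa using hu
    by_cases huR : u ∈ R
    · have := hdg u hxu
      have := hmax u huR
      exact ⟨hxu, h.noncut u huR, by omega, by omega⟩
    · have := hout u hxu huR
      subst this
      have := hHa hxu
      exact ⟨hxu, h.noncut_left, by omega, by omega⟩) with ⟨w, hw, hlt⟩ | ⟨S, hSY, hS, hS1, hS2, hle⟩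
  · obtain ⟨u, hxu, hu⟩ := hw.exists_conflict E.bip E.bad
    exact (hlt u (by simpa using hxu)).ne hu
  have hSR : ∀ u ∈ S, u ∈ R := fun u hu => by
    by_contra huR
    have := hout u (hS1 u hu).1 huR
    subst this
    have := hHa (hS1 _ hu).1
    have := (hS2 _ hu).1
    omega
  have hxS : x ∉ S := fun hx => (hS1 x hx).1.ne rfl
  have hOQ : Rᶜ ⊆ {x}ᶜ \ S := fun v hv => by
    rw [mem_compl] at hv
    simp only [mem_sdiff, mem_compl, mem_singleton]
    exact ⟨by rintro rfl; exact hv hxR, fun hvS => hv (hSR v hvS)⟩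
  rw [comps_eq_of_closed hHG fun C hC u hu v hv huv => by
    by_cases hH : H.Adj u v
    · exact (mem_comps.1 hC).2.2.1 u hu v hv hH
    · obtain ⟨hu', hv'⟩ := hHR u v huv hH
      exact hHO.subset_of_closed hOQ (mem_comps.1 hC).2.2.1 (mem_compl.2 hu') hu
        (mem_compl.2 hv')] at hle
  obtain ⟨D, hD, haD⟩ := exists_mem_comps G (hOQ (mem_compl.2 h.two.hx))
  have hOD : Rᶜ ⊆ D := hOG.subset_of_closed hOQ (mem_comps.1 hD).2.2.1 (mem_compl.2 h.two.hx) haD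
  have hD2 : 2 ≤ ebd G D := ebd_pos E.bl haD (mem_comps.1 hD).notMem
  have hCR : ∀ C ∈ comps G ({x}ᶜ \ S), C ≠ D → C ⊆ R := fun C hC hCD v hv => by
    by_contra hvR
    exact hCD ((mem_comps.1 hC).eq_of_mem (mem_comps.1 hD) hv (hOD (mem_compl.2 hvR)))
  have hnc : ∀ z, z = x ∨ z ∈ S → NonCut G z := fun z hz => by
    rcases hz with rfl | hz
    · exact hx
    · exact (hS1 z hz).2.1
  have hC3 : ∀ C ∈ comps G ({x}ᶜ \ S), C ≠ D → 3 ≤ ebd G C := fun C hC hCD => by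
    have hC' := mem_comps.1 hC
    have hCR' := hCR C hC hCD
    refine E.three_le_ebd hx hdx hS1 hC'.2.1 hC'.2.2.2 hC'.notMem
      (fun v hv z hz hvz => hC'.exit hv hz hvz) fun p α q β htwo hα hβ hbr => ?_
    refine ih C (card_lt_card ⟨hCR', fun hRC => hC'.notMem (hRC hxR)⟩) p α q β
      ⟨htwo, hbr, fun v hv => h.noncut v (hCR' hv), hnc α hα, hnc β hβ⟩
  have hsum := E.sum_ebd_violator (x := x) (S := S) fun u hu => ⟨(hS1 u hu).1, (hS2 u hu).2⟩
  have hm := three_mul_card_le hD hC3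
  have hk := hS.card_pos
  have hd3 : deg G x = 3 := by
    by_contra hd
    obtain ⟨e, he⟩ : ∃ e, deg G x = e + 4 := ⟨deg G x - 4, by omega⟩
    rw [he, mul_add] at hsum hle
    have : e ≤ #S * e := Nat.le_mul_of_pos_left e hk
    omega
  have hxa := h3 hd3
  subst hxa
  rw [hd3] at hsum hle
  have hk2 : #S ≤ 2 := by
    have h1 : insert a' S ⊆ ({u | G.Adj x u} : Finset V) := insert_subset
      (by simpa using h.two.px) (fun u hu => by simpa using (hS1 u hu).1)
    have h2 := card_le_card h1
    rw [card_insert_of_notMem fun hs => h.two.hx (hSR _ hs)] at h2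
    have : #{u | G.Adj x u} = 3 := hd3
    omega
  have hSc : #S = 2 := by omega
  obtain ⟨u₁, u₂, hu12, rfl⟩ := card_eq_two.1 hSc
  obtain ⟨C, hC, hCD⟩ : ∃ C ∈ comps G ({x}ᶜ \ {u₁, u₂}), C ≠ D :=
    exists_mem_ne (by omega) D
  have hm2 := three_mul_card_le_of_two hD hC hCD hC3
  have hC' := mem_comps.1 hC
  have hC3' := hC3 C hC hCD
  have hCR' := hCR C hC hCD
  have hxC := hC'.notMem
  have hxnb : ∀ v ∈ C, ¬ G.Adj v x := fun v hv hvx => by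
    have h1 : ({u₁, u₂, a'} : Finset V) ⊆ ({u | G.Adj x u} : Finset V) := fun u hu => by
      simp only [mem_insert, mem_singleton] at hu
      rcases hu with rfl | rfl | rfl
      · simpa using (hS1 u (by simp)).1
      · simpa using (hS1 u (by simp)).1
      · simpa using h.two.px
    have hn : ∀ u ∈ ({u₁, u₂} : Finset V), u ≠ a' := fun u hu he =>
      h.two.hx (he ▸ hSR u hu)
    have h2 : ({u₁, u₂, a'} : Finset V) = ({u | G.Adj x u} : Finset V) := by
      refine eq_of_subset_of_card_le h1 ?_
      rw [card_eq_three.2 ⟨u₁, u₂, a', hu12, hn u₁ (by simp), hn u₂ (by simp), rfl⟩]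
      exact hd3.le
    have h3 : v ∈ ({u₁, u₂, a'} : Finset V) := by rw [h2]; simpa using hvx.symm
    simp only [mem_insert, mem_singleton] at h3
    rcases h3 with rfl | rfl | rfl
    · exact hC'.notMem_of_mem (by simp) hv
    · exact hC'.notMem_of_mem (by simp) hv
    · exact h.two.hx (hCR' hv)
  obtain ⟨u, hu, u', hu', t, htwo⟩ := hC'.exists_twoExit_insert hu12
    (fun u hu => ⟨(hS1 u hu).1, hd3 ▸ (hS2 u hu).2⟩) hxnb (by omega)
  have hsub : insert u C ⊆ R := insert_subset (hSR u hu) hCR'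
  exact ih (insert u C) (card_lt_card ⟨hsub, fun hRC => htwo.hx (hRC hxR)⟩) u x t u'
    ⟨htwo, ⟨u, mem_insert_self _ _, (hS1 u hu).2.2.1⟩, fun v hv => h.noncut v (hsub hv), hx,
      (hS1 u' hu').2.1⟩

lemma no_region (E : Env G c) : ∀ (R : Finset V) (a a' b b' : V), ¬ Region G R a a' b b' := by
  intro R
  induction hn : #R using Nat.strong_induction_on generalizing R with
  | _ n ih =>
  subst hn
  intro a a' b b' h
  have ih' : ∀ R' : Finset V, #R' < #R → ∀ p x q u, ¬ Region G R' p x q u :=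
    fun R' hR' => ih _ hR' R' rfl
  have key : ∀ {a a' b b'}, Region G R a a' b b' → 3 ≤ deg G a := by
    intro a a' b b' h
    by_contra hlt
    obtain ⟨a₁, h1⟩ := h.shrink (by omega)
    exact ih' _ (card_erase_lt_of_mem h.two.hp) _ _ _ _ h1
  have ha := key h
  have hb := key h.symm
  obtain ⟨x, hxR, hmax⟩ := exists_max_image R (deg G) ⟨a, h.two.hp⟩
  by_cases h3 : deg G x = 3
  · have hax : deg G a = 3 := le_antisymm (h3 ▸ hmax a h.two.hp) ha
    exact E.no_region_of_max h ih' ha h.two.hp (fun v hv => hax ▸ h3 ▸ hmax v hv) h.ne fun _ => rfl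
  · by_cases hxb : x = b
    · subst hxb
      exact E.no_region_of_max h.symm ih' hb hxR hmax h.ne.symm fun h => absurd h h3
    · exact E.no_region_of_max h ih' ha hxR hmax hxb fun h => absurd h h3

end Env

/-- The neighbours of `x`. -/
noncomputable def nb (G : SimpleGraph V) (x : V) : Finset V := {u | G.Adj x u}

@[simp] lemma mem_nb {x u : V} : u ∈ nb G x ↔ G.Adj x u := by simp [nb]

lemma card_nb (x : V) : #(nb G x) = deg G x := rfl

/-- A set left by two edges only is connected. -/
lemma connOn_of_ebd_eq_two (hbl : BL G) {X : Finset V} (hX : Xᶜ.Nonempty) (h : ebd G X = 2) :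
    ConnOn G X := by
  obtain ⟨z, hz⟩ := hX
  have h1 := sum_ebd_comps G X
  rw [← sum_dg_comm] at h1
  have h2 : ∀ C ∈ comps G X, 2 ≤ ebd G C := fun C hC => by
    obtain ⟨v, hv⟩ := (mem_comps.1 hC).2.1
    exact ebd_pos hbl hv fun hzC => mem_compl.1 hz ((mem_comps.1 hC).1 hzC)
  have h3 := card_nsmul_le_sum (comps G X) (fun D => ebd G D) 2 h2
  rw [smul_eq_mul] at h3
  unfold ebd at h h3 h1
  have hX : X.Nonempty := by
    rw [nonempty_iff_ne_empty]; rintro rfl; simp at h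
  obtain ⟨v, hv⟩ := hX
  obtain ⟨C, hC, hvC⟩ := exists_mem_comps G hv
  have h4 : #(comps G X) = 1 := by
    have := card_pos.2 ⟨C, hC⟩
    omega
  obtain ⟨C', hC'⟩ := card_eq_one.1 h4
  have h5 := comps_biUnion G X
  rw [hC', mem_singleton] at hC
  rw [hC', singleton_biUnion, id] at h5
  rw [← h5]
  exact (mem_comps.1 (hC' ▸ mem_singleton_self C')).2.2.2

namespace Env

lemma noncut_no_region (E : Env G c) (hall : ∀ v, NonCut G v) {C : Finset V} {p a q b : V}
    (h : TwoExit G C p a q b) (hbr : ∃ v ∈ C, 3 ≤ deg G v) : False :=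
  E.no_region C p a q b ⟨h, hbr, fun v _ => hall v, hall a, hall b⟩

/-- Without cut vertices, the neighbourhood of a vertex of maximum degree. -/
lemma structure_at_max (E : Env G c) (hall : ∀ v, NonCut G v) {x : V} (hdx : 3 ≤ deg G x)
    (hmax : ∀ v, deg G v ≤ deg G x) :
    deg G x = 3 ∧ (∀ u, G.Adj x u → deg G u = 3) ∧ #(comps G ({x}ᶜ \ nb G x)) = 2 ∧
      ∀ C ∈ comps G ({x}ᶜ \ nb G x), ∀ u, G.Adj x u → dg G C u = 1 := by
  have hdg : ∀ u, G.Adj x u → dg G {x}ᶜ u + 1 = deg G u := fun u hxu => by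
    have h6 := dg_compl_singleton (H := G) x u
    rwa [if_pos hxu.symm] at h6
  rcases E.full_or_violator le_rfl (hall x) (hall x) hdx (Y := nb G x) (fun u hu => by
    have hxu := mem_nb.1 hu
    have := hdg u hxu
    have := hmax u
    exact ⟨hxu, hall u, by omega, by omega⟩) with ⟨w, hw, hlt⟩ | ⟨S, hSY, hS, hS1, hS2, hle⟩
  · obtain ⟨u, hxu, hu⟩ := hw.exists_conflict E.bip E.bad
    exact absurd hu (hlt u (by simpa using hxu)).ne
  have hC3 : ∀ C ∈ comps G ({x}ᶜ \ S), 3 ≤ ebd G C := fun C hC => by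
    have hC' := mem_comps.1 hC
    exact E.three_le_ebd (hall x) hdx hS1 hC'.2.1 hC'.2.2.2 hC'.notMem
      (fun v hv z hz hvz => hC'.exit hv hz hvz)
      fun p α q β htwo _ _ hbr => E.noncut_no_region hall htwo hbr
  have hsum := E.sum_ebd_violator (x := x) (S := S) fun u hu => ⟨(hS1 u hu).1, (hS2 u hu).2⟩
  have hm := card_nsmul_le_sum (comps G ({x}ᶜ \ S)) (fun D => ebd G D) 3 hC3
  rw [smul_eq_mul] at hm
  have hk := hS.card_pos
  have hkd := card_le_card hSY
  rw [card_nb] at hkd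
  have hd3 : deg G x = 3 := by
    by_contra hd
    obtain ⟨e, he⟩ : ∃ e, deg G x = e + 4 := ⟨deg G x - 4, by omega⟩
    rw [he, mul_add] at hsum hle
    have : e ≤ #S * e := Nat.le_mul_of_pos_left e hk
    omega
  rw [hd3] at hsum hle hkd
  have hSx : S = nb G x := eq_of_subset_of_card_le hSY (by rw [card_nb]; omega)
  have hm2 : #(comps G ({x}ᶜ \ S)) = 2 := by omega
  have hS3 : #S = 3 := by omega
  have hCeq : ∀ C ∈ comps G ({x}ᶜ \ S), ebd G C = 3 := fun C hC => by
    have h1 := sum_erase_add _ (fun D => ebd G D) hC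
    have h2 := card_nsmul_le_sum ((comps G ({x}ᶜ \ S)).erase C) (fun D => ebd G D) 3
      fun D hD => hC3 D (mem_of_mem_erase hD)
    rw [smul_eq_mul, card_erase_of_mem hC] at h2
    have := hC3 C hC
    omega
  have hdeg : ∀ u, G.Adj x u → deg G u = 3 := fun u hu =>
    hd3 ▸ (hS2 u (hSx ▸ mem_nb.2 hu)).2
  have hexit : ∀ C ∈ comps G ({x}ᶜ \ S), ∀ v ∈ C, ∀ z ∉ C, G.Adj v z → z ∈ S := by
    intro C hC v hv z hz hvz
    rcases (mem_comps.1 hC).exit hv hz hvz with rfl | h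
    · exact absurd hv ((mem_comps.1 hC).notMem_of_mem (hSx ▸ mem_nb.2 hvz.symm))
    · exact h
  have hCS : ∀ C ∈ comps G ({x}ᶜ \ S), ∑ u ∈ S, dg G C u = 3 := fun C hC => by
    rw [← hCeq C hC, (mem_comps.1 hC).ebd_eq, sum_dg_comm G C ({x}ᶜ \ S)ᶜ]
    have hcompl : ({x}ᶜ \ S)ᶜ = insert x S := by ext; simp; tauto
    rw [hcompl, sum_insert (by simp [hSx]), dg_eq_zero.2 fun v hv hxv =>
      (mem_comps.1 hC).notMem_of_mem (hSx ▸ mem_nb.2 hxv) hv, zero_add]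
  have hpos : ∀ C ∈ comps G ({x}ᶜ \ S), ∀ u ∈ S, dg G C u ≤ 1 := by
    intro C hC u hu
    by_contra hn
    have hC' := mem_comps.1 hC
    have h2 : dg G C u ≤ 2 := by
      have h1 := dg_mono G (fun v hv => by
        simp only [mem_compl, mem_singleton]; rintro rfl; exact hC'.notMem hv : C ⊆ {x}ᶜ) u
      have := hdg u (hS1 u hu).1
      have := (hS2 u hu).2
      omega
    have h3 := hCS C hC
    rw [← add_sum_erase S _ hu] at h3
    have h4 : ∑ u' ∈ S.erase u, dg G C u' = 1 := by omega
    obtain ⟨u', hu', h5⟩ : ∃ u' ∈ S.erase u, 0 < dg G C u' := by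
      by_contra hn
      push Not at hn
      rw [sum_eq_zero fun u' hu' => Nat.le_zero.1 (hn u' hu')] at h4
      omega
    rw [← add_sum_erase _ _ hu'] at h4
    have h6 : ∀ v ∈ (S.erase u).erase u', dg G C v = 0 := by
      rw [← sum_eq_zero_iff]; omega
    obtain ⟨huu', hu'S⟩ := mem_erase.1 hu'
    obtain ⟨t, ht⟩ := TwoExit.of_insert hC'.2.2.2 hC'.notMem (hC'.notMem_of_mem hu)
      (hC'.notMem_of_mem hu'S) huu'.symm (hS1 u' hu'S).1.ne (hS1 u hu).1 (hdeg u (hS1 u hu).1)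
      (by omega) (by omega) fun v hv z hz hvz => by
        by_contra hzz
        push Not at hzz
        have hzS := hexit C hC v hv z hz hvz
        exact dg_eq_zero.1 (h6 z (by simp [hzz, hzS])) v hv hvz.symm
    exact E.noncut_no_region hall ht ⟨u, mem_insert_self _ _, (hS1 u hu).2.2.1⟩
  rw [← hSx]
  refine ⟨hd3, hdeg, hm2, fun C hC u hu => ?_⟩
  have huS : u ∈ S := hSx ▸ mem_nb.2 hu
  refine le_antisymm (hpos C hC u huS) (Nat.pos_of_ne_zero fun h0 => ?_)
  have h3 := hCS C hC
  rw [← add_sum_erase S _ huS, h0] at h3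
  have h4 : ∑ u' ∈ S.erase u, dg G C u' ≤ ∑ u' ∈ S.erase u, 1 :=
    sum_le_sum fun u' hu' => hpos C hC u' (mem_of_mem_erase hu')
  rw [sum_const, card_erase_of_mem huS] at h4
  simp at h4
  omega

/-- A minimal counterexample with a vertex of degree at least three has a cut vertex. -/
lemma exists_cut (E : Env G c) {v₀ : V} (hv₀ : 3 ≤ deg G v₀) : ∃ v, ¬ NonCut G v := by
  by_contra hall
  push Not at hall
  obtain ⟨x, -, hmax⟩ := exists_max_image univ (deg G) ⟨v₀, mem_univ _⟩
  have hdx := hv₀.trans (hmax v₀ (mem_univ _))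
  have hx3 := (E.structure_at_max hall hdx fun v => hmax v (mem_univ _)).1
  have hstr : ∀ v, deg G v = 3 → _ := fun v hv => E.structure_at_max hall (x := v) hv.ge
    fun u => hv ▸ hx3 ▸ hmax u (mem_univ _)
  have hcubic : ∀ v, deg G v = 3 := by
    have := E.conn {v | deg G v = 3} (subset_univ _) ⟨x, by simpa using hx3⟩
      fun u hu v _ huv => by
        simp only [mem_filter, mem_univ, true_and] at hu ⊢
        exact (hstr u hu).2.1 v huv
    intro v
    have hv := mem_univ v
    rw [← this] at hv
    simpa using hv
  have h3 : ∀ X : Finset V, X.Nonempty → Xᶜ.Nonempty → 3 ≤ ebd G X := by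
    intro X hX hXc
    by_contra hlt
    have h2 := E.bl X hX hXc
    have hconn := connOn_of_ebd_eq_two E.bl hXc (by omega)
    obtain ⟨p, a, q, b, hp, hq, ha, hb, hpa, hqb, -, hex⟩ := exists_exits (G := G) (X := X) (by omega)
    by_cases hab : a = b
    · subst hab
      have := eq_compl_of_exit (hall a) hX ha fun v hv z hz hvz => by
        rcases hex v hv z hz hvz with h | h <;> exact h.2
      rw [this, ebd_compl, ebd_singleton, hcubic] at hlt
      omega
    · exact E.noncut_no_region hall ⟨hp, hq, ha, hb, hab, hpa, hqb, hex, hconn⟩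
        ⟨p, hp, (hcubic p).ge⟩
  obtain ⟨-, -, hm, hone⟩ := hstr x hx3
  have hex : ∀ C ∈ comps G ({x}ᶜ \ nb G x), ∀ v ∈ C, ∀ z ∉ C, G.Adj v z → G.Adj x z := by
    intro C hC v hv z hz hvz
    rcases (mem_comps.1 hC).exit hv hz hvz with rfl | h
    · exact absurd hv ((mem_comps.1 hC).notMem_of_mem (mem_nb.2 hvz.symm))
    · simpa using h
  have hsing : ∀ C ∈ comps G ({x}ᶜ \ nb G x), ∀ v ∈ C, ∀ z ∈ C, v = z := by
    intro C hC
    have hC' := mem_comps.1 hC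
    suffices ∃ y, C = {y} by
      obtain ⟨y, rfl⟩ := this
      intro v hv z hz
      rw [mem_singleton] at hv hz
      rw [hv, hz]
    obtain ⟨u₁, hu₁⟩ : ∃ u, G.Adj x u := by
      have : 0 < deg G x := by omega
      obtain ⟨u, -, hu⟩ := exists_adj_of_dg_pos this
      exact ⟨u, hu⟩
    obtain ⟨y, hy⟩ := card_eq_one.1 (hone C hC u₁ hu₁)
    have hy' : ∀ v, v ∈ C ∧ G.Adj u₁ v ↔ v = y := fun v => by
      simpa using Finset.ext_iff.1 hy v
    obtain ⟨hyC, huy⟩ := (hy' y).2 rfl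
    refine ⟨y, (eq_singleton_iff_unique_mem.2 ⟨hyC, ?_⟩)⟩
    by_contra hn
    push Not at hn
    obtain ⟨t, htC, hty⟩ := hn
    obtain ⟨-, -, -, hone'⟩ := hstr u₁ (hcubic u₁)
    have hu₁C : u₁ ∉ C := hC'.notMem_of_mem (by simpa using hu₁)
    have htu : ¬ G.Adj u₁ t := fun h => hty ((hy' t).1 ⟨htC, h⟩)
    obtain ⟨A, hA, htA⟩ := exists_mem_comps G (R := {u₁}ᶜ \ nb G u₁) (v := t) (by
      simp only [mem_sdiff, mem_compl, mem_singleton, mem_nb]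
      exact ⟨by rintro rfl; exact hu₁C htC, htu⟩)
    have hA' := mem_comps.1 hA
    have hxA := hone' A hA x hu₁.symm
    obtain ⟨u₂, hu₂⟩ := card_eq_one.1 hxA
    have hu₂' : ∀ v, v ∈ A ∧ G.Adj x v ↔ v = u₂ := fun v => by
      simpa using Finset.ext_iff.1 hu₂ v
    obtain ⟨hu₂A, hxu₂⟩ := (hu₂' u₂).2 rfl
    have hyA : y ∉ A := hA'.notMem_of_mem (by simpa using huy)
    obtain ⟨p, hp⟩ := card_eq_one.1 (hone' A hA y huy)
    obtain ⟨q, hq⟩ := card_eq_one.1 (hone C hC u₂ hxu₂)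
    have hp' : ∀ v, v ∈ A ∧ G.Adj y v ↔ v = p := fun v => by
      simpa using Finset.ext_iff.1 hp v
    have hq' : ∀ v, v ∈ C ∧ G.Adj u₂ v ↔ v = q := fun v => by
      simpa using Finset.ext_iff.1 hq v
    have hle : ebd G (C ∩ A) ≤ 2 := by
      refine ebd_le_of_exit (p := p) (x := y) (q := q) (u := u₂) fun v hv z hz hvz => ?_
      simp only [mem_inter, not_and] at hv hz
      by_cases hzC : z ∈ C
      · have hzA := hz hzC
        have h1 : G.Adj u₁ z := by
          rcases hA'.exit hv.2 hzA hvz with rfl | h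
          · exact absurd hzC hu₁C
          · simpa using h
        have hzy := (hy' z).1 ⟨hzC, h1⟩
        subst hzy
        exact Or.inl ⟨(hp' v).1 ⟨hv.2, hvz.symm⟩, rfl⟩
      · have hxz := hex C hC v hv.1 z hzC hvz
        have hzA : z ∈ A := by
          by_contra hzA
          rcases hA'.exit hv.2 hzA hvz with rfl | h
          · have := (hy' v).1 ⟨hv.1, hvz.symm⟩
            exact hyA (this ▸ hv.2)
          · exact E.bip.ne (mem_nb.1 h) ((E.bip hu₁).trans (E.bip hxz).symm)
        have hzu := (hu₂' z).1 ⟨hzA, hxz⟩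
        subst hzu
        exact Or.inr ⟨(hq' v).1 ⟨hv.1, hvz.symm⟩, rfl⟩
    have := h3 (C ∩ A) ⟨t, by simp [htC, htA]⟩ ⟨y, by simp [hyA]⟩
    omega
  have hind : ∀ u v, G.Adj u v → G.Adj x u ∨ G.Adj x v := by
    intro u v huv
    by_contra hn
    push Not at hn
    have hux : u ≠ x := by rintro rfl; exact hn.2 huv
    obtain ⟨C, hC, huC⟩ := exists_mem_comps G (R := {x}ᶜ \ nb G x) (v := u) (by simp [hux, hn.1])
    by_cases hvC : v ∈ C
    · exact huv.ne (hsing C hC u huC v hvC)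
    · exact hn.2 (hex C hC u huC v hvC huv)
  let w : Sym2 V → ZMod 2 := fun e => if x ∈ e then 1 else 0
  have hw1 : ∀ u, w s(x, u) = 1 := fun u => if_pos (by simp)
  have hsx : sd G w x = 3 := hx3 ▸ sd_eq_deg fun u _ => hw1 u
  have hsd : ∀ u, u ≠ x → sd G w u = if G.Adj x u then 1 else 0 := by
    intro u hu
    have : sd G w u = dg G {x} u := by
      refine congrArg card ?_
      ext v
      simp only [mem_filter, mem_univ, true_and, mem_singleton, w]
      constructor
      · rintro ⟨h1, h2⟩
        refine ⟨?_, h1⟩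
        by_contra hv
        rw [if_neg (by simp [hu.symm, Ne.symm hv])] at h2
        exact zero_ne_one h2
      · rintro ⟨rfl, h1⟩
        exact ⟨h1, if_pos (by simp)⟩
    rw [this, dg_singleton, G.adj_comm]
  have hmain : ∀ u v, G.Adj u v → G.Adj x u → sd G w u ≠ sd G w v := by
    intro u v huv hxu
    rw [hsd u hxu.ne', if_pos hxu]
    by_cases hv : v = x
    · rw [hv, hsx]; omega
    · rw [hsd v hv, if_neg fun hxv => E.bip.ne huv ((E.bip hxu).trans (E.bip hxv).symm)]
      omega
  refine E.bad ⟨w, fun u v huv => ?_⟩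
  rcases hind u v huv with h | h
  · exact hmain u v huv h
  · exact (hmain v u huv.symm h).symm

end Env

/-! ### Cut vertices -/

/-- A minimal part `D` cut off by a vertex `z`. -/
structure Lobe (G : SimpleGraph V) (D : Finset V) (z : V) : Prop where
  ne : D.Nonempty
  hz : z ∉ D
  exit : ∀ v ∈ D, ∀ u ∉ D, G.Adj v u → u = z
  conn : ConnOn G D
  connO : ConnOn G Dᶜ
  noncut : ∀ v ∈ D, NonCut G v
  proper : D ≠ {z}ᶜ

lemma exists_lobe (hG : ConnOn G univ) (h : ∃ v, ¬ NonCut G v) : ∃ D z, Lobe G D z := by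
  let P : Finset V → Prop := fun D => D.Nonempty ∧ ∃ z, z ∉ D ∧
    (∀ v ∈ D, ∀ u ∉ D, G.Adj v u → u = z) ∧ D ≠ {z}ᶜ
  have hP : ∀ {v : V} {X : Finset V}, X ⊆ {v}ᶜ → X.Nonempty →
      (∀ u ∈ X, ∀ t ∈ ({v}ᶜ : Finset V), G.Adj u t → t ∈ X) → X ≠ {v}ᶜ → P X := by
    intro v X hX hne hcl hX'
    refine ⟨hne, v, fun hv => by simpa using hX hv, fun u hu t ht hut => ?_, hX'⟩
    by_contra htv
    exact ht (hcl u hu t (by simpa using htv) hut)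
  obtain ⟨D, hD, hmin⟩ := exists_min_image (univ.filter P) card (by
    obtain ⟨v, hv⟩ := h
    unfold NonCut ConnOn at hv
    push Not at hv
    obtain ⟨X, hX, hne, hcl, hX'⟩ := hv
    exact ⟨X, by simpa using hP hX hne hcl hX'⟩)
  simp only [mem_filter, mem_univ, true_and] at hD hmin
  obtain ⟨hne, z, hz, hex, hprop⟩ := hD
  have hnoleave : ∀ X : Finset V, X.Nonempty → X ≠ univ →
      (∀ u ∈ X, ∀ v, G.Adj u v → v ∈ X) → False := fun X hX hXu hcl =>
    hXu (hG X (subset_univ X) hX fun u hu v _ huv => hcl u hu v huv)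
  refine ⟨D, z, hne, hz, hex, ?_, ?_, ?_, hprop⟩
  · intro X hX hXne hcl
    refine eq_of_subset_of_card_le hX (hmin X ⟨hXne, z, fun h => hz (hX h), ?_, ?_⟩)
    · intro v hv u hu hvu
      by_cases huD : u ∈ D
      · exact absurd (hcl v hv u huD hvu) hu
      · exact hex v (hX hv) u huD hvu
    · rintro rfl
      exact hprop (subset_antisymm (fun v hv => by
        simp only [mem_compl, mem_singleton]; rintro rfl; exact hz hv) hX)
  · intro X hX hXne hcl
    by_contra hXD
    obtain ⟨d, hd⟩ := hne
    have hdX : d ∉ X := fun h => mem_compl.1 (hX h) hd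
    by_cases hzX : z ∈ X
    · obtain ⟨t, htD, htX⟩ := exists_of_ssubset (hX.ssubset_of_ne hXD)
      refine hnoleave (Dᶜ \ X) ⟨t, mem_sdiff.2 ⟨htD, htX⟩⟩ (fun h => ?_) fun u hu v huv => ?_
      · have := h ▸ mem_univ z
        exact (mem_sdiff.1 this).2 hzX
      · rw [mem_sdiff, mem_compl] at hu ⊢
        have hvD : v ∉ D := fun hvD => by
          have := hex v hvD u hu.1 huv.symm
          exact hu.2 (this ▸ hzX)
        exact ⟨hvD, fun hvX => hu.2 (hcl v hvX u (mem_compl.2 hu.1) huv.symm)⟩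
    · refine hnoleave X hXne (fun h => hdX (h ▸ mem_univ d)) fun u hu v huv => ?_
      by_cases hvD : v ∈ D
      · have := hex v hvD u (mem_compl.1 (hX hu)) huv.symm
        exact absurd (this ▸ hu) hzX
      · exact hcl u hu v (mem_compl.2 hvD) huv
  · intro v hvD
    have hvz : v ≠ z := fun h => hz (h ▸ hvD)
    have key : ∀ X ⊆ ({v}ᶜ : Finset V), X.Nonempty →
        (∀ u ∈ X, ∀ t ∈ ({v}ᶜ : Finset V), G.Adj u t → t ∈ X) → z ∉ X → False := by
      intro X hX hXne hcl hzX
      have hvX : v ∉ X := fun h => by simpa using hX h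
      by_cases hne' : (X ∩ D).Nonempty
      · have h1 := hmin (X ∩ D) ⟨hne', v, by simp [hvX], fun u hu t ht hut => by
          by_contra htv
          rw [mem_inter] at hu
          have htX := hcl u hu.1 t (by simpa using htv) hut
          have htD : t ∉ D := fun htD => ht (mem_inter.2 ⟨htX, htD⟩)
          exact hzX (hex u hu.2 t htD hut ▸ htX), fun h => by
            have : z ∈ X ∩ D := by rw [h]; simpa using hvz.symm
            exact hzX (mem_inter.1 this).1⟩
        have h2 := eq_of_subset_of_card_le inter_subset_right h1
        have : v ∈ X ∩ D := by rw [h2]; exact hvD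
        exact hvX (mem_inter.1 this).1
      · rw [not_nonempty_iff_eq_empty] at hne'
        have hXD : ∀ u ∈ X, u ∉ D := fun u hu hD => by
          have : u ∈ X ∩ D := mem_inter.2 ⟨hu, hD⟩
          simp [hne'] at this
        refine hnoleave X hXne (fun h => hvX (h ▸ mem_univ v)) fun u hu t hut => ?_
        by_cases htv : t = v
        · subst htv
          exact absurd (hex t hvD u (hXD u hu) hut.symm ▸ hu) hzX
        · exact hcl u hu t (by simpa using htv) hut
    intro X hX hXne hcl
    by_contra hX'
    by_cases hzX : z ∈ X
    · refine key ({v}ᶜ \ X) sdiff_subset ?_ ?_ ?_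
      · rw [sdiff_nonempty]; exact fun h => hX' (subset_antisymm hX h)
      · intro u hu t ht hut
        rw [mem_sdiff] at hu ⊢
        exact ⟨ht, fun htX => hu.2 (hcl t htX u hu.1 hut.symm)⟩
      · simp [hzX]
    · exact key X hX hXne hcl hzX

lemma ebd_le_one {X : Finset V} {p x : V}
    (h : ∀ v ∈ X, ∀ z, z ∉ X → G.Adj v z → v = p ∧ z = x) : ebd G X ≤ 1 := by
  have : ebd G X = #(X.sigma fun v => {z ∈ Xᶜ | G.Adj v z}) := by
    rw [card_sigma]; rfl
  rw [this]
  refine (card_le_card (t := {⟨p, x⟩}) ?_).trans (by simp)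
  rintro ⟨v, z⟩ hvz
  simp only [mem_sigma, mem_filter, mem_compl] at hvz
  obtain ⟨rfl, rfl⟩ := h v hvz.1 z hvz.2.1 hvz.2.2
  simp

/-- If all edges leaving `O` start at one vertex, no edge of `O` separates it. -/
lemma BL.connOn_deleteEdge (hbl : BL G) {O : Finset V} {z v : V}
    (hexit : ∀ t ∈ O, ∀ u ∉ O, G.Adj t u → t = z) :
    ConnOn (G.deleteEdges {s(z, v)}) O := by
  have key : ∀ X ⊆ O, X.Nonempty →
      (∀ u ∈ X, ∀ t ∈ O, (G.deleteEdges {s(z, v)}).Adj u t → t ∈ X) → z ∉ X → False := by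
    intro X hX hne hcl hzX
    obtain ⟨a, ha⟩ := hne
    have h1 := ebd_pos hbl ha hzX
    have h2 : ebd G X ≤ 1 := ebd_le_one (p := v) (x := z) fun u hu t ht hut => by
      have huz : u ≠ z := fun h => hzX (h ▸ hu)
      have htO : t ∈ O := by
        by_contra htO
        exact huz (hexit u (hX hu) t htO hut)
      by_contra hn
      refine ht (hcl u hu t htO ?_)
      rw [SimpleGraph.deleteEdges_adj]
      refine ⟨hut, ?_⟩
      simp only [Set.mem_singleton_iff, Sym2.eq_iff]
      tauto
    omega
  intro X hX hne hcl
  by_contra hX'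
  by_cases hzX : z ∈ X
  · refine key (O \ X) sdiff_subset ?_ ?_ ?_
    · rw [sdiff_nonempty]; exact fun h => hX' (subset_antisymm hX h)
    · intro u hu t ht hut
      rw [mem_sdiff] at hu ⊢
      exact ⟨ht, fun htX => hu.2 (hcl t htX u hu.1 hut.symm)⟩
    · simp [hzX]
  · exact key X hX hne hcl hzX

/-- The shifts of weights within `O` that keep all parities there. -/
def IsShift (G : SimpleGraph V) (O : Finset V) (g : Sym2 V → ZMod 2) : Prop :=
  (∀ u v, ¬ (G.Adj u v ∧ u ∈ O ∧ v ∈ O) → g s(u, v) = 0) ∧ ∀ v ∈ O, bd G g v = 0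

lemma IsShift.add {O : Finset V} {g g' : Sym2 V → ZMod 2} (h : IsShift G O g)
    (h' : IsShift G O g') : IsShift G O (g + g') :=
  ⟨fun u v huv => by simp [h.1 u v huv, h'.1 u v huv],
    fun v hv => by rw [bd_add, h.2 v hv, h'.2 v hv, add_zero]⟩

lemma IsShift.zero (O : Finset V) : IsShift G O 0 :=
  ⟨fun _ _ _ => rfl, fun v _ => by simp [bd, bdOn]⟩

lemma exists_shift_edge (hbl : BL G) {O : Finset V} {z v : V} (hz : z ∈ O)
    (hv : v ∈ O) (hexit : ∀ t ∈ O, ∀ u ∉ O, G.Adj t u → t = z) (hzv : G.Adj z v) :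
    ∃ g, IsShift G O g ∧ g s(z, v) = 1 := by
  obtain ⟨g, hg, hgb⟩ := (hbl.connOn_deleteEdge (v := v) hexit).exists_join
    (SimpleGraph.deleteEdges_le _) (fun e => if e = s(z, v) then 1 else 0) (fun _ => 0) (by
      rw [sum_const_zero]
      refine (sum_eq_zero fun a ha => sum_eq_zero fun b hb => if_neg ?_).symm
      have hbO : b ∉ O := by simpa using (mem_filter.1 hb).1
      rw [Sym2.eq_iff]
      rintro (⟨rfl, rfl⟩ | ⟨rfl, rfl⟩) <;> contradiction)
  refine ⟨g, ⟨fun a b hab => ?_, hgb⟩, ?_⟩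
  · rw [hg a b fun h => hab ⟨SimpleGraph.deleteEdges_le _ h.1, h.2⟩, if_neg]
    rw [Sym2.eq_iff]
    rintro (⟨rfl, rfl⟩ | ⟨rfl, rfl⟩)
    · exact hab ⟨hzv, hz, hv⟩
    · exact hab ⟨hzv.symm, hv, hz⟩
  · rw [hg z v fun h => by simp [SimpleGraph.deleteEdges_adj] at h]
    simp

/-- On average over all shifts, half of the edges at `z` have weight one. -/
lemma sum_shift (hbl : BL G) {O : Finset V} {z : V} (hz : z ∈ O)
    (hexit : ∀ t ∈ O, ∀ u ∉ O, G.Adj t u → t = z) (w : Sym2 V → ZMod 2) :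
    ∑ g with IsShift G O g, 2 * sdOn G (w + g) O z =
      ∑ g : Sym2 V → ZMod 2 with IsShift G O g, dg G O z := by
  rw [← mul_sum]
  have h1 : ∀ g : Sym2 V → ZMod 2, sdOn G (w + g) O z =
      ∑ v ∈ O with G.Adj z v, if (w + g) s(z, v) = 1 then 1 else 0 := fun g => by
    rw [sdOn, ← filter_filter, card_filter _ ({v ∈ O | G.Adj z v})]
  simp only [h1]
  rw [sum_comm, mul_sum, sum_const, smul_eq_mul, dg, mul_comm, ← smul_eq_mul, ← sum_const]
  refine sum_congr rfl fun v hv => ?_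
  rw [mem_filter] at hv
  obtain ⟨g₀, hg₀, hg₁⟩ := exists_shift_edge hbl hz hv.1 hexit hv.2
  rw [← card_filter, ← card_filter_add_card_filter_not
    (s := univ.filter (IsShift G O)) (fun g => (w + g) s(z, v) = 1), two_mul]
  congr 1
  refine card_bij' (fun g _ => g + g₀) (fun g _ => g + g₀) ?_ ?_ ?_ ?_
  · intro g hg
    simp only [mem_filter, mem_univ, true_and, Pi.add_apply] at hg ⊢
    refine ⟨hg.1.add hg₀, ?_⟩
    rw [hg₁, ← add_assoc, hg.2]
    decide
  · intro g hg
    simp only [mem_filter, mem_univ, true_and, Pi.add_apply] at hg ⊢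
    refine ⟨hg.1.add hg₀, ?_⟩
    rw [hg₁, ← add_assoc, zmod2_ne.1 hg.2]
    decide
  · intro g _
    ext e
    simp [add_assoc, zmod2_add_self]
  · intro g _
    ext e
    simp [add_assoc, zmod2_add_self]

lemma exists_shift_ge (hbl : BL G) {O : Finset V} {z : V} (hz : z ∈ O)
    (hexit : ∀ t ∈ O, ∀ u ∉ O, G.Adj t u → t = z) (w : Sym2 V → ZMod 2) :
    ∃ g, IsShift G O g ∧ dg G O z ≤ 2 * sdOn G (w + g) O z := by
  obtain ⟨g, hg, h⟩ := exists_le_of_sum_le (s := univ.filter (IsShift G O))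
    ⟨0, by simpa using IsShift.zero O⟩ (sum_shift hbl hz hexit w).ge
  exact ⟨g, (mem_filter.1 hg).2, h⟩

lemma exists_shift_le (hbl : BL G) {O : Finset V} {z : V} (hz : z ∈ O)
    (hexit : ∀ t ∈ O, ∀ u ∉ O, G.Adj t u → t = z) (w : Sym2 V → ZMod 2) :
    ∃ g, IsShift G O g ∧ 2 * sdOn G (w + g) O z ≤ dg G O z := by
  obtain ⟨g, hg, h⟩ := exists_le_of_sum_le (s := univ.filter (IsShift G O))
    ⟨0, by simpa using IsShift.zero O⟩ (sum_shift hbl hz hexit w).le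
  exact ⟨g, (mem_filter.1 hg).2, h⟩

namespace Lobe

variable {D : Finset V} {z : V}

lemma exitO (L : Lobe G D z) : ∀ t ∈ Dᶜ, ∀ u ∉ Dᶜ, G.Adj t u → t = z := fun t ht u hu htu =>
  L.exit u (by simpa using hu) t (by simpa using ht) htu.symm

lemma dg_compl (L : Lobe G D z) {u : V} (hu : u ∈ D) :
    dg G Dᶜ u = if G.Adj u z then 1 else 0 := by
  rw [← dg_singleton, dg, dg]
  congr 1
  ext v
  simp only [mem_filter, mem_compl, mem_singleton]
  exact ⟨fun h => ⟨L.exit u hu v h.1 h.2, h.2⟩, fun h => ⟨h.1 ▸ L.hz, h.2⟩⟩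

lemma dg_add (L : Lobe G D z) {u : V} (hu : u ∈ D) :
    dg G D u + (if G.Adj u z then 1 else 0) = deg G u := by
  rw [← L.dg_compl hu, deg, dg_add_compl]

lemma sum_bdOn (L : Lobe G D z) (w : Sym2 V → ZMod 2) : ∑ v ∈ Dᶜ, bdOn G w D v = bdOn G w D z := by
  refine sum_eq_single_of_mem z (mem_compl.2 L.hz) fun v hv hvz => ?_
  refine sum_eq_zero fun u hu => ?_
  rw [mem_filter] at hu
  exact absurd (L.exit u hu.1 v (mem_compl.1 hv) hu.2.symm) hvz

lemma ebd_eq (L : Lobe G D z) : ebd G D = dg G D z := by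
  rw [ebd, sum_dg_comm]
  refine sum_eq_single_of_mem z (mem_compl.2 L.hz) fun v hv hvz => ?_
  exact dg_eq_zero.2 fun u hu hvu => hvz (L.exit u hu v (mem_compl.1 hv) hvu.symm)

lemma two_le (L : Lobe G D z) (hbl : BL G) : 2 ≤ dg G D z := by
  obtain ⟨v, hv⟩ := L.ne
  rw [← L.ebd_eq]
  exact ebd_pos hbl hv L.hz

lemma two_le_out (L : Lobe G D z) (hbl : BL G) : 2 ≤ dg G Dᶜ z := by
  have hne : (insert z D)ᶜ.Nonempty := by
    rw [nonempty_iff_ne_empty, Ne, compl_eq_empty_iff]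
    intro h
    refine L.proper ?_
    ext v
    have : v ∈ insert z D := h ▸ mem_univ v
    rw [mem_insert] at this
    simp only [mem_compl, mem_singleton]
    exact ⟨fun hv hvz => L.hz (hvz ▸ hv), fun hv => this.resolve_left hv⟩
  have h1 := hbl (insert z D) ⟨z, by simp⟩ hne
  rw [ebd, sum_insert L.hz] at h1
  have h2 : ∑ v ∈ D, dg G (insert z D)ᶜ v = 0 := sum_eq_zero fun v hv =>
    dg_eq_zero.2 fun u hu hvu => by
      simp only [mem_compl, mem_insert, not_or] at hu
      exact hu.1 (L.exit v hv u hu.2 hvu)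
  have h3 : dg G (insert z D)ᶜ z ≤ dg G Dᶜ z := dg_mono G (by
    intro v; simp only [mem_compl, mem_insert, not_or]; exact fun h => h.2) z
  omega

lemma bd_shift (w g : Sym2 V → ZMod 2) (hg : IsShift G Dᶜ g) (v : V) :
    bd G (w + g) v = bd G w v := by
  rw [bd_add]
  by_cases hv : v ∈ D
  · rw [show bd G g v = 0 from sum_eq_zero fun u _ => hg.1 v u (by simp [hv]), add_zero]
  · rw [hg.2 v (mem_compl.2 hv), add_zero]

lemma shift_eq {w g : Sym2 V → ZMod 2} (hg : IsShift G Dᶜ g) {u v : V} (hv : v ∈ D) :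
    (w + g) s(u, v) = w s(u, v) := by
  rw [Pi.add_apply, hg.1 u v (by simp [hv]), add_zero]

lemma sdOn_shift {w g : Sym2 V → ZMod 2} (hg : IsShift G Dᶜ g) (v : V) :
    sdOn G (w + g) D v = sdOn G w D v := by
  refine congrArg card (filter_congr fun u hu => ?_)
  rw [shift_eq hg hu]

lemma sd_shift {w g : Sym2 V → ZMod 2} (hg : IsShift G Dᶜ g) {v : V} (hv : v ∈ D) :
    sd G (w + g) v = sd G w v := by
  refine congrArg card (filter_congr fun u _ => ?_)
  rw [Sym2.eq_swap, shift_eq hg hv]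

/-- Weighting all edges from `z` into an odd lobe by one. -/
lemma le_of_connOn (L : Lobe G D z) (E : Env G c) (hodd : Odd #D) (hHG : H ≤ G)
    (hH : ConnOn H D) :
    ∃ u ∈ D, G.Adj u z ∧ 2 * dg G D z + dg G Dᶜ z ≤ 2 * (dg H D u + 1) := by
  by_contra hcon
  push Not at hcon
  have hD1 : (#D : ZMod 2) = 1 := by
    obtain ⟨k, hk⟩ := hodd
    rw [hk]; push_cast
    generalize (k : ZMod 2) = a
    revert a; decide
  obtain ⟨κ, hκ⟩ : ∃ κ, ∑ v ∈ D, (c v + κ) = (dg G D z : ZMod 2) := by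
    refine ⟨∑ v ∈ D, c v + dg G D z, ?_⟩
    rw [sum_c_add, hD1, one_mul, ← add_assoc, zmod2_add_self, zero_add]
  have hV : (#Dᶜ : ZMod 2) = 1 := by
    have h0 := E.odd 0
    have h1 := E.odd 1
    rw [sum_c_add, mul_one] at h1
    simp only [add_zero] at h0
    rw [h0, card_univ, ← card_compl_add_card D] at h1
    push_cast at h1
    rw [hD1] at h1
    revert h1
    generalize (#Dᶜ : ZMod 2) = a
    revert a; decide
  let w₀ : Sym2 V → ZMod 2 := fun e => if z ∈ e then 1 else 0
  have hb : ∀ w : Sym2 V → ZMod 2, (∀ u ∈ D, w s(z, u) = 1) →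
      bdOn G w D z = (dg G D z : ZMod 2) := by
    intro w hw
    rw [bdOn_eq_sdOn, sdOn, dg]
    congr 2
    exact filter_congr fun u hu => by simp [hw u hu]
  obtain ⟨w₁, hw₁, hwb₁⟩ := hH.exists_join hHG w₀ (fun v => c v + κ) (by
    rw [hκ, sum_bdOn_comm, L.sum_bdOn, hb w₀ fun u _ => if_pos (by simp)])
  have hz₁ : ∀ u ∈ D, w₁ s(z, u) = 1 := fun u _ => by
    rw [hw₁ z u fun h => L.hz h.2.1]
    exact if_pos (by simp)
  obtain ⟨w₂, hw₂, hwb₂⟩ := L.connO.exists_join le_rfl w₁ (fun v => c v + (κ + 1)) (by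
    rw [compl_compl, L.sum_bdOn, hb w₁ hz₁, ← hκ]
    have h := E.odd κ
    rw [← sum_compl_add_sum D] at h
    simp only [← add_assoc (c _)]
    rw [sum_add_distrib (s := Dᶜ), sum_const, nsmul_eq_mul, hV]
    revert h
    generalize ∑ v ∈ Dᶜ, (c v + κ) = a
    generalize ∑ v ∈ D, (c v + κ) = b
    revert a b; decide)
  have heq : ∀ u, ∀ v ∈ D, w₂ s(u, v) = w₁ s(u, v) := fun u v hv => hw₂ u v (by simp [hv])
  have hwD : ∀ v ∈ D, bd G w₂ v = c v + κ := fun v hv => by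
    rw [bd_eq_of_eq_off hw₂ (by simpa using hv), hwb₁ v hv]
  obtain ⟨g, hg, hgz⟩ := exists_shift_ge E.bl (mem_compl.2 L.hz) L.exitO w₂
  have hsz : sdOn G (w₂ + g) D z = dg G D z := by
    rw [sdOn_shift hg]
    refine congrArg card (filter_congr fun u hu => ?_)
    simp [heq z u hu, hz₁ u hu]
  have hsz' := sdOn_add_compl G (w₂ + g) D z
  have hmain : ∀ u ∈ D, G.Adj u z → sd G (w₂ + g) u ≠ sd G (w₂ + g) z := by
    intro u hu huz
    have h1 := hcon u hu huz
    have h2 : sdOn G (w₂ + g) D u ≤ dg H D u := by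
      rw [sdOn_shift hg]
      refine card_le_card fun v hv => ?_
      rw [mem_filter] at hv ⊢
      refine ⟨hv.1, ?_⟩
      by_contra hn
      have h3 := hv.2.2
      rw [heq u v hv.1, hw₁ u v fun h => hn h.1] at h3
      refine absurd h3 ?_
      rw [show w₀ s(u, v) = 0 from if_neg ?_]
      · decide
      · rw [Sym2.mem_iff]
        rintro (rfl | rfl)
        · exact L.hz hu
        · exact L.hz hv.1
    have h3 := sdOn_le_dg G (w₂ + g) Dᶜ u
    rw [L.dg_compl hu, if_pos huz] at h3
    have h4 := sdOn_add_compl G (w₂ + g) D u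
    omega
  refine E.bad ⟨w₂ + g, fun u v huv => ?_⟩
  by_cases hu : u ∈ D <;> by_cases hv : v ∈ D
  · exact sd_ne_of_bd_ne (by
      rw [bd_shift _ _ hg, bd_shift _ _ hg, hwD u hu, hwD v hv]; exact E.bip.symm_sum huv _)
  · have := L.exit u hu v hv huv
    subst this
    exact hmain u hu huv
  · have := L.exit v hv u hu huv.symm
    subst this
    exact (hmain v hv huv.symm).symm
  · exact sd_ne_of_bd_ne (by
      rw [bd_shift _ _ hg, bd_shift _ _ hg, hwb₂ u (mem_compl.2 hu), hwb₂ v (mem_compl.2 hv)]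
      exact E.bip.symm_sum huv _)

/-- In a full state in which only `z` can have a conflict, half of the outer edges of `z` have
weight one on average. -/
lemma full_count (L : Lobe G D z) (E : Env G c) {x : V} (hx : x ∈ D) {w : Sym2 V → ZMod 2}
    (hw : IsFull G c x w) (hlt : ∀ u ∈ D, G.Adj x u → sd G w u < deg G x) :
    G.Adj x z ∧ 2 * sdOn G w D z + dg G Dᶜ z = 2 * deg G x := by
  have key : ∀ g, IsShift G Dᶜ g → G.Adj x z ∧ sdOn G w D z + sdOn G (w + g) Dᶜ z = deg G x := by
    intro g hg
    have hw' : IsFull G c x (w + g) := ⟨fun u hu => by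
      rw [Sym2.eq_swap, shift_eq hg hx, Sym2.eq_swap, hw.1 u hu], fun v hv => by
      rw [bd_shift _ _ hg, hw.2 v hv]⟩
    obtain ⟨u, hxu, hu⟩ := hw'.exists_conflict E.bip E.bad
    by_cases huD : u ∈ D
    · have := hlt u huD hxu
      rw [sd_shift hg huD] at hu
      omega
    · have := L.exit x hx u huD hxu
      subst this
      refine ⟨hxu, ?_⟩
      rw [← hu, ← sdOn_add_compl G (w + g) D, sdOn_shift hg]
  obtain ⟨g₁, hg₁, h₁⟩ := exists_shift_ge E.bl (mem_compl.2 L.hz) L.exitO w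
  obtain ⟨g₂, hg₂, h₂⟩ := exists_shift_le E.bl (mem_compl.2 L.hz) L.exitO w
  have h3 := key g₁ hg₁
  have h4 := key g₂ hg₂
  exact ⟨h3.1, by omega⟩

/-- If moreover the lobe has even size, the parities outside can be flipped. -/
lemma odd_of_full (L : Lobe G D z) (E : Env G c) {x : V} (hx : x ∈ D)
    (hmax : ∀ v ∈ D, deg G v ≤ deg G x) {w : Sym2 V → ZMod 2}
    (hw : IsFull G c x w) (hlt : ∀ u ∈ D, G.Adj x u → sd G w u < deg G x) : Odd #D := by
  by_contra heven
  rw [Nat.not_odd_iff_even] at heven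
  obtain ⟨hxz, hcount⟩ := L.full_count E hx hw hlt
  set κ := c x + deg G x + 1 with hκ
  have hD0 : (#D : ZMod 2) = 0 := (ZMod.natCast_eq_zero_iff _ 2).2 heven.two_dvd
  have hV : (#Dᶜ : ZMod 2) = 0 := by
    have h0 := E.odd 0
    have h1 := E.odd 1
    rw [sum_c_add, mul_one] at h1
    simp only [add_zero] at h0
    rw [h0, card_univ, ← card_compl_add_card D] at h1
    push_cast at h1
    rw [hD0] at h1
    revert h1
    generalize (#Dᶜ : ZMod 2) = a
    revert a; decide
  have hxO : ∀ v ∈ Dᶜ, v ≠ x := by rintro v hv rfl; exact mem_compl.1 hv hx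
  obtain ⟨w₂, hw₂, hwb₂⟩ := L.connO.exists_join le_rfl w (fun v => c v + (κ + 1)) (by
    have h1 := sum_bd G w Dᶜ
    rw [← h1, sum_congr rfl fun v hv => hw.2 v (hxO v hv), sum_c_add, sum_c_add, hV]
    simp)
  have heq : ∀ u, ∀ v ∈ D, w₂ s(u, v) = w s(u, v) := fun u v hv => hw₂ u v (by simp [hv])
  obtain ⟨g, hg, hgz⟩ := exists_shift_ge E.bl (mem_compl.2 L.hz) L.exitO w₂
  have hsD : ∀ v ∈ D, sd G (w₂ + g) v = sd G w v := fun v hv => by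
    rw [sd_shift hg hv]
    refine congrArg card (filter_congr fun u _ => ?_)
    rw [Sym2.eq_swap, heq u v hv]
  have hszD : sdOn G (w₂ + g) D z = sdOn G w D z := by
    rw [sdOn_shift hg]
    refine congrArg card (filter_congr fun u hu => ?_)
    rw [heq z u hu]
  have hsz := sdOn_add_compl G (w₂ + g) D z
  have hsx : sd G w x = deg G x := sd_eq_deg hw.1
  have hzx : sd G (w₂ + g) z ≠ deg G x := by
    intro h
    have h1 := bd_eq_sd G (w₂ + g) z
    rw [h, bd_shift _ _ hg, hwb₂ z (mem_compl.2 L.hz), E.bip hxz, hκ] at h1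
    revert h1
    generalize (deg G x : ZMod 2) = a
    generalize c x = b
    revert a b; decide
  have hmain : ∀ u ∈ D, G.Adj u z → sd G (w₂ + g) u ≠ sd G (w₂ + g) z := by
    intro u hu huz
    have h1 := hmax u hu
    have h2 := sd_le_deg (G := G) w u
    rw [hsD u hu]
    omega
  refine E.bad ⟨w₂ + g, fun u v huv => ?_⟩
  by_cases hu : u ∈ D <;> by_cases hv : v ∈ D
  · rw [hsD u hu, hsD v hv]
    by_cases hux : u = x
    · subst hux; rw [hsx]; exact (hlt v hv huv).ne'
    · by_cases hvx : v = x
      · subst hvx; rw [hsx]; exact (hlt u hu huv.symm).ne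
      · exact sd_ne_of_bd_ne (by rw [hw.2 u hux, hw.2 v hvx]; exact E.bip.symm_sum huv _)
  · have := L.exit u hu v hv huv
    subst this
    exact hmain u hu huv
  · have := L.exit v hv u hu huv.symm
    subst this
    exact (hmain v hv huv.symm).symm
  · exact sd_ne_of_bd_ne (by
      rw [bd_shift _ _ hg, bd_shift _ _ hg, hwb₂ u (mem_compl.2 hu), hwb₂ v (mem_compl.2 hv)]
      exact E.bip.symm_sum huv _)

end Lobe

namespace Lobe

variable {D : Finset V} {z : V}

lemma subset_of_comp (L : Lobe G D z) {x : V} (hx : x ∈ D) {S C : Finset V} (hS : S ⊆ D)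
    (hC : IsComp G ({x}ᶜ \ S) C) : (z ∈ C → Dᶜ ⊆ C) ∧ (z ∉ C → C ⊆ D) := by
  have hsub : Dᶜ ⊆ {x}ᶜ \ S := fun v hv => by
    rw [mem_compl] at hv
    simp only [mem_sdiff, mem_compl, mem_singleton]
    exact ⟨by rintro rfl; exact hv hx, fun h => hv (hS h)⟩
  have key : ∀ v ∈ C, v ∉ D → Dᶜ ⊆ C := fun v hv hvD =>
    L.connO.subset_of_closed hsub hC.2.2.1 (mem_compl.2 hvD) hv
  refine ⟨fun hz => key z hz L.hz, fun hz v hv => ?_⟩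
  by_contra hvD
  exact hz (key v hv hvD (mem_compl.2 L.hz))

/-- Full states at a vertex of maximum degree in a lobe. -/
lemma full_or_violator (L : Lobe G D z) (E : Env G c) {x : V} (hx : x ∈ D) (hdx : 3 ≤ deg G x)
    (hmax : ∀ v ∈ D, deg G v ≤ deg G x) {Y : Finset V} (hY : ∀ u ∈ Y, G.Adj x u ∧ u ∈ D) :
    (∃ w, IsFull G c x w ∧ ∀ u ∈ Y, sd G w u < deg G x) ∨
    ∃ S ⊆ Y, S.Nonempty ∧ (∀ u ∈ S, deg G u = deg G x) ∧
      ∃ B ∈ comps G ({x}ᶜ \ S), Dᶜ ⊆ B ∧ 2 ≤ ebd G B ∧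
        (∀ C ∈ comps G ({x}ᶜ \ S), C ≠ B → C ⊆ D ∧ 3 ≤ ebd G C) ∧
        #S * deg G x + 2 ≤ #(comps G ({x}ᶜ \ S)) + 3 * #S ∧
        ∑ C ∈ comps G ({x}ᶜ \ S), ebd G C + 2 * #S = #S * deg G x + deg G x := by
  rcases E.full_or_violator le_rfl (L.noncut x hx) (L.noncut x hx) hdx (Y := Y) (fun u hu => by
    have h1 := dg_compl_singleton (H := G) x u
    rw [if_pos (hY u hu).1.symm] at h1
    have h2 := hmax u (hY u hu).2
    exact ⟨(hY u hu).1, L.noncut u (hY u hu).2, by omega, Or.inr h2⟩) with h | h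
  · exact Or.inl h
  · obtain ⟨S, hSY, hS, hS1, hS2, hm⟩ := h
    have hSD : S ⊆ D := fun u hu => (hY u (hSY hu)).2
    obtain ⟨B, hB, hzB⟩ := exists_mem_comps G (R := {x}ᶜ \ S) (v := z) (by
      simp only [mem_sdiff, mem_compl, mem_singleton]
      exact ⟨by rintro rfl; exact L.hz hx, fun h => L.hz (hSD h)⟩)
    have hB' := mem_comps.1 hB
    refine Or.inr ⟨S, hSY, hS, fun u hu => (hS2 u hu).2, B, hB,
      (L.subset_of_comp hx hSD hB').1 hzB, ebd_pos E.bl hzB hB'.notMem, fun C hC hCB => ?_, hm,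
      E.sum_ebd_violator fun u hu => ⟨(hS1 u hu).1, (hS2 u hu).2⟩⟩
    have hC' := mem_comps.1 hC
    have hCD := (L.subset_of_comp hx hSD hC').2 fun hz => hCB (hC'.eq_of_mem hB' hz hzB)
    refine ⟨hCD, E.three_le_ebd (L.noncut x hx) hdx hS1 hC'.2.1 hC'.2.2.2 hC'.notMem
      (fun v hv t ht hvt => hC'.exit hv ht hvt) fun p a q b htwo ha hb hbr => ?_⟩
    have hnc : ∀ t, t = x ∨ t ∈ S → NonCut G t := by
      rintro t (rfl | ht)
      · exact L.noncut t hx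
      · exact L.noncut t (hSD ht)
    exact E.no_region C p a q b ⟨htwo, hbr, fun v hv => L.noncut v (hCD hv), hnc a ha, hnc b hb⟩

/-- In a lobe all vertices of maximum degree at least four are attached to the cut vertex. -/
lemma adj_of_max (L : Lobe G D z) (E : Env G c) {x : V} (hx : x ∈ D) (hdx : 4 ≤ deg G x)
    (hmax : ∀ v ∈ D, deg G v ≤ deg G x) : G.Adj x z := by
  by_contra hxz
  have hnbD : ∀ u, G.Adj x u → u ∈ D := fun u hu => by
    by_contra huD
    exact hxz (L.exit x hx u huD hu ▸ hu)
  rcases L.full_or_violator E hx (by omega) hmax (Y := nb G x)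
    (fun u hu => ⟨mem_nb.1 hu, hnbD u (mem_nb.1 hu)⟩) with ⟨w, hw, hlt⟩ | h
  · obtain ⟨u, hxu, hu⟩ := hw.exists_conflict E.bip E.bad
    have := hlt u (mem_nb.2 hxu)
    omega
  · obtain ⟨S, hSY, hS, -, B, hB, -, hB2, hC, hm, hsum⟩ := h
    have h1 := three_mul_card_le (f := fun C => ebd G C) hB fun C hC' hne => (hC C hC' hne).2
    have h2 := card_le_card hSY
    have h3 := hS.card_pos
    rw [card_nb] at h2
    obtain ⟨j, hj⟩ : ∃ j, #S = j + 1 := ⟨#S - 1, by omega⟩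
    obtain ⟨d, hd⟩ : ∃ d, deg G x = d + 4 := ⟨deg G x - 4, by omega⟩
    rw [hj, hd] at hm hsum
    nlinarith

/-- In an odd lobe, few edges leave the cut vertex. -/
lemma violator (L : Lobe G D z) (E : Env G c) (hodd : Odd #D) {d : ℕ}
    (hmax : ∀ v ∈ D, deg G v ≤ d) (hd : 2 * d < 2 * dg G D z + dg G Dᶜ z + 2) :
    ∃ S ⊆ D, S.Nonempty ∧ (∀ u ∈ S, G.Adj u z ∧ deg G u = d) ∧
      #S * d + 2 ≤ #(comps G (D \ S)) + 3 * #S ∧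
      ∑ C ∈ comps G (D \ S), ebd G C + 2 * #S = #S * d + dg G D z := by
  set U := {u ∈ D | G.Adj u z ∧ deg G u = d} with hU
  have hUD : U ⊆ D := filter_subset _ _
  have hUz : ∀ u ∈ U, G.Adj u z ∧ deg G u = d := fun u hu => (mem_filter.1 hu).2
  have hind : ∀ u ∈ U, ∀ v ∈ U, ¬ G.Adj u v := fun u hu v hv huv =>
    E.bip.ne huv (add_right_cancel
      ((E.bip (hUz u hu).1).symm.trans (E.bip (hUz v hv).1)))
  rcases L.conn.exists_deletable hind with ⟨e, he, hconn⟩ | h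
  · exfalso
    obtain ⟨u, hu, huz, hle⟩ := L.le_of_connOn E hodd (SimpleGraph.deleteEdges_le _) hconn
    have h1 := L.dg_add hu
    rw [if_pos huz] at h1
    have h2 := dg_mono_left (SimpleGraph.deleteEdges_le (G := G) {z | ∃ u ∈ U, z = s(u, e u)}) D u
    have h3 := hmax u hu
    by_cases hud : deg G u = d
    · have huU : u ∈ U := mem_filter.2 ⟨hu, huz, hud⟩
      have h4 : dg (G.deleteEdges {z | ∃ u ∈ U, z = s(u, e u)}) D u + 1 ≤ dg G D u := by
        refine Nat.succ_le_of_lt (card_lt_card ?_)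
        rw [ssubset_iff_of_subset (fun z hz => by
          simp only [mem_filter] at hz ⊢
          exact ⟨hz.1, SimpleGraph.deleteEdges_le _ hz.2⟩)]
        refine ⟨e u, by simpa using he u huU, ?_⟩
        simp only [mem_filter, not_and]
        intro _ h
        rw [SimpleGraph.deleteEdges_adj] at h
        exact h.2 ⟨u, huU, rfl⟩
      omega
    · omega
  · obtain ⟨S, hSU, hS, hm⟩ := h
    have hSD := hSU.trans hUD
    refine ⟨S, hSD, hS, fun u hu => hUz u (hSU hu), ?_, ?_⟩
    · have h1 : ∑ u ∈ S, (dg G D u + 1) = ∑ u ∈ S, d := sum_congr rfl fun u hu => by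
        have := L.dg_add (hSD hu)
        rw [if_pos (hUz u (hSU hu)).1, (hUz u (hSU hu)).2] at this
        exact this
      rw [sum_add_distrib, sum_const, sum_const] at h1
      simp only [smul_eq_mul, mul_one] at h1
      omega
    · have hcompl : (D \ S)ᶜ = Dᶜ ∪ S := by ext; simp; tauto
      have hdisj : Disjoint Dᶜ S := by
        rw [Finset.disjoint_left]
        exact fun v hv hvS => mem_compl.1 hv (hSD hvS)
      rw [sum_ebd_comps, hcompl, sum_union hdisj]
      have h1 : ∑ u ∈ Dᶜ, dg G (D \ S) u = dg G (D \ S) z :=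
        sum_eq_single_of_mem z (mem_compl.2 L.hz) fun v hv hvz => dg_eq_zero.2 fun u hu hvu =>
          hvz (L.exit u (mem_sdiff.1 hu).1 v (mem_compl.1 hv) hvu.symm)
      have h2 := dg_sdiff_add (H := G) hSD z
      have h3 : dg G S z = #S := congrArg card (filter_true_of_mem fun u hu =>
        (hUz u (hSU hu)).1.symm)
      have h4 : ∑ u ∈ S, (dg G (D \ S) u + 1) = ∑ u ∈ S, d := sum_congr rfl fun u hu => by
        have h5 := L.dg_add (hSD hu)
        rw [if_pos (hUz u (hSU hu)).1, (hUz u (hSU hu)).2] at h5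
        have h6 := dg_sdiff_add (H := G) hSD u
        have h7 : dg G S u = 0 := dg_eq_zero.2 fun v hv => hind u (hSU hu) v (hSU hv)
        omega
      rw [sum_add_distrib, sum_const, sum_const] at h4
      simp only [smul_eq_mul, mul_one] at h4
      omega

/-- A full state at a vertex of maximum degree at least four in a lobe. -/
lemma exists_full_of_max (L : Lobe G D z) (E : Env G c) {x : V} (hx : x ∈ D)
    (hdx : 4 ≤ deg G x) (hmax : ∀ v ∈ D, deg G v ≤ deg G x) :
    ∃ w, IsFull G c x w ∧ ∀ u ∈ D, G.Adj x u → sd G w u < deg G x := by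
  have hxz := L.adj_of_max E hx hdx hmax
  rcases exists_full E.bip E.odd le_rfl (L.noncut x hx) (U := ∅) (by simp) with
    ⟨w, hw, -, -⟩ | ⟨S, hS, hne, -⟩
  · refine ⟨w, hw, fun u hu hxu => (sd_le_deg w u).trans_lt ?_⟩
    refine (hmax u hu).lt_of_ne fun hud => ?_
    have huz := L.adj_of_max E hu (by omega) fun v hv => hud ▸ hmax v hv
    exact E.bip.ne hxu (add_right_cancel ((E.bip hxz).symm.trans (E.bip huz)))
  · rw [subset_empty.1 hS] at hne
    simp at hne

end Lobe

/-- A connected set of vertices spans at least as many edges as a tree. -/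
lemma two_mul_card_le_of_connOn {R : Finset V} (hR : ConnOn H R) (hne : R.Nonempty) :
    2 * #R ≤ ∑ v ∈ R, dg H R v + 2 := by
  obtain ⟨v₀, hv₀⟩ := hne
  obtain ⟨X, hX, hmax⟩ := exists_max_image
    (R.powerset.filter fun X => X.Nonempty ∧ 2 * #X ≤ ∑ v ∈ X, dg H X v + 2) card
    ⟨{v₀}, by simp [hv₀]⟩
  simp only [mem_filter, mem_powerset] at hX hmax
  obtain ⟨hXR, hXne, hXle⟩ := hX
  by_cases hXeq : X = R
  · rwa [hXeq] at hXle
  exfalso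
  refine hXeq (hR X hXR hXne fun u hu v hv huv => ?_)
  by_contra hvX
  have h1 := hmax (insert v X) ⟨insert_subset hv hXR, insert_nonempty v X, ?_⟩
  · rw [card_insert_of_notMem hvX] at h1
    omega
  · rw [card_insert_of_notMem hvX, sum_insert hvX]
    have h2 : ∑ t ∈ X, dg H (insert v X) t = dg H X v + ∑ t ∈ X, dg H X t := by
      rw [sum_congr rfl fun t _ => dg_insert hvX t, sum_add_distrib, dg, card_filter]
      simp only [H.adj_comm]
    have h3 : 1 ≤ dg H X v := dg_pos hu huv.symm
    have h4 := dg_mono H (subset_insert v X) v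
    omega

namespace Lobe

variable {D : Finset V} {z : V}

/-- A lobe with all degrees two has odd size. -/
lemma odd_of_deg_two (L : Lobe G D z) (E : Env G c) (h2 : ∀ v ∈ D, deg G v = 2) : Odd #D := by
  have h3 := two_mul_card_le_of_connOn L.conn L.ne
  have h4 : ∑ v ∈ D, dg G D v + ebd G D = ∑ v ∈ D, 2 := by
    rw [ebd, ← sum_add_distrib]
    exact sum_congr rfl fun v hv => by rw [dg_add_compl, ← h2 v hv]
  have h5 := L.two_le E.bl
  rw [L.ebd_eq, sum_const, smul_eq_mul] at h4
  have hn : dg G D z = 2 := by omega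
  obtain ⟨u, v, huv, huvD⟩ := card_eq_two.1 hn
  have hz : ∀ t, t ∈ D ∧ G.Adj z t ↔ t = u ∨ t = v := fun t => by
    simpa using Finset.ext_iff.1 huvD t
  obtain ⟨hu, hzu⟩ := (hz u).2 (Or.inl rfl)
  obtain ⟨hv, hzv⟩ := (hz v).2 (Or.inr rfl)
  have hu1 : dg G D u = 1 := by
    have := L.dg_add hu
    rw [if_pos hzu.symm, h2 u hu] at this
    omega
  obtain ⟨p, hp⟩ := card_eq_one.1 hu1
  have hp' : ∀ t, t ∈ D ∧ G.Adj u t ↔ t = p := fun t => by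
    simpa using Finset.ext_iff.1 hp t
  obtain ⟨hpD, hup⟩ := (hp' p).2 rfl
  have hconn : ConnOn G (D.erase u) := by
    have key : ∀ X ⊆ D.erase u, X.Nonempty → (∀ s ∈ X, ∀ t ∈ D.erase u, G.Adj s t → t ∈ X) →
        p ∈ X := by
      intro X hX hne hcl
      by_contra hpX
      have := L.conn X (hX.trans (erase_subset u D)) hne fun s hs t ht hst => by
        by_cases htu : t = u
        · subst htu
          exact absurd ((hp' s).1 ⟨mem_of_mem_erase (hX hs), hst.symm⟩ ▸ hs) hpX
        · exact hcl s hs t (mem_erase.2 ⟨htu, ht⟩) hst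
      exact hpX (this ▸ hpD)
    intro X hX hne hcl
    by_contra hX'
    have h6 := key X hX hne hcl
    have h7 := key (D.erase u \ X) sdiff_subset (by
      rw [sdiff_nonempty]; exact fun h => hX' (subset_antisymm hX h)) fun s hs t ht hst => by
        refine mem_sdiff.2 ⟨ht, fun htX => (mem_sdiff.1 hs).2 ?_⟩
        exact hcl t htX s (mem_sdiff.1 hs).1 hst.symm
    exact (mem_sdiff.1 h7).2 h6
  have hthread : Thread G (D.erase u) u z := by
    refine ⟨⟨p, v, mem_erase.2 ⟨hup.ne', hpD⟩, mem_erase.2 ⟨huv.symm, hv⟩, notMem_erase u D,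
      fun h => L.hz (mem_of_mem_erase h), hzu.ne', hup.symm, hzv.symm, ?_, hconn⟩,
      fun t ht => h2 t (mem_of_mem_erase ht)⟩
    intro t ht s hs hts
    rw [mem_erase] at ht
    by_cases hsD : s ∈ D
    · have hsu : s = u := by
        by_contra hsu
        exact hs (mem_erase.2 ⟨hsu, hsD⟩)
      subst hsu
      exact Or.inl ⟨(hp' t).1 ⟨ht.2, hts.symm⟩, rfl⟩
    · have hsz := L.exit t ht.2 s hsD hts
      subst hsz
      exact Or.inr ⟨((hz t).1 ⟨ht.2, hts.symm⟩).resolve_left ht.1, rfl⟩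
  have h6 := hthread.balanced E.bip (E.bip.ne hzu.symm)
  have h7 := card_erase_add_one hu
  exact ⟨#{v ∈ D.erase u | c v = 1}, by omega⟩

/-- There is no lobe of odd size. -/
lemma not_odd (L : Lobe G D z) (E : Env G c) : ¬ Odd #D := by
  intro hodd
  obtain ⟨x, hx, hmax⟩ := exists_max_image D (deg G) L.ne
  have hn := L.two_le E.bl
  have hO := L.two_le_out E.bl
  have hdeg : ∀ v ∈ D, 2 ≤ deg G v := fun v hv =>
    E.bl.two_le_deg (z := z) (by rintro rfl; exact L.hz hv)
  have hcase : 2 * dg G D z + dg G Dᶜ z ≤ 2 * deg G x := by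
    obtain ⟨u, hu, huz, hle⟩ := L.le_of_connOn E hodd le_rfl L.conn
    have h1 := L.dg_add hu
    rw [if_pos huz] at h1
    have := hmax u hu
    omega
  have hd : 2 * deg G x < 2 * dg G D z + dg G Dᶜ z + 2 := by
    by_cases hdx : 4 ≤ deg G x
    · obtain ⟨w, hw, hlt⟩ := L.exists_full_of_max E hx hdx hmax
      have h1 := (L.full_count E hx hw hlt).2
      have h2 := sdOn_le_dg G w D z
      omega
    · omega
  obtain ⟨S, hSD, hS, hSz, hm, hsum⟩ := L.violator E hodd hmax hd
  have hk := hS.card_pos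
  have hC2 : ∀ C ∈ comps G (D \ S), 2 ≤ ebd G C := fun C hC => by
    obtain ⟨v, hv⟩ := (mem_comps.1 hC).2.1
    exact ebd_pos E.bl hv fun hz => L.hz (mem_sdiff.1 ((mem_comps.1 hC).1 hz)).1
  have hm2 := card_nsmul_le_sum _ (fun C => ebd G C) _ hC2
  rw [smul_eq_mul] at hm2
  have hkn : #S ≤ dg G D z := card_le_card fun u hu =>
    mem_filter.2 ⟨hSD hu, (hSz u hu).1.symm⟩
  have hd3 : deg G x = 3 := by
    by_contra hd3
    have h4 : 4 ≤ deg G x := by omega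
    obtain ⟨j, hj⟩ : ∃ j, #S = j + 1 := ⟨#S - 1, by omega⟩
    obtain ⟨d, hd⟩ : ∃ d, deg G x = d + 4 := ⟨deg G x - 4, by omega⟩
    rw [hj, hd] at hm hsum
    nlinarith
  rw [hd3] at hm hsum
  have hk2 : #S = 2 := by omega
  have hm' : #(comps G (D \ S)) = 2 := by omega
  have hall2 : ∀ C ∈ comps G (D \ S), ebd G C = 2 := by
    intro C hC
    have h1 := sum_erase_add _ (fun C => ebd G C) hC
    have h2 := card_nsmul_le_sum ((comps G (D \ S)).erase C) (fun C => ebd G C) _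
      fun C' hC' => hC2 C' (mem_of_mem_erase hC')
    rw [card_erase_of_mem hC, smul_eq_mul] at h2
    have := hC2 C hC
    omega
  have hSN : S = {u ∈ D | G.Adj z u} := eq_of_subset_of_card_le
    (fun u hu => mem_filter.2 ⟨hSD hu, (hSz u hu).1.symm⟩) (by
      change dg G D z ≤ #S
      omega)
  have hoddC : ∀ C ∈ comps G (D \ S), Odd #C := by
    intro C hC
    have hC' := mem_comps.1 hC
    have hCD : C ⊆ D := hC'.1.trans sdiff_subset
    have hexit : ∀ v ∈ C, ∀ t ∉ C, G.Adj v t → t ∈ S := by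
      intro v hv t ht hvt
      by_contra htS
      by_cases htD : t ∈ D
      · exact ht (hC'.2.2.1 v hv t (mem_sdiff.2 ⟨htD, htS⟩) hvt)
      · have := L.exit v (hCD hv) t htD hvt
        subst this
        refine (mem_sdiff.1 (hC'.1 hv)).2 ?_
        rw [hSN]
        exact mem_filter.2 ⟨hCD hv, hvt.symm⟩
    obtain ⟨p, a, q, b, hp, hq, ha, hb, hpa, hqb, hne, hex⟩ := exists_exits (hall2 C hC)
    have haS := hexit p hp a ha hpa
    have hbS := hexit q hq b hb hqb
    have hab : a ≠ b := by
      rintro rfl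
      have := Env.eq_compl_of_exit (L.noncut a (hSD haS)) hC'.2.1 ha fun v hv t ht hvt => by
        rcases hex v hv t ht hvt with h | h <;> exact h.2
      have hz : z ∈ C := by
        rw [this, mem_compl, mem_singleton]
        rintro rfl
        exact L.hz (hSD haS)
      exact L.hz (hCD hz)
    have htwo : TwoExit G C p a q b := ⟨hp, hq, ha, hb, hab, hpa, hqb, hex, hC'.2.2.2⟩
    have hthr : Thread G C a b := ⟨⟨p, q, htwo⟩, fun v hv => by
      by_contra hv2
      have h2 := hdeg v (hCD hv)
      exact E.no_region C p a q b ⟨htwo, ⟨v, hv, by omega⟩, fun v hv => L.noncut v (hCD hv),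
        L.noncut a (hSD haS), L.noncut b (hSD hbS)⟩⟩
    refine hthr.odd E.bip ?_
    exact add_right_cancel ((E.bip (hSz a haS).1).symm.trans (E.bip (hSz b hbS).1))
  obtain ⟨A, B, hAB, hcomps⟩ := card_eq_two.1 hm'
  have hA := hoddC A (by simp [hcomps])
  have hB := hoddC B (by simp [hcomps])
  have hcard := sum_comps G (D \ S) (fun _ => 1)
  rw [hcomps, sum_pair hAB] at hcard
  simp only [sum_const, smul_eq_mul, mul_one] at hcard
  have hDS := card_sdiff_add_card_eq_card hSD
  rw [Nat.odd_iff] at hA hB hodd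
  omega

/-- There is no lobe of even size. -/
lemma odd (L : Lobe G D z) (E : Env G c) : Odd #D := by
  by_contra hodd
  obtain ⟨x, hx, hmax⟩ := exists_max_image D (deg G) L.ne
  have hn := L.two_le E.bl
  have hdeg : ∀ v ∈ D, 2 ≤ deg G v := fun v hv =>
    E.bl.two_le_deg (z := z) (by rintro rfl; exact L.hz hv)
  have hd3 : deg G x = 3 := by
    by_contra hd3
    by_cases hdx : 4 ≤ deg G x
    · obtain ⟨w, hw, hlt⟩ := L.exists_full_of_max E hx hdx hmax
      exact hodd (L.odd_of_full E hx hmax hw hlt)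
    · exact hodd (L.odd_of_deg_two E fun v hv => by
        have h1 := hmax v hv
        have h2 := hdeg v hv
        omega)
  by_cases hatt : ∃ y ∈ D, G.Adj y z ∧ deg G y = 3
  · obtain ⟨y, hy, hyz, hy3⟩ := hatt
    have hmax' : ∀ v ∈ D, deg G v ≤ deg G y := fun v hv => by rw [hy3, ← hd3]; exact hmax v hv
    rcases L.full_or_violator E hy (by omega) hmax' (Y := (nb G y).erase z) (fun u hu => by
      rw [mem_erase, mem_nb] at hu
      refine ⟨hu.2, ?_⟩
      by_contra huD
      exact hu.1 (L.exit y hy u huD hu.2)) with ⟨w, hw, hlt⟩ | h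
    · exact hodd (L.odd_of_full E hy hmax' hw fun u hu hyu =>
        hlt u (mem_erase.2 ⟨by rintro rfl; exact L.hz hu, mem_nb.2 hyu⟩))
    · obtain ⟨S, hSY, hS, hSd, B, hB, hOB, hB2, hC, hm, hsum⟩ := h
      have h1 := three_mul_card_le (f := fun C => ebd G C) hB fun C hC' hne => (hC C hC' hne).2
      have h2 := card_le_card hSY
      rw [card_erase_of_mem (mem_nb.2 hyz), card_nb] at h2
      rw [hy3] at hm hsum h2
      have h3 := hS.card_pos
      have hSY' : S = (nb G y).erase z := eq_of_subset_of_card_le hSY (by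
        rw [card_erase_of_mem (mem_nb.2 hyz), card_nb, hy3]; omega)
      obtain ⟨C, hCm, hCB⟩ := exists_mem_ne (show 1 < #(comps G ({y}ᶜ \ S)) by omega) B
      have h4 := three_mul_card_le_of_two (f := fun C => ebd G C) hB hCm hCB
        fun C hC' hne => (hC C hC' hne).2
      obtain ⟨hCD, hC3⟩ := hC C hCm hCB
      have hC' := mem_comps.1 hCm
      obtain ⟨u₁, u₂, hu12, rfl⟩ := card_eq_two.1 (show #S = 2 by omega)
      have hSy : ∀ u ∈ ({u₁, u₂} : Finset V), G.Adj y u ∧ u ∈ D := fun u hu => by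
        have h5 := hSY hu
        rw [mem_erase, mem_nb] at h5
        refine ⟨h5.2, ?_⟩
        by_contra huD
        exact h5.1 (L.exit y hy u huD h5.2)
      obtain ⟨u, hu, u', hu', t, htwo⟩ := hC'.exists_twoExit_insert hu12
        (fun u hu => ⟨(hSy u hu).1, (hSd u hu).trans hy3⟩) (fun v hv hvy => by
          have hvz : v ≠ z := fun h => L.hz (h ▸ hCD hv)
          refine hC'.notMem_of_mem (u := v) ?_ hv
          rw [hSY']
          exact mem_erase.2 ⟨hvz, mem_nb.2 hvy.symm⟩) (by omega)
      refine E.no_region _ _ _ _ _ ⟨htwo, ⟨u, mem_insert_self u C, ?_⟩, fun v hv => ?_,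
        L.noncut y hy, L.noncut u' (hSy u' hu').2⟩
      · have := hSd u hu
        omega
      · rcases mem_insert.1 hv with rfl | hv
        · exact L.noncut v (hSy v hu).2
        · exact L.noncut v (hCD hv)
  · push Not at hatt
    obtain ⟨y, hy, hy3, t, ht, ht3, hyt⟩ : ∃ y ∈ D, deg G y = 3 ∧ ∃ t ∈ D, deg G t ≠ 3 ∧
        G.Adj y t := by
      by_contra hcon
      push Not at hcon
      have := L.conn {v ∈ D | deg G v = 3} (filter_subset _ _) ⟨x, by simp [hx, hd3]⟩
        fun u hu v hv huv => by
          rw [mem_filter] at hu ⊢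
          refine ⟨hv, ?_⟩
          by_contra h3
          exact hcon u hu.1 hu.2 v hv h3 huv
      obtain ⟨v, hv, hzv⟩ := exists_adj_of_dg_pos (H := G) (R := D) (u := z) (by omega)
      have hv3 := hatt v hv hzv.symm
      rw [← this, mem_filter] at hv
      exact hv3 hv.2
    have hmax' : ∀ v ∈ D, deg G v ≤ deg G y := fun v hv => by rw [hy3, ← hd3]; exact hmax v hv
    have hnbD : ∀ u ∈ D, deg G u = 3 → ∀ v, G.Adj u v → v ∈ D := fun u hu hu3 v huv => by
      by_contra hvD
      exact hatt u hu (L.exit u hu v hvD huv ▸ huv) hu3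
    rcases L.full_or_violator E hy (by omega) hmax' (Y := nb G y)
      (fun u hu => ⟨mem_nb.1 hu, hnbD y hy hy3 u (mem_nb.1 hu)⟩) with ⟨w, hw, hlt⟩ | h
    · obtain ⟨u, hyu, hu⟩ := hw.exists_conflict E.bip E.bad
      have := hlt u (mem_nb.2 hyu)
      omega
    · obtain ⟨S, hSY, hS, hSd, B, hB, hOB, hB2, hC, hm, hsum⟩ := h
      have h1 := three_mul_card_le (f := fun C => ebd G C) hB fun C hC' hne => (hC C hC' hne).2
      have h2 : #S < 3 := by
        rw [← hy3, ← card_nb]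
        refine card_lt_card (hSY.ssubset_of_ne ?_)
        rintro rfl
        exact ht3 ((hSd t (mem_nb.2 hyt)).trans hy3)
      rw [hy3] at hm hsum
      have hSD : S ⊆ D := fun u hu => hnbD y hy hy3 u (mem_nb.1 (hSY hu))
      have hB' := mem_comps.1 hB
      obtain ⟨C, hCm, hCB⟩ := exists_mem_ne (show 1 < #(comps G ({y}ᶜ \ S)) by omega) B
      have hC' := mem_comps.1 hCm
      obtain ⟨p, a, q, b, hp, hq, ha, hb, hpa, hqb, hne, hex⟩ :=
        exists_exits (show ebd G B = 2 by omega)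
      have hend : ∀ p ∈ B, ∀ a ∉ B, G.Adj p a → a ∈ D ∧ a ∉ C ∧ p ∈ D ∧ p ≠ z := by
        intro p hp a ha hpa
        have haD : a ∈ D ∧ a ∉ C ∧ deg G a = 3 := by
          rcases hB'.exit hp ha hpa with rfl | h
          · exact ⟨hy, hC'.notMem, hy3⟩
          · exact ⟨hSD h, hC'.notMem_of_mem h, (hSd a h).trans hy3⟩
        have hpD := hnbD a haD.1 haD.2.2 p hpa.symm
        exact ⟨haD.1, haD.2.1, hpD, fun h => L.hz (h ▸ hpD)⟩
      have hpe := hend p hp a ha hpa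
      have hqe := hend q hq b hb hqb
      have hab : a ≠ b := by
        rintro rfl
        have := Env.eq_compl_of_exit (L.noncut a hpe.1) hB'.2.1 ha fun v hv t ht hvt => by
          rcases hex v hv t ht hvt with h | h <;> exact h.2
        obtain ⟨v, hv⟩ := hC'.2.1
        refine hCB (hC'.eq_of_mem hB' hv ?_)
        rw [this, mem_compl, mem_singleton]
        rintro rfl
        exact hpe.2.1 hv
      have hpq : p ≠ q := by
        rintro rfl
        have := Env.eq_compl_of_exit (L.noncut p hpe.2.2.1) ⟨a, mem_compl.2 ha⟩
          (by simpa using hp) fun v hv t ht hvt => by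
            rcases hex t (by simpa using ht) v (mem_compl.1 hv) hvt.symm with h | h <;> exact h.1
        have hz : z ∈ Bᶜ := by rw [this]; simpa using hpe.2.2.2.symm
        exact mem_compl.1 hz (hOB (mem_compl.2 L.hz))
      have htwo : TwoExit G B p a q b := ⟨hp, hq, ha, hb, hab, hpa, hqb, hex, hB'.2.2.2⟩
      refine E.no_region _ _ _ _ _ ⟨htwo.compl E.bl hpq, ⟨y, ?_, by omega⟩, fun v hv => ?_,
        L.noncut p hpe.2.2.1, L.noncut q hqe.2.2.1⟩
      · exact mem_compl.2 hB'.notMem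
      · refine L.noncut v ?_
        by_contra hvD
        exact mem_compl.1 hv (hOB (mem_compl.2 hvD))

end Lobe

/-- A minimal counterexample has maximum degree two. -/
lemma Env.deg_le_two (E : Env G c) (v : V) : deg G v ≤ 2 := by
  by_contra hv
  obtain ⟨D, z, L⟩ := exists_lobe E.conn (E.exists_cut (v₀ := v) (by omega))
  exact L.not_odd E (L.odd E)

end Reductions

section PathVertices

variable {V W : Type} {G : SimpleGraph V} {H : SimpleGraph W} {u v : V} {n : ℕ}

/-- The `i`-th vertex of the added path, as a function on the natural numbers. -/
noncomputable def pv (u v : V) (n i : ℕ) : V ⊕ Fin n :=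
  if i = 0 then Sum.inl u else if h : i - 1 < n then Sum.inr ⟨i - 1, h⟩ else Sum.inl v

@[simp] lemma pv_zero : pv u v n 0 = Sum.inl u := by simp [pv]

lemma pv_succ {i : ℕ} (h : i < n) : pv u v n (i + 1) = Sum.inr ⟨i, h⟩ := by simp [pv, h]

@[simp] lemma pv_last : pv u v n (n + 1) = Sum.inl v := by simp [pv]

lemma inr_eq_pv (t : Fin n) : (Sum.inr t : V ⊕ Fin n) = pv u v n (t + 1) := by
  rw [pv_succ t.2]

lemma pathVert_eq_pv (i : Fin (n + 2)) : pathVert u v n i = pv u v n i := by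
  unfold pathVert pv
  have := i.2
  split_ifs <;> first | rfl | omega

lemma pv_inj (huv : u ≠ v) {i j : ℕ} (hi : i ≤ n + 1) (hj : j ≤ n + 1)
    (h : pv u v n i = pv u v n j) : i = j := by
  unfold pv at h
  split_ifs at h <;> simp at h <;> first | omega | exact absurd h huv | exact absurd h.symm huv

lemma addPath_adj (huv : u ≠ v) {p q : V ⊕ Fin n} :
    (addPathGraph G u v n).Adj p q ↔ (∃ a b, p = Sum.inl a ∧ q = Sum.inl b ∧ G.Adj a b) ∨
      ∃ i ≤ n, (p = pv u v n i ∧ q = pv u v n (i + 1)) ∨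
        (p = pv u v n (i + 1) ∧ q = pv u v n i) := by
  simp only [addPathGraph, SimpleGraph.fromEdgeSet_adj, Set.mem_union, Set.mem_image, pathEdges,
    Set.mem_ofPred_eq, pathVert_eq_pv]
  constructor
  · rintro ⟨⟨e, he, h⟩ | ⟨i, h⟩, hne⟩
    · left
      induction e with
      | _ a b =>
        rw [Sym2.map_mk, Sym2.eq_iff] at h
        rcases h with ⟨h1, h2⟩ | ⟨h1, h2⟩
        · exact ⟨a, b, h1.symm, h2.symm, he⟩
        · exact ⟨b, a, h2.symm, h1.symm, (show G.Adj a b from he).symm⟩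
    · right
      refine ⟨i, by omega, ?_⟩
      simpa [Sym2.eq_iff] using h
  · rintro (⟨a, b, rfl, rfl, h⟩ | ⟨i, hi, h⟩)
    · exact ⟨Or.inl ⟨s(a, b), h, rfl⟩, by simpa using h.ne⟩
    · refine ⟨Or.inr ⟨⟨i, by omega⟩, by simpa [Sym2.eq_iff] using h⟩, ?_⟩
      rintro rfl
      rcases h with ⟨h1, h2⟩ | ⟨h1, h2⟩ <;>
      · have := pv_inj huv (by omega) (by omega) (h1.symm.trans h2)
        omega

lemma addPath_adj_inl (huv : u ≠ v) (hn : n ≠ 0) {a b : V} :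
    (addPathGraph G u v n).Adj (Sum.inl a) (Sum.inl b) ↔ G.Adj a b := by
  rw [addPath_adj huv]
  constructor
  · rintro (⟨a', b', h1, h2, h⟩ | ⟨i, hi, h⟩)
    · cases h1; cases h2; exact h
    · exfalso
      rcases h with ⟨h1, h2⟩ | ⟨h1, h2⟩ <;> unfold pv at h1 h2 <;>
        split_ifs at h1 h2 <;> omega
  · exact fun h => Or.inl ⟨a, b, rfl, rfl, h⟩

lemma addPath_adj_pv (huv : u ≠ v) {i : ℕ} (hi : i ≤ n) :
    (addPathGraph G u v n).Adj (pv u v n i) (pv u v n (i + 1)) :=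
  (addPath_adj huv).2 (Or.inr ⟨i, hi, Or.inl ⟨rfl, rfl⟩⟩)

lemma addPath_adj_pv_iff (huv : u ≠ v) {i : ℕ} (hi : i < n) {q : V ⊕ Fin n} :
    (addPathGraph G u v n).Adj (pv u v n (i + 1)) q ↔
      q = pv u v n i ∨ q = pv u v n (i + 2) := by
  rw [addPath_adj huv]
  constructor
  · rintro (⟨a', b', h1, h2, h⟩ | ⟨j, hj, ⟨h1, h2⟩ | ⟨h1, h2⟩⟩)
    · rw [pv_succ hi] at h1
      cases h1
    · have := pv_inj huv (by omega) (by omega) h1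
      subst this
      exact Or.inr h2
    · have := pv_inj huv (by omega) (by omega) h1
      simp only [Nat.add_right_cancel_iff] at this
      subst this
      exact Or.inl h2
  · rintro (rfl | rfl)
    · exact Or.inr ⟨i, by omega, Or.inr ⟨rfl, rfl⟩⟩
    · exact Or.inr ⟨i + 1, by omega, Or.inl ⟨rfl, rfl⟩⟩

lemma addPath_adj_inl_inr (huv : u ≠ v) {a : V} {t : Fin n} :
    (addPathGraph G u v n).Adj (Sum.inl a) (Sum.inr t) ↔
      (a = u ∧ t.1 = 0) ∨ (a = v ∧ t.1 + 1 = n) := by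
  rw [SimpleGraph.adj_comm, inr_eq_pv, addPath_adj_pv_iff huv t.2]
  have h1 := t.2
  unfold pv
  split_ifs <;> simp <;> grind

lemma addPath_adj_inr_inr (huv : u ≠ v) {s t : Fin n} :
    (addPathGraph G u v n).Adj (Sum.inr s) (Sum.inr t) ↔ s.1 + 1 = t ∨ t.1 + 1 = s := by
  rw [inr_eq_pv, addPath_adj_pv_iff huv s.2]
  have h1 := s.2
  have h2 := t.2
  unfold pv
  split_ifs <;> simp [Fin.ext_iff] <;> grind

/-- Adding a path commutes with isomorphisms. -/
def addPathIso (e : G ≃g H) (u v : V) (n : ℕ) (huv : u ≠ v) (hn : n ≠ 0) :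
    addPathGraph G u v n ≃g addPathGraph H (e u) (e v) n where
  toEquiv := Equiv.sumCongr e.toEquiv (Equiv.refl _)
  map_rel_iff' := by
    have huv' : e u ≠ e v := fun h => huv (e.injective h)
    rintro (a | s) (b | t)
    · simp [addPath_adj_inl huv hn, addPath_adj_inl huv' hn, e.map_adj_iff]
    · simp [addPath_adj_inl_inr huv, addPath_adj_inl_inr huv']
    · rw [SimpleGraph.adj_comm, SimpleGraph.adj_comm _ (Sum.inr s)]
      simp [addPath_adj_inl_inr huv, addPath_adj_inl_inr huv']
    · simp [addPath_adj_inr_inr huv, addPath_adj_inr_inr huv']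

/-- The order in which two paths are added to a graph is immaterial. -/
def addPathComm (G : SimpleGraph V) (a b x u : V) (m n : ℕ) (hab : a ≠ b) (hxu : x ≠ u)
    (hm : m ≠ 0) (hn : n ≠ 0) :
    addPathGraph (addPathGraph G a b m) (Sum.inl x) (Sum.inl u) n ≃g
      addPathGraph (addPathGraph G x u n) (Sum.inl a) (Sum.inl b) m where
  toEquiv := (Equiv.sumAssoc V (Fin m) (Fin n)).trans
    (((Equiv.refl V).sumCongr (Equiv.sumComm (Fin m) (Fin n))).trans
      (Equiv.sumAssoc V (Fin n) (Fin m)).symm)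
  map_rel_iff' := by
    have h1 : (Sum.inl x : V ⊕ Fin m) ≠ Sum.inl u := by simpa
    have h2 : (Sum.inl a : V ⊕ Fin n) ≠ Sum.inl b := by simpa
    rintro ((p | p) | p) ((q | q) | q) <;>
    simp [addPath_adj_inl h1 hn, addPath_adj_inl h2 hm, addPath_adj_inl hxu hn,
      addPath_adj_inl hab hm, addPath_adj_inl_inr h1, addPath_adj_inl_inr h2,
      addPath_adj_inl_inr hab, addPath_adj_inl_inr hxu, addPath_adj_inr_inr h1,
      addPath_adj_inr_inr h2, addPath_adj_inr_inr hab, addPath_adj_inr_inr hxu,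
      SimpleGraph.adj_comm _ (Sum.inr _) (Sum.inl _)]

/-- Reversing the added path. -/
def addPathSwap (G : SimpleGraph V) (u v : V) (n : ℕ) (huv : u ≠ v) (hn : n ≠ 0) :
    addPathGraph G u v n ≃g addPathGraph G v u n where
  toEquiv := (Equiv.refl V).sumCongr Fin.revPerm
  map_rel_iff' := by
    rintro (a | s) (b | t)
    · simp [addPath_adj_inl huv hn, addPath_adj_inl huv.symm hn]
    · simp [addPath_adj_inl_inr huv, addPath_adj_inl_inr huv.symm]
      grind
    · rw [SimpleGraph.adj_comm, SimpleGraph.adj_comm _ (Sum.inr s)]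
      simp [addPath_adj_inl_inr huv, addPath_adj_inl_inr huv.symm]
      grind
    · simp [addPath_adj_inr_inr huv, addPath_adj_inr_inr huv.symm]
      omega

end PathVertices

section Transfer

variable {V W : Type} [Fintype V] [Fintype W] {G : SimpleGraph V} {H : SimpleGraph W}

lemma wdeg_eq_sd (w : Sym2 V → ℕ) (w' : Sym2 V → ZMod 2)
    (h : ∀ e ∈ G.edgeSet, w e = if w' e = 1 then 1 else 0) (v : V) : wdeg G w v = sd G w' v := by
  rw [wdeg, sd, sdOn, ← filter_filter, card_filter]
  exact sum_congr rfl fun u hu => h _ (mem_filter.1 hu).2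

lemma good_iff : Good G ↔ HasZeroOneProperty G := by
  constructor
  · rintro ⟨w, hw⟩
    refine ⟨fun e => if w e = 1 then 1 else 0, fun e _ => ?_, fun u v huv => ?_⟩
    · by_cases h : w e = 1 <;> simp [h]
    · rw [wdeg_eq_sd _ w fun _ _ => rfl, wdeg_eq_sd _ w fun _ _ => rfl]
      exact hw huv
  · rintro ⟨w, h01, hw⟩
    have h : ∀ e ∈ G.edgeSet, w e = if (w e : ZMod 2) = 1 then 1 else 0 := fun e he => by
      rcases h01 e he with h | h <;> simp [h]
    refine ⟨fun e => w e, fun u v huv => ?_⟩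
    rw [← wdeg_eq_sd w _ h, ← wdeg_eq_sd w _ h]
    exact hw huv

lemma sd_iso (e : G ≃g H) (w : Sym2 W → ZMod 2) (v : V) :
    sd G (fun f => w (f.map e)) v = sd H w (e v) := by
  rw [sd, sd, sdOn, sdOn]
  refine card_bij (fun a _ => e a) (fun a ha => ?_) (fun a _ b _ h => e.injective h) fun b hb => ?_
  · exact mem_filter.2 ⟨mem_univ _, e.map_adj_iff.2 (mem_filter.1 ha).2.1, (mem_filter.1 ha).2.2⟩
  · refine ⟨e.symm b, mem_filter.2 ⟨mem_univ _, ?_⟩, by simp⟩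
    rw [← e.map_adj_iff, Sym2.map_mk, e.apply_symm_apply]
    exact (mem_filter.1 hb).2

lemma Good.of_iso (e : G ≃g H) (h : Good H) : Good G := by
  obtain ⟨w, hw⟩ := h
  refine ⟨fun f => w (f.map e), fun u v huv => ?_⟩
  rw [sd_iso, sd_iso]
  exact hw (e.map_adj_iff.2 huv)

lemma good_congr (e : G ≃g H) : Good G ↔ Good H :=
  ⟨Good.of_iso e.symm, Good.of_iso e⟩

end Transfer

section Cactus

variable {V : Type} {G : SimpleGraph V} {u v : V} {n : ℕ}

lemma wdeg_addPath_inl [Fintype V] (huv : u ≠ v) (hn : n ≠ 0) (w : Sym2 (V ⊕ Fin n) → ℕ) (a : V) :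
    wdeg (addPathGraph G u v n) w (Sum.inl a) = wdeg G (fun e => w (e.map Sum.inl)) a +
      ((if a = u then w s(pv u v n 0, pv u v n 1) else 0) +
        if a = v then w s(pv u v n n, pv u v n (n + 1)) else 0) := by
  obtain ⟨m, rfl⟩ : ∃ m, n = m + 1 := ⟨n - 1, by omega⟩
  rw [wdeg, sum_filter, Fintype.sum_sum_type, wdeg, sum_filter]
  simp only [addPath_adj_inl huv hn, addPath_adj_inl_inr huv]
  congr 1
  have h1 : (pv u v (m + 1) 1) = Sum.inr 0 := pv_succ (by omega)
  have h2 : (pv u v (m + 1) (m + 1)) = Sum.inr (Fin.last m) := pv_succ (by omega)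
  rw [pv_zero, pv_last, h1, h2]
  by_cases hu : a = u
  · subst hu
    simp only [huv, true_and, false_and, or_false, if_true, if_false, add_zero]
    rw [sum_eq_single 0]
    · simp
    · intro t _ ht
      exact if_neg fun h => ht (Fin.ext h)
    · simp
  · by_cases hv : a = v
    · subst hv
      simp only [hu, true_and, false_and, false_or, if_true, if_false, zero_add]
      rw [sum_eq_single (Fin.last m)]
      · simp [Sym2.eq_swap]
      · intro t _ ht
        exact if_neg fun h => ht (Fin.ext (Nat.add_right_cancel h))
      · simp
    · simp [hu, hv]

lemma wdeg_addPath_pv [Fintype V] (huv : u ≠ v) (w : Sym2 (V ⊕ Fin n) → ℕ) {i : ℕ} (hi : i < n) :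
    wdeg (addPathGraph G u v n) w (pv u v n (i + 1)) =
      w s(pv u v n i, pv u v n (i + 1)) + w s(pv u v n (i + 1), pv u v n (i + 2)) := by
  have h : univ.filter ((addPathGraph G u v n).Adj (pv u v n (i + 1))) =
      {pv u v n i, pv u v n (i + 2)} := by
    ext q
    simp [addPath_adj_pv_iff huv hi]
  have h2 : pv u v n i ≠ pv u v n (i + 2) := fun h => by
    have := pv_inj huv (by omega) (by omega) h
    omega
  rw [wdeg, h, sum_pair h2, Sym2.eq_swap]

lemma alternate {f : ℕ → ℕ} {k : ℕ} (h1 : ∀ i ≤ 2 * k, f i ≤ 1)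
    (h2 : ∀ i < 2 * k, f i ≠ f (i + 1)) : f (2 * k) = f 0 := by
  induction k with
  | zero => rfl
  | succ k ih =>
    rw [← ih (fun i hi => h1 i (by omega)) fun i hi => h2 i (by omega)]
    have := h1 (2 * k) (by omega)
    have := h1 (2 * k + 1) (by omega)
    have := h1 (2 * k + 2) (by omega)
    have := h2 (2 * k) (by omega)
    have := h2 (2 * k + 1) (by omega)
    show f (2 * k + 2) = _
    simp only [add_assoc, Nat.reduceAdd] at *
    omega

lemma map_inl_ne_path {e : Sym2 V} {i : ℕ} (hn : n ≠ 0) (hi : i ≤ n) :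
    e.map Sum.inl ≠ s(pv u v n i, pv u v n (i + 1)) := by
  induction e with
  | _ a b =>
    rw [Sym2.map_mk, Ne, Sym2.eq_iff]
    unfold pv
    split_ifs <;> simp only [Sum.inl.injEq, false_and, and_false, or_false, not_false_eq_true]
    all_goals first | omega | grind

/-- However the green edges of an odd multi-cactus are weighted, if the other edges have weights
zero or one, then two adjacent vertices have the same weighted degree. -/
lemma exists_conflict_of_omc {green : Set (Sym2 V)} (h : OMC V G green) :
    ∀ [Fintype V] (w : Sym2 V → ℕ), (∀ e ∈ G.edgeSet, e ∉ green → w e ≤ 1) →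
      ∃ a b, G.Adj a b ∧ s(a, b) ∈ green ∧ wdeg G w a = wdeg G w b := by
  induction h with
  | k2 =>
    intro inst w _
    refine ⟨0, 1, by simp, by simp, ?_⟩
    obtain rfl : inst = Fin.fintype 2 := Subsingleton.elim _ _
    simp [wdeg, sum_filter, Sym2.eq_swap]
  | @addPath V G green h u v hadj hgreen k ih =>
    generalize hn : 4 * k + 4 = n
    intro inst w hw
    have hfin : Finite V := Finite.of_injective (Sum.inl : V → V ⊕ Fin n) Sum.inl_injective
    obtain ⟨_⟩ := nonempty_fintype V
    obtain rfl : inst = instFintypeSum V (Fin n) := Subsingleton.elim _ _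
    have huv := hadj.ne
    by_cases hc : ∃ i < n, Odd i ∧
        wdeg (addPathGraph G u v n) w (pv u v n i) = wdeg (addPathGraph G u v n) w (pv u v n (i + 1))
    · obtain ⟨i, hi, hodd, h⟩ := hc
      refine ⟨_, _, addPath_adj_pv huv hi.le, Or.inr ⟨⟨i, by omega⟩, hodd, ?_⟩, h⟩
      simp [pathVert_eq_pv]
    push Not at hc
    set r : ℕ → ℕ := fun i => w s(pv u v n i, pv u v n (i + 1)) with hr
    have hred : ∀ j ≤ 2 * (k + 1), r (2 * j) ≤ 1 := fun j hj => by
      refine hw _ (addPath_adj_pv huv (by omega)) ?_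
      rintro (⟨e, he, h⟩ | ⟨i, hi, h⟩)
      · exact map_inl_ne_path (by omega) (by omega) h
      · simp only [pathVert_eq_pv, Fin.val_castSucc, Fin.val_succ] at h
        have := i.2
        rcases Sym2.eq_iff.1 h with ⟨h1, -⟩ | ⟨h1, h2⟩
        · have := pv_inj huv (by omega) (by omega) h1
          rw [← this] at hi
          exact Nat.not_odd_iff_even.2 (even_two_mul j) hi
        · have := pv_inj huv (by omega) (by omega) h1
          have := pv_inj huv (by omega) (by omega) h2
          omega
    have halt : ∀ j < 2 * (k + 1), r (2 * j) ≠ r (2 * (j + 1)) := fun j hj h => by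
      refine hc (2 * j + 1) (by omega) ⟨j, rfl⟩ ?_
      rw [wdeg_addPath_pv huv w (by omega), wdeg_addPath_pv huv w (by omega)]
      simp only [hr] at h
      rw [h, add_comm]
      rfl
    have hends : r n = r 0 := by
      have := alternate (f := fun j => r (2 * j)) hred halt
      rw [← hn, show 4 * k + 4 = 2 * (2 * (k + 1)) by ring]
      exact this
    have hdeg : ∀ a, wdeg (addPathGraph G u v n) w (Sum.inl a) =
        wdeg G (fun e => w (e.map Sum.inl) + if e = s(u, v) then r 0 else 0) a := fun a => by
      rw [wdeg_addPath_inl huv (by omega)]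
      simp only [wdeg, sum_add_distrib]
      congr 1
      change (if a = u then r 0 else 0) + (if a = v then r n else 0) = _
      rw [hends, sum_filter]
      by_cases hu : a = u
      · subst hu
        rw [sum_eq_single v] <;> simp [huv, hadj]
        tauto
      · by_cases hv : a = v
        · subst hv
          rw [sum_eq_single u] <;> simp [hu, hadj.symm, Sym2.eq_swap]
          tauto
        · simp [hu, hv]
    obtain ⟨a, b, hab, hgr, h⟩ := ih (fun e => w (e.map Sum.inl) + if e = s(u, v) then r 0 else 0)
      fun e he hne => by
        rw [if_neg (fun h => hne (by rw [h]; exact hgreen)), add_zero]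
        refine hw _ ?_ ?_
        · induction e with
          | _ a b => exact (addPath_adj_inl huv (by omega)).2 he
        · rintro (⟨e', he', h⟩ | ⟨i, hi, h⟩)
          · exact hne (Sym2.map.injective Sum.inl_injective h ▸ he')
          · simp only [pathVert_eq_pv, Fin.val_castSucc, Fin.val_succ] at h
            exact map_inl_ne_path (by omega) (by omega) h
    refine ⟨Sum.inl a, Sum.inl b, (addPath_adj_inl huv (by omega)).2 hab, Or.inl ⟨_, hgr, rfl⟩, ?_⟩
    rw [hdeg, hdeg, h]

lemma not_good_of_omc {green : Set (Sym2 V)} [Fintype V] (h : OMC V G green) : ¬ Good G := by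
  rw [good_iff]
  rintro ⟨w, h01, hw⟩
  obtain ⟨a, b, hab, -, h⟩ := exists_conflict_of_omc h w fun e he _ => by
    rcases h01 e he with h | h <;> omega
  exact hw hab h

end Cactus

section BridgeCondition

variable {V : Type} [Fintype V] {G H : SimpleGraph V} {c : V → ZMod 2}

lemma ConnOn.forall {R : Finset V} (h : ConnOn H R) {P : V → Prop}
    (hP : ∀ a ∈ R, ∀ b ∈ R, H.Adj a b → P a → P b) {a : V} (ha : a ∈ R) (hPa : P a) :
    ∀ b ∈ R, P b := by
  have := h {v ∈ R | P v} (filter_subset _ _) ⟨a, by simp [ha, hPa]⟩ fun u hu v hv huv => by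
    simp only [mem_filter] at hu ⊢
    exact ⟨hv, hP u hu.1 v hv huv hu.2⟩
  intro b hb
  rw [← this] at hb
  exact (mem_filter.1 hb).2

lemma connOn_of_hub {R : Finset V} (r : V) (h : ∀ P : V → Prop,
    (∀ a ∈ R, ∀ b ∈ R, H.Adj a b → (P a ↔ P b)) → ∀ a ∈ R, (P a ↔ P r)) : ConnOn H R := by
  intro X hX ⟨a, ha⟩ hcl
  have := h (· ∈ X) fun a ha b hb hab => ⟨fun h => hcl a h b hb hab, fun h => hcl b h a ha hab.symm⟩
  exact hX.antisymm fun b hb => (this b hb).2 ((this a (hX ha)).1 ha)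

lemma chain_iff {P : ℕ → Prop} {lo hi : ℕ} (h : ∀ i, lo ≤ i → i < hi → (P i ↔ P (i + 1))) {i : ℕ}
    (h1 : lo ≤ i) (h2 : i ≤ hi) : P i ↔ P hi := by
  induction hi, h2 using Nat.le_induction with
  | base => rfl
  | succ k hk ih =>
    exact (ih fun j hj hjk => h j hj (by omega)).trans (h k (by omega) (by omega))

/-- `G` stays connected when any one edge is deleted. -/
def BC (G : SimpleGraph V) : Prop := ∀ a b, ConnOn (G.deleteEdges {s(a, b)}) univ

lemma BC.connOn (h : BC G) : ConnOn G univ := by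
  intro X hX hne hcl
  obtain ⟨a, ha⟩ := hne
  exact (h a a).mono (G.deleteEdges_le _) X hX ⟨a, ha⟩ hcl

lemma bl_iff_bc : BL G ↔ BC G := by
  constructor
  · intro h a b X _ hX hcl
    by_contra hne
    have h1 := h X hX (by
      rw [nonempty_iff_ne_empty, Ne, compl_eq_empty_iff]
      exact hne)
    have hex : ∀ v ∈ X, ∀ z, z ∉ X → G.Adj v z → s(v, z) = s(a, b) := fun v hv z hz hvz => by
      by_contra hne
      exact hz (hcl v hv z (mem_univ _) ((G.deleteEdges_adj).2 ⟨hvz, hne⟩))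
    have : ebd G X ≤ 1 := by
      by_cases ha : a ∈ X
      · refine ebd_le_one (p := a) (x := b) fun v hv z hz hvz => ?_
        rcases Sym2.eq_iff.1 (hex v hv z hz hvz) with h | ⟨rfl, rfl⟩
        · exact h
        · exact absurd ha hz
      · refine ebd_le_one (p := b) (x := a) fun v hv z hz hvz => ?_
        rcases Sym2.eq_iff.1 (hex v hv z hz hvz) with ⟨rfl, rfl⟩ | h
        · exact absurd hv ha
        · exact h
    omega
  · intro h X hX ⟨r, hr⟩
    by_contra hlt
    have hr : r ∉ X := mem_compl.1 hr
    have key : ∃ a b, ∀ v ∈ X, ∀ z, z ∉ X → G.Adj v z → s(v, z) = s(a, b) := by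
      by_cases hex : ∃ p ∈ X, ∃ x, x ∉ X ∧ G.Adj p x
      · obtain ⟨p, hp, x, hx, hpx⟩ := hex
        refine ⟨p, x, fun v hv z hz hvz => ?_⟩
        have : ebd G X = #(X.sigma fun v => {z ∈ Xᶜ | G.Adj v z}) := by
          rw [card_sigma]; rfl
        rw [this, not_le, Nat.lt_succ_iff, card_le_one] at hlt
        have := hlt ⟨v, z⟩ (by simp [hv, hz, hvz]) ⟨p, x⟩ (by simp [hp, hx, hpx])
        cases this
        rfl
      · exact ⟨r, r, fun v hv z hz hvz => absurd ⟨v, hv, z, hz, hvz⟩ hex⟩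
    obtain ⟨a, b, hab⟩ := key
    refine hr ?_
    rw [h a b X (subset_univ _) hX fun u hu v _ huv => ?_]
    · exact mem_univ r
    · rw [SimpleGraph.deleteEdges_adj] at huv
      by_contra hv
      exact huv.2 (hab u hu v hv huv.1)

lemma eq_of_deg_two {v a b t : V} (h : deg G v = 2) (hab : a ≠ b) (ha : G.Adj v a) (hb : G.Adj v b)
    (ht : G.Adj v t) : t = a ∨ t = b := by
  rw [← card_nb] at h
  have := eq_of_subset_of_card_le (s := {a, b}) (t := nb G v)
    (by intro s; simp only [mem_insert, mem_singleton, mem_nb]; rintro (rfl | rfl) <;> assumption)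
    (by rw [card_pair hab, h])
  simpa [← this] using mem_nb.2 ht

lemma TwoExit.exists_seq {q u : V} {n : ℕ} : ∀ {C : Finset V} {p x : V}, TwoExit G C p x q u →
    (∀ v ∈ C, deg G v = 2) → #C = n → ∃ f : ℕ → V, f 0 = x ∧ f (n + 1) = u ∧
      (∀ i ≤ n, G.Adj (f i) (f (i + 1))) ∧ (∀ i j, i ≤ n + 1 → j ≤ n + 1 → f i = f j → i = j) ∧
      ∀ v, v ∈ C ↔ ∃ i < n, f (i + 1) = v := by
  induction n with
  | zero =>
    intro C p x h _ hC
    exact absurd h.hp (by simp [card_eq_zero.1 hC])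
  | succ n ih =>
    intro C p x h h2 hC
    by_cases hpq : p = q
    · subst hpq
      have hCp : C = {p} := by
        refine (h.conn {p} (by simpa using h.hp) (singleton_nonempty p) fun v hv t ht hvt => ?_).symm
        rw [mem_singleton.1 hv] at hvt
        rcases eq_of_deg_two (h2 p h.hp) h.ne h.px h.qu hvt with rfl | rfl
        · exact absurd ht h.hx
        · exact absurd ht h.hu
      obtain rfl : n = 0 := by simpa [hCp] using hC.symm
      have hxp := h.px.ne
      have hup := h.qu.ne
      refine ⟨fun i => if i = 0 then x else if i = 1 then p else u, by simp, by simp, ?_, ?_, ?_⟩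
      · intro i hi
        have hi : i = 0 ∨ i = 1 := by omega
        rcases hi with rfl | rfl
        · simpa using h.px.symm
        · simpa using h.qu
      · intro i j hi hj
        have := h.ne
        have hi : i = 0 ∨ i = 1 ∨ i = 2 := by omega
        have hj : j = 0 ∨ j = 1 ∨ j = 2 := by omega
        rcases hi with rfl | rfl | rfl <;> rcases hj with rfl | rfl | rfl <;> simp <;> tauto
      · intro v
        simp [hCp, eq_comm]
    have hxnb : x ∈ nb G p := mem_nb.2 h.px
    obtain ⟨p', hp'⟩ : ∃ p', p' ∈ (nb G p).erase x := by
      refine card_pos.1 ?_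
      rw [card_erase_of_mem hxnb, card_nb, h2 p h.hp]
      norm_num
    simp only [mem_erase, mem_nb] at hp'
    have hp'C : p' ∈ C := by
      by_contra hn
      rcases h.exit p h.hp p' hn hp'.2 with h1 | h1
      · exact hp'.1 h1.2
      · exact hpq h1.1
    have hnbp : ∀ t ∈ C, G.Adj p t → t = p' := fun t ht hpt => by
      rcases eq_of_deg_two (h2 p h.hp) hp'.1.symm h.px hp'.2 hpt with rfl | h1
      · exact absurd ht h.hx
      · exact h1
    have hup : p ≠ u := fun h1 => h.hu (h1 ▸ h.hp)
    have hnew : TwoExit G (C.erase p) p' p q u := by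
      refine ⟨mem_erase.2 ⟨hp'.2.ne', hp'C⟩, mem_erase.2 ⟨Ne.symm hpq, h.hq⟩, notMem_erase p C,
        fun h1 => h.hu (mem_of_mem_erase h1), hup, hp'.2.symm, h.qu, ?_, ?_⟩
      · intro v hv z hz hvz
        rw [mem_erase] at hv
        by_cases hzC : z ∈ C
        · obtain rfl : z = p := by by_contra hzp; exact hz (mem_erase.2 ⟨hzp, hzC⟩)
          exact Or.inl ⟨hnbp v hv.2 hvz.symm, rfl⟩
        · rcases h.exit v hv.2 z hzC hvz with h1 | h1
          · exact absurd h1.1 hv.1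
          · exact Or.inr h1
      · refine connOn_of_hub p' fun P hP => ?_
        have := h.conn.forall (P := fun v => v = p ∨ (P v ↔ P p')) (fun a ha b hb hab hPa => ?_)
          h.hp (Or.inl rfl)
        · intro a ha
          rw [mem_erase] at ha
          exact (this a ha.2).resolve_left ha.1
        · by_cases hbp : b = p
          · exact Or.inl hbp
          right
          by_cases hap : a = p
          · rw [hnbp b hb (hap ▸ hab)]
          · rw [← hPa.resolve_left hap]
            exact (hP a (mem_erase.2 ⟨hap, ha⟩) b (mem_erase.2 ⟨hbp, hb⟩) hab).symm
    obtain ⟨f, h0, hl, hadj, hinj, hCf⟩ := ih hnew (fun v hv => h2 v (mem_of_mem_erase hv))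
      (by rw [card_erase_of_mem h.hp, hC]; rfl)
    have hxf : ∀ i ≤ n + 1, f i ≠ x := by
      intro i hi hx
      rcases Nat.eq_zero_or_pos i with rfl | hpos
      · exact h.px.ne (h0.symm.trans hx)
      · rcases hi.eq_or_lt with rfl | hlt
        · exact h.ne (hx.symm.trans hl)
        · have := (hCf x).2 ⟨i - 1, by omega, by rw [Nat.sub_add_cancel hpos, hx]⟩
          exact h.hx (mem_of_mem_erase this)
    refine ⟨fun i => if i = 0 then x else f (i - 1), by simp, by simpa using hl, ?_, ?_, ?_⟩
    · intro i hi
      rcases i with _ | i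
      · simpa [h0] using h.px.symm
      · simpa using hadj i (by omega)
    · rintro (_ | i) (_ | j) hi hj hij
      · rfl
      · exact absurd (by simpa using hij.symm) (hxf j (by omega))
      · exact absurd (by simpa using hij) (hxf i (by omega))
      · rw [hinj i j (by omega) (by omega) (by simpa using hij)]
    · intro v
      have hv : v ∈ C ↔ v = p ∨ v ∈ C.erase p := by
        rw [mem_erase]
        by_cases hvp : v = p
        · simp [hvp, h.hp]
        · simp [hvp]
      rw [hv, hCf]
      constructor
      · rintro (rfl | ⟨i, hi, rfl⟩)
        · exact ⟨0, by omega, by simpa using h0⟩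
        · exact ⟨i + 1, by omega, by simp⟩
      · rintro ⟨_ | i, hi, hf⟩
        · exact Or.inl (by simpa [h0] using hf.symm)
        · exact Or.inr ⟨i, by omega, by simpa using hf⟩

/-- A thread is an added path. -/
lemma TwoExit.exists_iso {C : Finset V} {p x q u : V} (h : TwoExit G C p x q u)
    (h2 : ∀ v ∈ C, deg G v = 2) : ∃ e : G ≃g addPathGraph (G.induce {v | v ∉ C}) ⟨x, h.hx⟩ ⟨u, h.hu⟩ #C,
      e x = Sum.inl ⟨x, h.hx⟩ ∧ e u = Sum.inl ⟨u, h.hu⟩ := by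
  obtain ⟨f, h0, hl, hadj, hinj, hCf⟩ := h.exists_seq h2 rfl
  have hn : #C ≠ 0 := (card_pos.2 ⟨p, h.hp⟩).ne'
  have hxu : (⟨x, h.hx⟩ : {v | v ∉ C}) ≠ ⟨u, h.hu⟩ := fun h1 => h.ne (congrArg Subtype.val h1)
  let F : {v | v ∉ C} ⊕ Fin #C → V := Sum.elim Subtype.val fun i => f (i + 1)
  have hpv : ∀ i ≤ #C + 1, F (pv ⟨x, h.hx⟩ ⟨u, h.hu⟩ #C i) = f i := by
    intro i hi
    unfold pv
    split_ifs with h1 h3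
    · rw [h1, h0]; rfl
    · show f (i - 1 + 1) = f i
      rw [Nat.sub_add_cancel (by omega)]
    · rw [show i = #C + 1 by omega, hl]; rfl
  have hFinj : Function.Injective F := by
    rintro (a | i) (b | j) hab
    · exact congrArg _ (Subtype.ext hab)
    · exact absurd ((hCf _).2 ⟨j, j.2, hab.symm⟩) a.2
    · exact absurd ((hCf _).2 ⟨i, i.2, hab⟩) b.2
    · have := hinj _ _ (by omega) (by omega) hab
      exact congrArg _ (Fin.ext (by omega))
  have hFsurj : Function.Surjective F := fun v => by
    by_cases hv : v ∈ C
    · obtain ⟨i, hi, rfl⟩ := (hCf v).1 hv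
      exact ⟨Sum.inr ⟨i, hi⟩, rfl⟩
    · exact ⟨Sum.inl ⟨v, hv⟩, rfl⟩
  have hr : ∀ (i : Fin #C) s, G.Adj (F (Sum.inr i)) (F s) ↔
      (addPathGraph (G.induce {v | v ∉ C}) ⟨x, h.hx⟩ ⟨u, h.hu⟩ #C).Adj (Sum.inr i) s := by
    intro i s
    have hi := i.2
    rw [inr_eq_pv, addPath_adj_pv_iff hxu i.2, hpv _ (by omega)]
    have h1 := (hadj i (by omega)).symm
    have h3 := hadj (i + 1) (by omega)
    constructor
    · intro h4
      have := eq_of_deg_two (h2 _ ((hCf _).2 ⟨i, i.2, rfl⟩)) (fun h5 => by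
        have := hinj _ _ (by omega) (by omega) h5
        omega) h1 h3 h4
      rw [← hpv _ (by omega), ← hpv (i + 1 + 1) (by omega)] at this
      exact this.imp (fun h => hFinj h) fun h => hFinj h
    · rintro (rfl | rfl)
      · rwa [hpv _ (by omega)]
      · rwa [hpv _ (by omega)]
  let e : addPathGraph (G.induce {v | v ∉ C}) ⟨x, h.hx⟩ ⟨u, h.hu⟩ #C ≃g G :=
    { toEquiv := Equiv.ofBijective F ⟨hFinj, hFsurj⟩
      map_rel_iff' := by
        rintro (a | i) (b | j)
        · rw [addPath_adj_inl hxu hn]; rfl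
        · rw [SimpleGraph.adj_comm, SimpleGraph.adj_comm _ (Sum.inl a)]
          exact hr j (Sum.inl a)
        · exact hr i (Sum.inl b)
        · exact hr i (Sum.inr j) }
  exact ⟨e.symm, e.injective (by rw [RelIso.apply_symm_apply]; rfl),
    e.injective (by rw [RelIso.apply_symm_apply]; rfl)⟩

end BridgeCondition

section Ear

variable {V : Type} {G : SimpleGraph V} {u v : V} {n : ℕ}

lemma exists_weight (huv : u ≠ v) (hn : n ≠ 0) (W : Sym2 V → ℕ) (g : ℕ → ℕ) :
    ∃ w : Sym2 (V ⊕ Fin n) → ℕ, (∀ e, w (e.map Sum.inl) = W e) ∧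
      ∀ i ≤ n, w s(pv u v n i, pv u v n (i + 1)) = g i := by
  refine ⟨fun e => if h : ∃ e', e = Sym2.map Sum.inl e' then W h.choose
    else if h : ∃ i ≤ n, e = s(pv u v n i, pv u v n (i + 1)) then g h.choose else 0, fun e => ?_,
    fun i hi => ?_⟩
  · have h : ∃ e', e.map (Sum.inl : V → V ⊕ Fin n) = Sym2.map Sum.inl e' := ⟨e, rfl⟩
    simp only [dif_pos h]
    exact congrArg W (Sym2.map.injective Sum.inl_injective h.choose_spec).symm
  · have h : ∃ j ≤ n, s(pv u v n i, pv u v n (i + 1)) = s(pv u v n j, pv u v n (j + 1)) :=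
      ⟨i, hi, rfl⟩
    have h' : ¬ ∃ e', s(pv u v n i, pv u v n (i + 1)) = Sym2.map Sum.inl e' :=
      fun ⟨e', he'⟩ => map_inl_ne_path hn hi he'.symm
    simp only [dif_neg h', dif_pos h]
    obtain ⟨hj, hs⟩ := h.choose_spec
    refine congrArg g ?_
    rcases Sym2.eq_iff.1 hs with ⟨h1, -⟩ | ⟨h1, h2⟩
    · exact (pv_inj huv (by omega) (by omega) h1).symm
    · have := pv_inj huv (by omega) (by omega) h1
      have := pv_inj huv (by omega) (by omega) h2
      omega

/-- Adding an ear of length one modulo four to an edge preserves the `{0,1}`-property. -/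
lemma good_addPath [Fintype V] (huv : G.Adj u v) {k : ℕ} (hn : n = 4 * k + 4) (hG : Good G) :
    Good (addPathGraph G u v n) := by
  rw [good_iff] at hG ⊢
  obtain ⟨W, h01, hW⟩ := hG
  have hn0 : n ≠ 0 := by omega
  have key : ∀ g : ℕ → ℕ, (∀ i, g i = 0 ∨ g i = 1) → g 0 = 0 → g n = 0 →
      (∀ i, g i ≠ g (i + 2)) → wdeg G W u ≠ g 1 → wdeg G W v ≠ g (4 * k + 3) →
      HasZeroOneProperty (addPathGraph G u v n) := by
    intro g hg hg0 hgn halt hgu hgv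
    obtain ⟨w, hw1, hw2⟩ := exists_weight huv.ne hn0 W g
    have hinl : ∀ a, wdeg (addPathGraph G u v n) w (Sum.inl a) = wdeg G W a := fun a => by
      rw [wdeg_addPath_inl huv.ne hn0, hw2 0 (by omega), hw2 n le_rfl, hg0, hgn]
      simp only [hw1, ite_self, add_zero]
    have hpv : ∀ i < n, wdeg (addPathGraph G u v n) w (pv u v n (i + 1)) = g i + g (i + 1) :=
      fun i hi => by rw [wdeg_addPath_pv huv.ne w hi, hw2 i (by omega), hw2 (i + 1) (by omega)]
    have hpath : ∀ i ≤ n, wdeg (addPathGraph G u v n) w (pv u v n i) ≠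
        wdeg (addPathGraph G u v n) w (pv u v n (i + 1)) := fun i hi => by
      rcases i with _ | i
      · rw [hpv 0 (by omega), pv_zero, hinl, hg0, zero_add]
        exact hgu
      · rcases hi.eq_or_lt with h | h
        · rw [hpv i (by omega), h, pv_last, hinl, hgn, show i = 4 * k + 3 by omega]
          exact hgv.symm
        · rw [hpv i (by omega), hpv (i + 1) h, add_comm]
          exact fun h => halt i (Nat.add_left_cancel h)
    refine ⟨w, fun e he => ?_, fun p q hpq => ?_⟩
    · induction e with
      | _ p q =>
        rcases (addPath_adj huv.ne).1 he with ⟨a, b, rfl, rfl, hab⟩ | ⟨i, hi, ⟨rfl, rfl⟩ | ⟨rfl, rfl⟩⟩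
        · exact hw1 s(a, b) ▸ h01 _ hab
        · rw [hw2 i hi]
          exact hg i
        · rw [Sym2.eq_swap, hw2 i hi]
          exact hg i
    · rcases (addPath_adj huv.ne).1 hpq with ⟨a, b, rfl, rfl, hab⟩ | ⟨i, hi, ⟨rfl, rfl⟩ | ⟨rfl, rfl⟩⟩
      · rw [hinl, hinl]
        exact hW hab
      · exact hpath i hi
      · exact (hpath i hi).symm
  have hne := hW huv
  by_cases h : wdeg G W u ≠ 0 ∧ wdeg G W v ≠ 1
  · refine key (fun i => if i % 4 = 2 ∨ i % 4 = 3 then 1 else 0) (fun i => ?_) rfl ?_ (fun i => ?_)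
      (by simpa using h.1) ?_
    · split_ifs <;> omega
    · exact if_neg (by omega)
    · split_ifs <;> omega
    · rw [if_pos (by omega)]
      exact h.2
  · refine key (fun i => if i % 4 = 1 ∨ i % 4 = 2 then 1 else 0) (fun i => ?_) rfl ?_ (fun i => ?_)
      (by simp; omega) ?_
    · split_ifs <;> omega
    · exact if_neg (by omega)
    · split_ifs <;> omega
    · rw [if_neg (by omega)]
      omega

lemma deg_eq_wdeg [Fintype V] (a : V) : deg G a = wdeg G (fun _ => 1) a := by
  simp [wdeg, deg, dg]

lemma deg_addPath_inl [Fintype V] (huv : u ≠ v) (hn : n ≠ 0) (a : V) :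
    deg (addPathGraph G u v n) (Sum.inl a) =
      deg G a + ((if a = u then 1 else 0) + if a = v then 1 else 0) := by
  rw [deg_eq_wdeg, wdeg_addPath_inl huv hn, deg_eq_wdeg]

lemma deg_addPath_pv [Fintype V] (huv : u ≠ v) {i : ℕ} (hi : i < n) :
    deg (addPathGraph G u v n) (pv u v n (i + 1)) = 2 := by
  rw [deg_eq_wdeg, wdeg_addPath_pv huv _ hi]

lemma sum_cases_pv {P : V ⊕ Fin n → Prop} (u v : V) (h1 : ∀ a, P (Sum.inl a))
    (h2 : ∀ i < n, P (pv u v n (i + 1))) : ∀ q, P q := by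
  rintro (a | t)
  · exact h1 a
  · rw [inr_eq_pv (u := u) (v := v)]
    exact h2 t t.2

/-- Adding a path to the ends of an edge yields a bridgeless graph, if no other edge is a bridge. -/
lemma bc_addPath [Fintype V] (huv : G.Adj u v) (hn : n ≠ 0) (hG : ConnOn G univ)
    (hG' : ∀ a b, s(a, b) ≠ s(u, v) → ConnOn (G.deleteEdges {s(a, b)}) univ) :
    BC (addPathGraph G u v n) := by
  intro p q
  refine connOn_of_hub (Sum.inl u) fun P hP => ?_
  have hP' : ∀ a b, (addPathGraph G u v n).Adj a b → s(a, b) ≠ s(p, q) → (P a ↔ P b) :=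
    fun a b hab hne => hP a (mem_univ _) b (mem_univ _) (SimpleGraph.deleteEdges_adj.2 ⟨hab, hne⟩)
  have hinl : ∀ {a b}, G.Adj a b → (addPathGraph G u v n).Adj (Sum.inl a) (Sum.inl b) :=
    fun h => (addPath_adj_inl huv.ne hn).2 h
  suffices h : (∀ a, P (Sum.inl a) ↔ P (Sum.inl u)) ∧ ∀ i < n, P (pv u v n (i + 1)) ↔ P (Sum.inl u) from
    fun a _ => sum_cases_pv (P := fun a => P a ↔ P (Sum.inl u)) u v h.1 h.2 a
  by_cases hj : ∃ j ≤ n, s(p, q) = s(pv u v n j, pv u v n (j + 1))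
  · obtain ⟨j, hj, hpq⟩ := hj
    rw [hpq] at hP'
    have h1 : ∀ a, P (Sum.inl a) ↔ P (Sum.inl u) := fun a =>
      hG.forall (P := fun a => P (Sum.inl a) ↔ P (Sum.inl u)) (fun a _ b _ hab ha =>
        (hP' _ _ (hinl hab) (map_inl_ne_path (e := s(a, b)) hn hj)).symm.trans ha) (mem_univ u)
          Iff.rfl a (mem_univ a)
    have h2 : ∀ i ≤ n, i ≠ j → (P (pv u v n i) ↔ P (pv u v n (i + 1))) := fun i hi hij =>
      hP' _ _ (addPath_adj_pv huv.ne hi) fun h => by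
        rcases Sym2.eq_iff.1 h with ⟨h1, -⟩ | ⟨h1, h2⟩
        · exact hij (pv_inj huv.ne (by omega) (by omega) h1)
        · have := pv_inj huv.ne (by omega) (by omega) h1
          have := pv_inj huv.ne (by omega) (by omega) h2
          omega
    refine ⟨h1, fun i hi => ?_⟩
    rcases le_or_gt (i + 1) j with hij | hij
    · have hc := fun i h3 => chain_iff (P := fun i => P (pv u v n i)) (lo := 0) (hi := j) (i := i)
        (fun i _ hi => h2 i (by omega) (by omega)) (Nat.zero_le _) h3
      rw [hc (i + 1) hij, ← hc 0 (by omega), pv_zero]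
    · rw [chain_iff (P := fun i => P (pv u v n i)) (lo := j + 1) (hi := n + 1)
        (fun i hi1 hi2 => h2 i (by omega) (by omega)) (by omega : j + 1 ≤ i + 1) (by omega), pv_last]
      exact h1 v
  · push Not at hj
    have h2 : ∀ i ≤ n + 1, P (pv u v n i) ↔ P (Sum.inl v) := fun i hi => by
      rw [chain_iff (P := fun i => P (pv u v n i)) (lo := 0) (hi := n + 1) (fun i _ hi =>
        hP' _ _ (addPath_adj_pv huv.ne (by omega)) (hj i (by omega)).symm) (Nat.zero_le _) hi, pv_last]
    have huv' : P (Sum.inl u) ↔ P (Sum.inl v) := by simpa using h2 0 (by omega)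
    refine ⟨fun a => ?_, fun i hi => (h2 _ (by omega)).trans huv'.symm⟩
    by_cases h : ∃ a b : V, s(p, q) = s(Sum.inl a, Sum.inl b) ∧ s(a, b) ≠ s(u, v)
    · obtain ⟨a', b', hpq, hne⟩ := h
      refine (hG' a' b' hne).forall (P := fun a => P (Sum.inl a) ↔ P (Sum.inl u))
        (fun a _ b _ hab ha => (hP' _ _ (hinl (SimpleGraph.deleteEdges_adj.1 hab).1) ?_).symm.trans ha)
        (mem_univ u) Iff.rfl a (mem_univ a)
      rw [hpq]
      exact fun h => (SimpleGraph.deleteEdges_adj.1 hab).2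
        (Sym2.map.injective (Sum.inl_injective (β := Fin n)) (a₁ := s(a, b)) (a₂ := s(a', b')) h)
    · push Not at h
      refine hG.forall (P := fun a => P (Sum.inl a) ↔ P (Sum.inl u)) (fun a _ b _ hab ha => ?_)
        (mem_univ u) Iff.rfl a (mem_univ a)
      by_cases hne : s((Sum.inl a : V ⊕ Fin n), Sum.inl b) = s(p, q)
      · rcases Sym2.eq_iff.1 (h a b hne.symm) with ⟨rfl, rfl⟩ | ⟨rfl, rfl⟩
        · exact huv'.symm
        · exact Iff.rfl
      · exact (hP' _ _ (hinl hab) hne).symm.trans ha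

/-- Only the edge `K₂` of an odd multi-cactus may be a bridge. -/
lemma connOn_of_omc {green : Set (Sym2 V)} (h : OMC V G green) :
    ∀ [Fintype V] {u v : V}, G.Adj u v → ConnOn G univ ∧
      ∀ a b, s(a, b) ≠ s(u, v) → ConnOn (G.deleteEdges {s(a, b)}) univ := by
  induction h with
  | k2 =>
    intro inst u v huv
    have hP : ∀ H : SimpleGraph (Fin 2), H.Adj 0 1 → ConnOn H univ := fun H hH =>
      connOn_of_hub 0 fun P hP a _ => by
        have := hP 0 (mem_univ _) 1 (mem_univ _) hH
        rcases Fin.exists_fin_two.1 ⟨a, rfl⟩ with h | h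
        · rw [h]
        · rw [h, this]
    refine ⟨hP _ (by simp), fun a b hab => hP _ ?_⟩
    rw [SimpleGraph.deleteEdges_adj]
    refine ⟨by simp, ?_⟩
    have huv := huv.ne
    rw [Set.mem_singleton_iff]
    revert hab huv
    revert a b u v
    decide
  | @addPath V G green h a b hadj hgreen k ih =>
    generalize hn : 4 * k + 4 = n
    intro inst _ _ _
    have hfin : Finite V := Finite.of_injective (Sum.inl : V → V ⊕ Fin n) Sum.inl_injective
    obtain ⟨_⟩ := nonempty_fintype V
    obtain rfl : inst = instFintypeSum V (Fin n) := Subsingleton.elim _ _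
    have := ih hadj
    have := bc_addPath hadj (by omega : n ≠ 0) this.1 this.2
    exact ⟨this.connOn, fun a b _ => this a b⟩

lemma bc_of_omc_addPath {green : Set (Sym2 V)} [Fintype V] (h : OMC V G green) (huv : G.Adj u v)
    (hn : n ≠ 0) : BC (addPathGraph G u v n) :=
  bc_addPath huv hn (connOn_of_omc h huv).1 (connOn_of_omc h huv).2

/-- The green edges of an odd multi-cactus form a perfect matching. -/
lemma matching_of_omc {green : Set (Sym2 V)} (h : OMC V G green) :
    ∀ v, ∃ w, s(v, w) ∈ green ∧ ∀ w', s(v, w') ∈ green → w' = w := by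
  induction h with
  | k2 =>
    intro v
    simp only [SimpleGraph.mem_edgeSet, SimpleGraph.top_adj]
    revert v
    decide
  | @addPath V G green h u v hadj hgreen k ih =>
    generalize hn : 4 * k + 4 = n
    have huv := hadj.ne
    have hgr : ∀ i ≤ n, Odd i → s(pv u v n i, pv u v n (i + 1)) ∈ greenPathEdges u v n :=
      fun i hi hodd => ⟨⟨i, by omega⟩, hodd, by simp [pathVert_eq_pv]⟩
    have hgr' : ∀ e ∈ greenPathEdges u v n,
        ∃ i < n, Odd i ∧ e = s(pv u v n i, pv u v n (i + 1)) := by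
      rintro e ⟨i, hodd, rfl⟩
      have hi := i.2
      obtain ⟨j, hj⟩ := hodd
      exact ⟨i, by omega, ⟨j, hj⟩, by simp [pathVert_eq_pv]⟩
    refine sum_cases_pv u v (fun a => ?_) fun i hi => ?_
    · obtain ⟨w, hw, huniq⟩ := ih a
      refine ⟨Sum.inl w, Or.inl ⟨_, hw, rfl⟩, ?_⟩
      rintro w' (⟨e, he, h⟩ | h)
      · induction e with
        | _ x y =>
          rcases Sym2.eq_iff.1 h with ⟨h1, rfl⟩ | ⟨rfl, h1⟩
          · cases h1
            rw [huniq y he]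
          · cases h1
            rw [huniq x (by rwa [Sym2.eq_swap])]
      · obtain ⟨i, hi, hodd, h⟩ := hgr' _ h
        obtain ⟨j, rfl⟩ := hodd
        rcases Sym2.eq_iff.1 h with ⟨h1, -⟩ | ⟨h1, -⟩
        · rw [pv_succ (by omega)] at h1
          cases h1
        · rw [pv_succ (by omega)] at h1
          cases h1
    · have hnot : ∀ w' e, e ∈ green → Sym2.map Sum.inl e ≠ s(pv u v n (i + 1), w') := by
        intro w' e _ h
        induction e with
        | _ x y =>
          rw [pv_succ hi] at h
          rcases Sym2.eq_iff.1 h with ⟨h1, -⟩ | ⟨-, h1⟩ <;> cases h1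
      have huniq : ∀ w', s(pv u v n (i + 1), w') ∈ greenPathEdges u v n →
          (Odd (i + 1) ∧ w' = pv u v n (i + 2)) ∨ (Odd i ∧ w' = pv u v n i) := by
        intro w' h
        obtain ⟨j, hj, hodd, h⟩ := hgr' _ h
        rcases Sym2.eq_iff.1 h with ⟨h1, rfl⟩ | ⟨h1, rfl⟩
        · have := pv_inj huv (by omega) (by omega) h1
          subst this
          exact Or.inl ⟨hodd, rfl⟩
        · have := pv_inj huv (by omega) (by omega) h1
          simp only [Nat.add_right_cancel_iff] at this
          subst this
          exact Or.inr ⟨hodd, rfl⟩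
      by_cases hodd : Odd i
      · refine ⟨pv u v n i, Or.inr (Sym2.eq_swap ▸ hgr i (by omega) hodd), ?_⟩
        rintro w' (⟨e, he, h⟩ | h)
        · exact absurd h (hnot w' e he)
        · rcases huniq w' h with h | h
          · exact absurd h.1 (by rw [Nat.odd_add_one]; simpa using hodd)
          · exact h.2
      · refine ⟨pv u v n (i + 2), Or.inr (hgr (i + 1) (by omega) (by rwa [Nat.odd_add_one])), ?_⟩
        rintro w' (⟨e, he, h⟩ | h)
        · exact absurd h (hnot w' e he)
        · rcases huniq w' h with h | h
          · exact h.2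
          · exact absurd h.1 hodd

end Ear

section Cycle

variable {V : Type} {G : SimpleGraph V}

lemma exists_other_nb [Fintype V] {x u : V} (h : deg G x = 2) (hxu : G.Adj x u) :
    ∃ p, p ≠ u ∧ G.Adj x p ∧ ∀ t, G.Adj x t → t = u ∨ t = p := by
  have : #((nb G x).erase u) = 1 := by rw [card_erase_of_mem (by simpa), card_nb, h]
  obtain ⟨p, hp⟩ := card_eq_one.1 this
  have hp' : p ∈ (nb G x).erase u := by simp [hp]
  simp only [mem_erase, mem_nb] at hp'
  exact ⟨p, hp'.1, hp'.2, fun t ht => eq_of_deg_two h hp'.1.symm hxu hp'.2 ht⟩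

lemma exists_addPath_iso {W : Type} {H : SimpleGraph W} (e : G ≃g H) {u v : V} {u' v' : W} {n : ℕ}
    (huv : u ≠ v) (hn : n ≠ 0) (hu : e u = u') (hv : e v = v') :
    ∃ f : addPathGraph G u v n ≃g addPathGraph H u' v' n,
      (∀ a, f (Sum.inl a) = Sum.inl (e a)) ∧ ∀ t, f (Sum.inr t) = Sum.inr t := by
  subst hu hv
  exact ⟨addPathIso e u v n huv hn, fun _ => rfl, fun _ => rfl⟩

/-- In a cycle, the vertices off an edge form a thread. -/
lemma exists_twoExit_of_cycle [Fintype V] (hbl : BL G) (h2 : ∀ v, deg G v = 2) {x u : V}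
    (hxu : G.Adj x u) : ∃ p q, TwoExit G {x, u}ᶜ p x q u := by
  obtain ⟨p, hpu, hxp, hp⟩ := exists_other_nb (h2 x) hxu
  obtain ⟨q, hqx, huq, hq⟩ := exists_other_nb (h2 u) hxu.symm
  have hpC : p ∈ ({x, u}ᶜ : Finset V) := by simp [hpu, hxp.ne']
  have hqC : q ∈ ({x, u}ᶜ : Finset V) := by simp [hqx, huq.ne']
  have hex : ∀ v ∈ ({x, u}ᶜ : Finset V), ∀ z, z ∉ ({x, u}ᶜ : Finset V) → G.Adj v z →
      v = p ∧ z = x ∨ v = q ∧ z = u := by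
    intro v hv z hz hvz
    simp only [mem_compl, mem_insert, mem_singleton, not_or, not_and_or, not_not] at hv hz
    rcases hz with rfl | rfl
    · exact Or.inl ⟨(hp v hvz.symm).resolve_left hv.2, rfl⟩
    · exact Or.inr ⟨(hq v hvz.symm).resolve_left hv.1, rfl⟩
  refine ⟨p, q, hpC, hqC, by simp, by simp, hxu.ne, hxp.symm, huq.symm, hex, ?_⟩
  have key : ∀ X ⊆ ({x, u}ᶜ : Finset V), X.Nonempty →
      (∀ a ∈ X, ∀ b ∈ ({x, u}ᶜ : Finset V), G.Adj a b → b ∈ X) → p ∈ X := by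
    intro X hX hne hcl
    by_contra hpX
    obtain ⟨a, ha⟩ := hne
    have h1 := ebd_pos hbl ha (fun h : x ∈ X => by simpa using hX h)
    have h3 : ebd G X ≤ 1 := ebd_le_one (p := q) (x := u) fun v hv z hz hvz => by
      by_cases hzC : z ∈ ({x, u}ᶜ : Finset V)
      · exact absurd (hcl v hv z hzC hvz) hz
      · refine (hex v (hX hv) z hzC hvz).resolve_left ?_
        rintro ⟨rfl, -⟩
        exact hpX hv
    omega
  intro X hX hne hcl
  by_contra hXC
  have h1 := key X hX hne hcl
  have h3 := key ({x, u}ᶜ \ X) sdiff_subset (by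
      rw [sdiff_nonempty]
      exact fun h => hXC (hX.antisymm h)) fun a ha b hb hab => by
    simp only [mem_sdiff] at ha ⊢
    exact ⟨hb, fun h => ha.2 (hcl b h a ha.1 hab.symm)⟩
  exact (mem_sdiff.1 h3).2 h1

/-- A cycle arises from any of its edges by adding a path. -/
lemma exists_cycle_iso [Fintype V] (hbc : BC G) (h2 : ∀ v, deg G v = 2) {x u : V}
    (hxu : G.Adj x u) {n : ℕ} (hn : Fintype.card V = n + 2) :
    ∃ e : G ≃g addPathGraph (⊤ : SimpleGraph (Fin 2)) 0 1 n, e x = Sum.inl 0 ∧ e u = Sum.inl 1 := by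
  obtain ⟨p, q, h⟩ := exists_twoExit_of_cycle (bl_iff_bc.2 hbc) h2 hxu
  obtain ⟨e, hx, hu⟩ := h.exists_iso fun v _ => h2 v
  have hC : #({x, u}ᶜ : Finset V) = n := by
    rw [card_compl, card_pair hxu.ne, hn]; omega
  have hn0 : n ≠ 0 := by
    rw [← hC]; exact (card_pos.2 ⟨p, h.hp⟩).ne'
  generalize h.hx = hx' at *
  generalize h.hu = hu' at *
  clear h
  have hmem : ∀ v : {v | v ∉ ({x, u}ᶜ : Finset V)}, v = ⟨x, hx'⟩ ∨ v = ⟨u, hu'⟩ := by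
    rintro ⟨v, hv⟩
    simpa [or_iff_not_imp_left] using hv
  have hne : (⟨x, hx'⟩ : {v | v ∉ ({x, u}ᶜ : Finset V)}) ≠ ⟨u, hu'⟩ := by
    simpa using hxu.ne
  subst hC
  let e₀ : G.induce {v | v ∉ ({x, u}ᶜ : Finset V)} ≃g (⊤ : SimpleGraph (Fin 2)) :=
    { toFun := fun v => if v = ⟨x, hx'⟩ then 0 else 1
      invFun := fun i => if i = 0 then ⟨x, hx'⟩ else ⟨u, hu'⟩
      left_inv := fun v => by
        rcases hmem v with rfl | rfl <;> simp [hne.symm]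
      right_inv := fun i => by
        rcases Fin.exists_fin_two.1 ⟨i, rfl⟩ with rfl | rfl <;> simp [hne.symm]
      map_rel_iff' := fun {v w} => by
        rcases hmem v with rfl | rfl <;> rcases hmem w with rfl | rfl <;>
          simp [hne.symm, hxu, hxu.symm] }
  obtain ⟨f, hf, -⟩ := exists_addPath_iso (n := #({x, u}ᶜ : Finset V)) e₀ hne hn0
    (show e₀ ⟨x, hx'⟩ = 0 by simp [e₀]) (show e₀ ⟨u, hu'⟩ = 1 by simp [e₀, hne.symm])
  refine ⟨e.trans f, ?_, ?_⟩
  · simp [hx, hf, e₀]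
  · simp [hu, hf, e₀, hne.symm]

end Cycle

section RedEar

variable {V : Type} {G H : SimpleGraph V} {a b : V} {m n i : ℕ}

lemma exists_bip (h : G.Colorable 2) : ∃ c, Bip G c := by
  obtain ⟨f⟩ := h
  refine ⟨fun v => if f v = 0 then 0 else 1, fun u v huv => ?_⟩
  have h1 := f.valid huv
  rcases Fin.exists_fin_two.1 ⟨f u, rfl⟩ with h2 | h2 <;>
    rcases Fin.exists_fin_two.1 ⟨f v, rfl⟩ with h3 | h3 <;> rw [h2, h3] at h1 <;>
    simp_all
  decide

/-- Adding a second ear along an internal red edge of an ear of even order. -/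
lemma good_addPath_pv [Fintype V] (hH : BC H) (hab : H.Adj a b) (hi2 : 2 ≤ i) (hi : Even i)
    (him : i ≤ m) (hn : n ≠ 0)
    (hcol : (addPathGraph (addPathGraph H a b m) (pv a b m i) (pv a b m (i + 1)) n).Colorable 2) :
    Good (addPathGraph (addPathGraph H a b m) (pv a b m i) (pv a b m (i + 1)) n) := by
  obtain ⟨c, hc⟩ := exists_bip hcol
  have hm : m ≠ 0 := by omega
  set D := addPathGraph H a b m with hD
  set x := pv a b m i with hx
  set u := pv a b m (i + 1) with hu
  set K := addPathGraph D x u n with hK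
  have hinj : ∀ {j k}, j ≤ m + 1 → k ≤ m + 1 → pv a b m j = pv a b m k → j = k :=
    fun hj hk h => pv_inj hab.ne hj hk h
  have hxu : x ≠ u := fun h => by
    have := hinj (by omega) (by omega) h
    omega
  have hinl : ∀ {p q}, D.Adj p q → K.Adj (Sum.inl p) (Sum.inl q) :=
    fun h => (addPath_adj_inl hxu hn).2 h
  have hpath : ∀ {j}, j ≤ m → D.Adj (pv a b m j) (pv a b m (j + 1)) :=
    fun h => addPath_adj_pv hab.ne h
  let C : Finset ((V ⊕ Fin m) ⊕ Fin n) := (range (i - 1)).image fun j => Sum.inl (pv a b m (j + 1))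
  have hCpv : ∀ {j}, j ≤ m + 1 → (Sum.inl (pv a b m j) ∈ C ↔ 1 ≤ j ∧ j < i) := by
    intro j hj
    simp only [C, mem_image, mem_range, Sum.inl.injEq]
    constructor
    · rintro ⟨k, hk, h⟩
      have := hinj (by omega) hj h
      omega
    · exact fun h => ⟨j - 1, by omega, by rw [Nat.sub_add_cancel h.1]⟩
  have hCa : (Sum.inl (Sum.inl a) : (V ⊕ Fin m) ⊕ Fin n) ∉ C := by
    have := hCpv (j := 0) (by omega)
    simpa using this
  have hCinl : ∀ v : V, (Sum.inl (Sum.inl v) : (V ⊕ Fin m) ⊕ Fin n) ∉ C := by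
    intro v h
    simp only [C, mem_image, mem_range, Sum.inl.injEq] at h
    obtain ⟨k, hk, h⟩ := h
    rw [pv_succ (by omega)] at h
    cases h
  have hCinr : ∀ t : Fin n, (Sum.inr t : (V ⊕ Fin m) ⊕ Fin n) ∉ C := by
    intro t h
    simp [C] at h
  have hcard : #C = i - 1 := by
    rw [card_image_of_injOn, card_range]
    intro j hj k hk h
    simp only [coe_range, Set.mem_Iio, Sum.inl.injEq] at hj hk h
    have := hinj (by omega) (by omega) h
    omega
  have hBC := bc_addPath (G := H) hab hm hH.connOn fun p q _ => hH p q
  have hKBC := bc_addPath (G := D) (hpath him) hn hBC.connOn fun p q _ => hBC p q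
  have hT : TwoExit K C (Sum.inl (pv a b m 1)) (Sum.inl (pv a b m 0))
      (Sum.inl (pv a b m (i - 1))) (Sum.inl x) := by
    refine ⟨(hCpv (by omega)).2 (by omega), (hCpv (by omega)).2 (by omega),
      fun h => by have := (hCpv (by omega)).1 h; omega, fun h => by have := (hCpv (by omega)).1 h; omega,
      fun h => ?_, hinl (hpath (by omega)).symm, hinl ?_, ?_, ?_⟩
    · have := hinj (by omega) (by omega) (Sum.inl_injective h)
      omega
    · have := hpath (j := i - 1) (by omega)
      rwa [Nat.sub_add_cancel (by omega)] at this
    · intro v hv z hz hvz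
      obtain ⟨j, hj, rfl⟩ := mem_image.1 hv
      rw [mem_range] at hj
      rcases z with w | t
      · have := (addPath_adj_inl hxu hn).1 hvz
        rcases (addPath_adj_pv_iff hab.ne (by omega)).1 this with rfl | rfl
        · rw [hCpv (by omega)] at hz
          obtain rfl : j = 0 := by omega
          exact Or.inl ⟨rfl, rfl⟩
        · rw [hCpv (by omega)] at hz
          obtain rfl : j + 2 = i := by omega
          exact Or.inr ⟨rfl, rfl⟩
      · exfalso
        rcases (addPath_adj_inl_inr hxu).1 hvz with ⟨h, -⟩ | ⟨h, -⟩ <;>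
        · have := hinj (by omega) (by omega) h
          omega
    · refine connOn_of_hub (Sum.inl (pv a b m (i - 1))) fun P hP v hv => ?_
      obtain ⟨j, hj, rfl⟩ := mem_image.1 hv
      rw [mem_range] at hj
      refine chain_iff (P := fun j => P (Sum.inl (pv a b m j))) (lo := 1) (fun k hk hk' => ?_)
        (by omega) (by omega)
      exact hP _ ((hCpv (by omega)).2 (by omega)) _ ((hCpv (by omega)).2 (by omega))
        (hinl (hpath (by omega)))
  refine good_of_odd_thread hc hKBC.connOn hT (fun v hv => ?_) ?_ (y' := Sum.inl (Sum.inl b))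
    (z' := Sum.inl u) (hCinl b) (fun h => ?_) ?_ (hinl (hpath him)) ?_
  · obtain ⟨j, hj, rfl⟩ := mem_image.1 hv
    rw [mem_range] at hj
    rw [deg_addPath_inl hxu hn, deg_addPath_pv hab.ne (by omega), if_neg, if_neg]
    · intro h
      have := hinj (by omega) (by omega) h
      omega
    · intro h
      have := hinj (by omega) (by omega) h
      omega
  · rw [hcard]
    obtain ⟨k, rfl⟩ := hi
    exact ⟨k - 1, by omega⟩
  · have := (hCpv (by omega)).1 h
    omega
  · rw [pv_zero]
    exact hinl ((addPath_adj_inl hab.ne hm).2 hab)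
  · refine connOn_of_hub (Sum.inl (Sum.inl a)) fun P hP => ?_
    have hP' : ∀ p q, p ∉ C → q ∉ C → K.Adj p q → s(p, q) ≠ s(Sum.inl (pv a b m 0), Sum.inl (Sum.inl b)) →
        s(p, q) ≠ s(Sum.inl x, Sum.inl u) → (P p ↔ P q) := fun p q hp hq hpq h1 h2 =>
      hP p (by simpa) q (by simpa) (by
        rw [SimpleGraph.deleteEdges_adj]
        exact ⟨hpq, by simp only [Set.mem_insert_iff, Set.mem_singleton_iff, not_or]; exact ⟨h1, h2⟩⟩)
    have h1 : ∀ v, P (Sum.inl (Sum.inl v)) ↔ P (Sum.inl (Sum.inl a)) := by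
      refine fun v => (hH a b).forall (P := fun v => P (Sum.inl (Sum.inl v)) ↔ P (Sum.inl (Sum.inl a)))
        (fun p _ q _ hpq hp => ?_) (mem_univ a) Iff.rfl v (mem_univ v)
      rw [SimpleGraph.deleteEdges_adj] at hpq
      refine (hP' _ _ (hCinl p) (hCinl q) (hinl ((addPath_adj_inl hab.ne hm).2 hpq.1)) ?_ ?_).symm.trans hp
      · intro h
        refine hpq.2 ?_
        rw [pv_zero] at h
        simpa using h
      · have := map_inl_ne_path (u := a) (v := b) hm him (e := s(p, q))
        intro h
        refine this ?_
        exact Sym2.map.injective (Sum.inl_injective (β := Fin n)) h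
    have h2 : ∀ j, i + 1 ≤ j → j ≤ m + 1 → (P (Sum.inl (pv a b m j)) ↔ P (Sum.inl (Sum.inl a))) := by
      intro j hj hj'
      rw [← h1 b, ← pv_last (u := a) (v := b) (n := m)]
      refine chain_iff (P := fun j => P (Sum.inl (pv a b m j))) (lo := i + 1) (fun k hk hk' => ?_) hj hj'
      refine hP' _ _ (fun h => ?_) (fun h => ?_) (hinl (hpath (by omega))) (fun h => ?_) (fun h => ?_)
      · have := (hCpv (by omega)).1 h
        omega
      · have := (hCpv (by omega)).1 h
        omega
      · rw [pv_zero] at h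
        exact map_inl_ne_path (u := a) (v := b) hm (i := k) (by omega) (e := s(a, b))
          (Sym2.map.injective (Sum.inl_injective (β := Fin n)) h.symm)
      · rcases Sym2.eq_iff.1 h with ⟨h, -⟩ | ⟨h, h'⟩
        · have := hinj (by omega) (by omega) (Sum.inl_injective h)
          omega
        · have := hinj (by omega) (by omega) (Sum.inl_injective h)
          have := hinj (by omega) (by omega) (Sum.inl_injective h')
          omega
    have h3 : ∀ j ≤ n + 1, (P (pv x u n j) ↔ P (Sum.inl (Sum.inl a))) := by
      have hnC : ∀ j, pv x u n j ∉ C := by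
        intro j
        unfold pv
        split_ifs
        · intro h
          have := (hCpv (by omega)).1 h
          omega
        · exact hCinr _
        · intro h
          have := (hCpv (by omega)).1 h
          omega
      intro j hj
      rw [← h2 (i + 1) le_rfl (by omega), ← hu, ← pv_last (u := x) (v := u) (n := n)]
      refine chain_iff (P := fun j => P (pv x u n j)) (lo := 0) (fun k hk hk' => ?_) (by omega) hj
      refine hP' _ _ (hnC _) (hnC _) (addPath_adj_pv hxu (by omega)) (fun h => ?_) (fun h => ?_)
      · exact map_inl_ne_path (u := x) (v := u) hn (i := k) (by omega) (e := s(pv a b m 0, Sum.inl b)) h.symm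
      · exact map_inl_ne_path (u := x) (v := u) hn (i := k) (by omega) (e := s(x, u)) h.symm
    refine sum_cases_pv x u (sum_cases_pv a b (fun v _ => h1 v) fun j hj hj' => ?_) fun j hj _ => h3 _ (by omega)
    replace hj' : Sum.inl (pv a b m (j + 1)) ∉ C := by simpa using hj'
    rw [hCpv (by omega)] at hj'
    by_cases hji : j + 1 = i
    · rw [hji]
      simpa using h3 0 (by omega)
    · exact h2 _ (by omega) (by omega)

lemma addPathSwap_pv (hab : a ≠ b) (hm : m ≠ 0) (hi : i ≤ m + 1) :
    addPathSwap H a b m hab hm (pv a b m i) = pv b a m (m + 1 - i) := by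
  unfold pv
  split_ifs <;> first | omega | simp [addPathSwap, Fin.ext_iff] <;> omega

lemma good_addPath_swap [Fintype V] (hab : a ≠ b) (hm : m ≠ 0) :
    Good (addPathGraph H a b m) ↔ Good (addPathGraph H b a m) :=
  good_congr (addPathSwap H a b m hab hm)

/-- Adding a second ear along any red edge of an ear of even order. -/
lemma good_addPath_red [Fintype V] (hH : BC H) (hab : H.Adj a b) (hm : m ≠ 0) (hmev : Even m)
    (hi : Even i) (him : i ≤ m) (hn : n ≠ 0)
    (hcol : (addPathGraph (addPathGraph H a b m) (pv a b m i) (pv a b m (i + 1)) n).Colorable 2) :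
    Good (addPathGraph (addPathGraph H a b m) (pv a b m i) (pv a b m (i + 1)) n) := by
  by_cases hi2 : 2 ≤ i
  · exact good_addPath_pv hH hab hi2 hi him hn hcol
  obtain rfl : i = 0 := by
    obtain ⟨k, rfl⟩ := hi
    omega
  have hne : pv a b m 0 ≠ pv a b m (0 + 1) := fun h => by
    have := pv_inj hab.ne (by omega) (by omega) h
    omega
  have hne' : pv b a m m ≠ pv b a m (m + 1) := fun h => by
    have := pv_inj hab.ne.symm (by omega) (by omega) h
    omega
  have h2 : 2 ≤ m := by
    obtain ⟨k, rfl⟩ := hmev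
    omega
  obtain ⟨f, -⟩ := exists_addPath_iso (n := n) (addPathSwap H a b m hab.ne hm) hne hn
    (addPathSwap_pv hab.ne hm (by omega)) (addPathSwap_pv hab.ne hm (by omega))
  have g := f.trans (addPathSwap _ _ _ n hne'.symm hn)
  exact Good.of_iso g (good_addPath_pv hH hab.symm h2 hmev le_rfl hn (hcol.of_hom (SimpleGraph.Iso.toHom g.symm)))

end RedEar

section RedEar

variable {V : Type} {G H : SimpleGraph V} {n : ℕ}

/-- The cycle with `n + 2` vertices. -/
abbrev cyc (n : ℕ) : SimpleGraph (Fin 2 ⊕ Fin n) := addPathGraph ⊤ 0 1 n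

lemma zero_ne_one_fin : (0 : Fin 2) ≠ 1 := by decide

lemma bc_cyc (hn : n ≠ 0) : BC (cyc n) :=
  bc_of_omc_addPath OMC.k2 (by simp) hn

lemma deg_cyc (hn : n ≠ 0) : ∀ v, deg (cyc n) v = 2 := by
  refine sum_cases_pv (0 : Fin 2) 1 (fun a => ?_) fun i hi => deg_addPath_pv zero_ne_one_fin hi
  rw [deg_addPath_inl zero_ne_one_fin hn]
  have : deg (⊤ : SimpleGraph (Fin 2)) a = 1 := by
    rw [← card_nb, card_eq_one]
    refine ⟨a + 1, ?_⟩
    ext b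
    simp only [mem_nb, SimpleGraph.top_adj, mem_singleton]
    revert a b
    decide
  rw [this]
  rcases Fin.exists_fin_two.1 ⟨a, rfl⟩ with rfl | rfl <;> simp

/-- A graph isomorphic to a cycle arises from any of its edges by adding a path. -/
lemma exists_iso_cyc_of_adj (hn : n ≠ 0) (e : G ≃g cyc n) {x u : V} (hxu : G.Adj x u) :
    ∃ e : G ≃g cyc n, e x = Sum.inl 0 ∧ e u = Sum.inl 1 := by
  obtain ⟨f, h0, h1⟩ := exists_cycle_iso (bc_cyc hn) (deg_cyc hn) (e.map_adj_iff.2 hxu) (n := n)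
    (by simp [add_comm])
  exact ⟨e.trans f, h0, h1⟩

/-- A perfect matching of an even cycle alternates. -/
lemma matching_cyc (hn : n ≠ 0) {M : Set (Sym2 (Fin 2 ⊕ Fin n))}
    (hM : ∀ v, ∃ w, s(v, w) ∈ M ∧ ∀ w', s(v, w') ∈ M → w' = w)
    (hsub : ∀ v w, s(v, w) ∈ M → (cyc n).Adj v w) (h01 : s(Sum.inl 0, Sum.inl 1) ∈ M) {i : ℕ}
    (hi : i ≤ n) : s(pv 0 1 n i, pv 0 1 n (i + 1)) ∈ M ↔ Odd i := by
  induction i with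
  | zero =>
    simp only [pv_zero, Nat.not_odd_zero, iff_false]
    intro h
    obtain ⟨w, -, hw⟩ := hM (Sum.inl 0)
    have := (hw _ h).trans (hw _ h01).symm
    rw [pv_succ (by omega)] at this
    cases this
  | succ i ih =>
    rw [Nat.odd_add_one, ← ih (by omega)]
    obtain ⟨w, hw, huniq⟩ := hM (pv 0 1 n (i + 1))
    rw [Sym2.eq_swap (a := pv 0 1 n i)]
    constructor
    · intro h h'
      have := pv_inj zero_ne_one_fin (by omega) (by omega) ((huniq _ h).trans (huniq _ h').symm)
      omega
    · intro h
      rcases (addPath_adj_pv_iff zero_ne_one_fin (by omega)).1 (hsub _ _ hw) with rfl | rfl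
      · exact absurd hw h
      · exact hw

lemma adj_of_mem_green {green : Set (Sym2 V)} (h : OMC V G green) :
    ∀ {v w}, s(v, w) ∈ green → G.Adj v w := by
  induction h with
  | k2 => exact id
  | @addPath V G green h u v hadj hgreen k ih =>
    generalize hn : 4 * k + 4 = n
    intro p q hpq
    rw [addPath_adj hadj.ne]
    rcases hpq with ⟨e, he, h⟩ | ⟨i, -, h⟩
    · induction e with
      | _ a b =>
        left
        rcases Sym2.eq_iff.1 h with ⟨rfl, rfl⟩ | ⟨rfl, rfl⟩
        · exact ⟨a, b, rfl, rfl, ih he⟩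
        · exact ⟨b, a, rfl, rfl, (ih he).symm⟩
    · right
      refine ⟨i, by omega, ?_⟩
      simpa [pathVert_eq_pv, Sym2.eq_iff] using h

lemma addPath_colorable {u v : V} (huv : u ≠ v) (hn : n ≠ 0)
    (h : (addPathGraph G u v n).Colorable 2) : G.Colorable 2 :=
  h.of_hom ⟨Sum.inl, fun hab => (addPath_adj_inl huv hn).2 hab⟩

/-- Adding an ear of order divisible by four along a red edge of an odd multi-cactus gives a good
graph, unless the multi-cactus is a cycle. -/
lemma good_addPath_of_omc {green : Set (Sym2 V)} (h : OMC V G green) :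
    ∀ [Fintype V] {x u : V} {l : ℕ}, G.Adj x u → s(x, u) ∉ green →
      (addPathGraph G x u (4 * l + 4)).Colorable 2 →
      Good (addPathGraph G x u (4 * l + 4)) ∨ ∃ j, Nonempty (G ≃g cyc (4 * j + 4)) := by
  induction h with
  | k2 => exact fun h h' => absurd h h'
  | @addPath V G green h a b hadj hgreen k ih =>
    generalize hm : 4 * k + 4 = m
    intro inst x u l hxu hred hcol
    have hfin : Finite V := Finite.of_injective (Sum.inl : V → V ⊕ Fin m) Sum.inl_injective
    obtain ⟨_⟩ := nonempty_fintype V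
    obtain rfl : inst = instFintypeSum V (Fin m) := Subsingleton.elim _ _
    have hm0 : m ≠ 0 := by omega
    generalize hn : 4 * l + 4 = n at hcol ⊢
    have hn0 : n ≠ 0 := by omega
    have hpath : ∀ {x u i}, i ≤ m → x = pv a b m i → u = pv a b m (i + 1) →
        s(x, u) ∉ Sym2.map Sum.inl '' green ∪ greenPathEdges a b m →
        (addPathGraph (addPathGraph G a b m) x u n).Colorable 2 →
        Good (addPathGraph (addPathGraph G a b m) x u n) ∨
          ∃ j, Nonempty (addPathGraph G a b m ≃g cyc (4 * j + 4)) := by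
      rintro _ _ i hi rfl rfl hred hcol
      have hev : Even i := by
        rw [← Nat.not_odd_iff_even]
        exact fun hodd => hred (Or.inr ⟨⟨i, by omega⟩, hodd, by simp [pathVert_eq_pv]⟩)
      have hmev : Even m := ⟨2 * k + 2, by omega⟩
      cases h with
      | k2 =>
        right
        refine ⟨k, ?_⟩
        rw [hm]
        rcases Fin.exists_fin_two.1 ⟨a, rfl⟩ with rfl | rfl <;>
          rcases Fin.exists_fin_two.1 ⟨b, rfl⟩ with rfl | rfl
        · exact absurd rfl hadj.ne
        · exact ⟨SimpleGraph.Iso.refl⟩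
        · exact ⟨addPathSwap _ _ _ _ hadj.ne hm0⟩
        · exact absurd rfl hadj.ne
      | @addPath V G green h a' b' hadj' hgreen' k' =>
        left
        have hfin : Finite V := Finite.of_injective (Sum.inl : V → V ⊕ Fin (4 * k' + 4)) Sum.inl_injective
        obtain ⟨_⟩ := nonempty_fintype V
        refine good_addPath_red ?_ hadj hm0 hmev hev hi hn0 hcol
        convert bc_of_omc_addPath h hadj' (by omega : 4 * k' + 4 ≠ 0)
    have hne := hxu.ne
    rcases (addPath_adj hadj.ne).1 hxu with ⟨x', u', rfl, rfl, hxu'⟩ | ⟨i, hi, ⟨hx, hu⟩ | ⟨hx, hu⟩⟩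
    · left
      have e := addPathComm G a b x' u' m n hadj.ne hxu'.ne hm0 hn0
      have hcol' := hcol.of_hom (SimpleGraph.Iso.toHom e.symm)
      have hred' : s(x', u') ∉ green := fun h => hred (Or.inl ⟨_, h, rfl⟩)
      rcases ih hxu' hred' (l := l) (hn ▸ addPath_colorable (by simpa using hadj.ne) hm0 hcol') with
        hG | ⟨j, ⟨e₀⟩⟩
      · rw [hn] at hG
        exact Good.of_iso e (good_addPath ((addPath_adj_inl hxu'.ne hn0).2 hadj) hm.symm hG)
      · generalize hN : 4 * j + 4 = N at e₀
        have hN0 : N ≠ 0 := by omega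
        obtain ⟨f, ha, hb⟩ := exists_iso_cyc_of_adj hN0 e₀ hadj
        have hgr : ∀ {p q}, s(p, q) ∈ green ↔ s(f p, f q) ∈ {e | Sym2.map f.symm e ∈ green} := by
          intro p q
          simp
        have h01 : s(Sum.inl 0, Sum.inl 1) ∈ {e | Sym2.map f.symm e ∈ green} := by
          rwa [← ha, ← hb, ← hgr]
        have hM := @matching_cyc N hN0 {e | Sym2.map f.symm e ∈ green} (fun v => by
          obtain ⟨w, hw, huniq⟩ := matching_of_omc h (f.symm v)
          refine ⟨f w, by simpa using hw, fun w' hw' => ?_⟩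
          rw [← huniq (f.symm w') (by simpa using hw'), RelIso.apply_symm_apply]) (fun v w hvw =>
            f.symm.map_adj_iff.1 (adj_of_mem_green h (by simpa using hvw))) h01
        have hear : ∀ {x' u' i}, i ≤ N → f x' = pv 0 1 N i → f u' = pv 0 1 N (i + 1) →
            s(x', u') ∉ green → x' ≠ u' →
            (addPathGraph (addPathGraph G a b m) (Sum.inl x') (Sum.inl u') n).Colorable 2 →
            Good (addPathGraph (addPathGraph G a b m) (Sum.inl x') (Sum.inl u') n) := by
          intro x' u' i hi hx hu hred hne hcol
          have hev : Even i := by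
            rw [← Nat.not_odd_iff_even, ← hM hi, ← hx, ← hu, ← hgr]
            exact hred
          obtain ⟨g, hg, -⟩ := exists_addPath_iso (n := m) f hadj.ne hm0 ha hb
          have hg' : ∀ j, addPathComm ⊤ 0 1 0 1 N m zero_ne_one_fin zero_ne_one_fin hN0 hm0
              (Sum.inl (pv 0 1 N j)) = pv (Sum.inl 0) (Sum.inl 1) N j := by
            intro j
            unfold pv
            split_ifs <;> rfl
          obtain ⟨g', -⟩ := exists_addPath_iso (n := n)
            (g.trans (addPathComm ⊤ 0 1 0 1 N m zero_ne_one_fin zero_ne_one_fin hN0 hm0))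
            (u := Sum.inl x') (v := Sum.inl u') (u' := pv (Sum.inl 0) (Sum.inl 1) N i)
            (v' := pv (Sum.inl 0) (Sum.inl 1) N (i + 1)) (by simpa using hne) hn0
            (by rw [RelIso.trans_apply, hg, hx, hg']) (by rw [RelIso.trans_apply, hg, hu, hg'])
          exact Good.of_iso g' (good_addPath_red (bc_cyc hm0)
            ((addPath_adj_inl zero_ne_one_fin hm0).2 (by simp)) hN0 ⟨2 * j + 2, by omega⟩ hev hi hn0
            (hcol.of_hom (SimpleGraph.Iso.toHom g'.symm)))
        rcases (addPath_adj zero_ne_one_fin).1 (f.map_adj_iff.2 hxu') with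
          ⟨p, q, hp, hq, hpq⟩ | ⟨i, hi, ⟨hx, hu⟩ | ⟨hx, hu⟩⟩
        · refine absurd (hgr.2 ?_) hred'
          rw [hp, hq]
          rcases Fin.exists_fin_two.1 ⟨p, rfl⟩ with rfl | rfl <;>
            rcases Fin.exists_fin_two.1 ⟨q, rfl⟩ with rfl | rfl
          · exact absurd rfl hpq.ne
          · exact h01
          · rwa [Sym2.eq_swap]
          · exact absurd rfl hpq.ne
        · exact hear hi hx hu hred' hxu'.ne hcol
        · rw [good_addPath_swap hne hn0]
          rw [Sym2.eq_swap] at hred'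
          exact hear hi hu hx hred' hxu'.ne'
            (hcol.of_hom (SimpleGraph.Iso.toHom (addPathSwap _ _ _ n hne.symm hn0)))
    · exact hpath hi hx hu hred hcol
    · rw [good_addPath_swap hne hn0]
      rw [Sym2.eq_swap] at hred
      exact hpath hi hu hx hred (hcol.of_hom (SimpleGraph.Iso.toHom (addPathSwap _ _ _ n hne.symm hn0)))

end RedEar

section Main

variable {V W : Type} {G : SimpleGraph V} {H : SimpleGraph W} {c : V → ZMod 2}

lemma multiCactus_of_iso (e : G ≃g H) (h : IsSimpleOddMultiCactus H) : IsSimpleOddMultiCactus G := by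
  obtain ⟨U, K, green, hK, ⟨f⟩⟩ := h
  exact ⟨U, K, green, hK, ⟨e.trans f⟩⟩

lemma bip_colorable (hc : Bip G c) : G.Colorable 2 :=
  ⟨⟨fun v => (c v : Fin 2), fun {u v} huv h => by
    rw [hc huv] at h
    have : ∀ z : ZMod 2, (z : Fin 2) ≠ (z + 1 : ZMod 2) := by decide
    exact this _ h⟩⟩

lemma good_of_subsingleton [Fintype V] (h : Subsingleton V) : Good G :=
  ⟨0, fun u v huv => absurd (h.elim u v) huv.ne⟩

/-- A bad even cycle is an odd multi-cactus. -/
lemma multiCactus_of_deg_le_two [Fintype V] (hc : Bip G c) (hbl : BL G) (hbad : ¬ Good G)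
    (h2 : ∀ v, deg G v ≤ 2) : IsSimpleOddMultiCactus G := by
  have hnt : Nontrivial V := by
    rw [← not_subsingleton_iff_nontrivial]
    exact fun h => hbad (good_of_subsingleton h)
  have hdeg : ∀ v, deg G v = 2 := fun v => by
    obtain ⟨z, hz⟩ := exists_ne v
    exact le_antisymm (h2 v) (hbl.two_le_deg hz)
  obtain ⟨x, -⟩ := exists_pair_ne V
  obtain ⟨u, hxu⟩ : ∃ u, G.Adj x u := by
    have : 0 < #(nb G x) := by rw [card_nb, hdeg]; omega
    obtain ⟨u, hu⟩ := card_pos.1 this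
    exact ⟨u, mem_nb.1 hu⟩
  obtain ⟨p, q, h⟩ := exists_twoExit_of_cycle hbl hdeg hxu
  have hxu1 := hc hxu
  have hbal := Thread.balanced hc ⟨⟨p, q, h⟩, fun v _ => hdeg v⟩ (fun h => by simp [h] at hxu1)
  have hsum := sum_eq_one_of_bad hc hbl.connOn hbad 0
  simp only [add_zero] at hsum
  rw [← sum_add_sum_compl {x, u}, sum_pair hxu.ne, hxu1, ← add_assoc, zmod2_add_self, zero_add,
    add_eq_left, sum_c_eq_card, ZMod.natCast_eq_zero_iff] at hsum
  obtain ⟨k, hk⟩ := hsum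
  have hpos := card_pos.2 ⟨p, h.hp⟩
  have hcard : #({x, u}ᶜ : Finset V) = 4 * (k - 1) + 4 := by omega
  have h3 := card_compl_add_card ({x, u} : Finset V)
  rw [card_pair hxu.ne, hcard] at h3
  obtain ⟨e, -⟩ := exists_cycle_iso (bl_iff_bc.1 hbl) hdeg hxu h3.symm
  exact ⟨_, _, _, OMC.addPath OMC.k2 0 1 (by simp) (by simp) (k - 1), ⟨e⟩⟩

/-- Deleting an ear between adjacent vertices leaves a bridgeless graph. -/
lemma bc_induce_of_ear [Fintype V] (hbc : BC G) {x u p q : V} {C : Finset V} (hxu : G.Adj x u)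
    (hx : NonCut G x) (hdx : 3 ≤ deg G x) (h : TwoExit G C p x q u) :
    BC (G.induce {v | v ∉ C}) := by
  intro a b
  refine connOn_of_hub ⟨x, h.hx⟩ fun P hP v _ => ?_
  have hP' : ∀ v w (hv : v ∉ C) (hw : w ∉ C), G.Adj v w → s(v, w) ≠ s(a.1, b.1) →
      (P ⟨v, hv⟩ ↔ P ⟨w, hw⟩) := fun v w hv hw hvw hne =>
    hP _ (mem_univ _) _ (mem_univ _) (by
      rw [SimpleGraph.deleteEdges_adj]
      refine ⟨hvw, fun h => hne ?_⟩
      have := congrArg (Sym2.map Subtype.val) (Set.mem_singleton_iff.1 h)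
      simpa using this)
  have hPxu : P ⟨x, h.hx⟩ ↔ P ⟨u, h.hu⟩ := by
    by_cases hab : s(x, u) = s(a.1, b.1)
    · obtain ⟨y, hy⟩ : ∃ y, y ∈ nb G x \ {u, p} := by
        refine card_pos.1 ?_
        have := le_card_sdiff {u, p} (nb G x)
        have := card_le_two (a := u) (b := p)
        rw [card_nb] at *
        omega
      simp only [mem_sdiff, mem_nb, mem_insert, mem_singleton, not_or] at hy
      obtain ⟨hxy, hyu, hyp⟩ := hy
      have hyC : y ∉ C := fun hyC => by
        rcases h.exit y hyC x h.hx hxy.symm with ⟨rfl, -⟩ | ⟨-, h'⟩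
        · exact hyp rfl
        · exact h.ne h'
      rw [hP' x y h.hx hyC hxy (by
        rw [← hab]
        simp [hyu, hxu.ne])]
      let Q : V → Prop := fun v => if hv : v ∉ C then P ⟨v, hv⟩ else P ⟨u, h.hu⟩
      have hQ := ConnOn.forall (P := fun v => Q v ↔ Q u) hx (fun v hv w hw hvw hv' => by
        refine Iff.trans ?_ hv'
        simp only [mem_compl, mem_singleton] at hv hw
        simp only [Q]
        split_ifs with hwC hvC hvC
        · rfl
        · rcases h.exit w hwC v hvC hvw.symm with ⟨-, h⟩ | ⟨-, rfl⟩
          · exact absurd h hv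
          · rfl
        · rcases h.exit v hvC w hwC hvw with ⟨-, h⟩ | ⟨-, rfl⟩
          · exact absurd h hw
          · rfl
        · refine hP' w v hwC hvC hvw.symm ?_
          rw [← hab]
          intro h
          rcases Sym2.eq_iff.1 h with ⟨h, -⟩ | ⟨-, h⟩
          · exact hw h
          · exact hv h) (by simp [hxu.ne'] : u ∈ ({x}ᶜ : Finset V)) Iff.rfl y (by simp [hxy.ne'])
      simpa [Q, hyC, h.hu] using hQ
    · exact hP' x u h.hx h.hu hxu hab
  let Q : V → Prop := fun v => if hv : v ∉ C then P ⟨v, hv⟩ else P ⟨x, h.hx⟩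
  have hQ := (hbc a b).forall (P := fun v => Q v ↔ Q x) (fun v _ w _ hvw hv' => by
    refine Iff.trans ?_ hv'
    rw [SimpleGraph.deleteEdges_adj] at hvw
    simp only [Q]
    split_ifs with hwC hvC hvC
    · rfl
    · rcases h.exit w hwC v hvC hvw.1.symm with ⟨-, rfl⟩ | ⟨-, rfl⟩
      · rfl
      · exact hPxu
    · rcases h.exit v hvC w hwC hvw.1 with ⟨-, rfl⟩ | ⟨-, rfl⟩
      · rfl
      · exact hPxu.symm
    · refine (hP' v w hvC hwC hvw.1 fun h => hvw.2 ?_).symm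
      exact h) (mem_univ x) Iff.rfl v (mem_univ _)
  have hvC : v.1 ∉ C := v.2
  simpa [Q, hvC, h.hx] using hQ

/-- Adding an ear of order divisible by four along an edge of an odd multi-cactus gives an odd
multi-cactus or a good graph. -/
lemma multiCactus_addPath [Fintype V] (h : IsSimpleOddMultiCactus G) {x u : V} (hxu : G.Adj x u)
    {l n : ℕ} (hn : n = 4 * l + 4) (hcol : (addPathGraph G x u n).Colorable 2)
    (hbad : ¬ Good (addPathGraph G x u n)) : IsSimpleOddMultiCactus (addPathGraph G x u n) := by
  obtain ⟨W, H, green, hH, ⟨e⟩⟩ := h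
  subst hn
  have hn0 : 4 * l + 4 ≠ 0 := by omega
  have hxu' : H.Adj (e x) (e u) := e.map_adj_iff.2 hxu
  let f := addPathIso e x u (4 * l + 4) hxu.ne hn0
  by_cases hg : s(e x, e u) ∈ green
  · exact ⟨_, _, _, OMC.addPath hH _ _ hxu' hg l, ⟨f⟩⟩
  · have : Fintype W := Fintype.ofEquiv V e.toEquiv
    rcases good_addPath_of_omc hH hxu' hg (hcol.of_hom (SimpleGraph.Iso.toHom f.symm)) with
      hG | ⟨j, ⟨g⟩⟩
    · exact absurd (hG.of_iso f) hbad
    · obtain ⟨g', h0, h1⟩ := exists_iso_cyc_of_adj (by omega) g hxu'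
      obtain ⟨f', -⟩ := exists_addPath_iso g' hxu'.ne hn0 h0 h1
      refine ⟨_, _, _, OMC.addPath (OMC.addPath OMC.k2 0 1 (by simp) (by simp) j)
        (Sum.inl 0) (Sum.inl 1) ?_ (Or.inl ⟨s(0, 1), by simp, rfl⟩) l, ⟨f.trans f'⟩⟩
      exact (addPath_adj_inl zero_ne_one_fin (by omega)).2 (by simp)

/-- Bridgeless bipartite graphs which are not good are odd multi-cacti. -/
theorem multiCactus_of_bad {n : ℕ} : ∀ {V : Type} [Fintype V] {G : SimpleGraph V} {c : V → ZMod 2},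
    Fintype.card V = n → Bip G c → BL G → ¬ Good G → IsSimpleOddMultiCactus G := by
  induction n using Nat.strong_induction_on with
  | _ n ih =>
  intro V _ G c hcard hc hbl hbad
  by_contra hnot
  have E : Env G c := by
    refine ⟨hc, hbl, hbad, fun x u C hxu hx _ hdx _ hth h4 => hnot ?_⟩
    obtain ⟨⟨p, q, h⟩, h2⟩ := hth
    obtain ⟨e, -⟩ := h.exists_iso h2
    have hpos := card_pos.2 ⟨p, h.hp⟩
    obtain ⟨l, hl⟩ : ∃ l, #C = 4 * l + 4 := by
      obtain ⟨k, hk⟩ := h4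
      exact ⟨k - 1, by omega⟩
    have hxu' : (G.induce {v | v ∉ C}).Adj ⟨x, h.hx⟩ ⟨u, h.hu⟩ := hxu
    have hbad' : ¬ Good (addPathGraph (G.induce {v | v ∉ C}) ⟨x, h.hx⟩ ⟨u, h.hu⟩ #C) :=
      fun hg => hbad (hg.of_iso e)
    refine multiCactus_of_iso e (multiCactus_addPath ?_ hxu' hl
      ((bip_colorable hc).of_hom (SimpleGraph.Iso.toHom e.symm)) hbad')
    refine ih (Fintype.card {v | v ∉ C}) ?_ (c := fun v => c v) rfl (fun u v huv => hc huv)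
      (bl_iff_bc.2 (bc_induce_of_ear (bl_iff_bc.1 hbl) hxu hx hdx h))
      fun hg => hbad' (good_addPath hxu' hl hg)
    rw [← hcard]
    exact Fintype.card_subtype_lt (x := p) (by simpa using h.hp)
  exact hnot (multiCactus_of_deg_le_two hc hbl hbad E.deg_le_two)

lemma connOn_of_connected [Fintype V] (h : G.Connected) : ConnOn G univ := by
  intro X _ ⟨a, ha⟩ hcl
  refine eq_univ_of_forall fun b => ?_
  obtain ⟨w⟩ := h.preconnected a b
  induction w with
  | nil => exact ha
  | cons hab _ ih => exact ih (hcl _ ha _ (mem_univ _) hab)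

lemma bc_of_bridgeless [Fintype V] (h : G.Connected) (hb : ∀ e, ¬ G.IsBridge e) : BC G :=
  fun a b => connOn_of_connected (h.connected_delete_edge_of_not_isBridge (hb s(a, b)))

end Main

end ZeroOne

/-- A finite connected simple bipartite graph with no bridge fails to
have the `{0,1}`-property if and only if it is a simple odd multi-cactus. -/
theorem statement0 {V : Type} [Fintype V] (G : SimpleGraph V) (hconn : G.Connected)
    (hbip : G.Colorable 2) (hbridgeless : ∀ e : Sym2 V, ¬ G.IsBridge e) :
    ¬ HasZeroOneProperty G ↔ IsSimpleOddMultiCactus G := by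
  rw [← ZeroOne.good_iff]
  constructor
  · intro hbad
    obtain ⟨c, hc⟩ := ZeroOne.exists_bip hbip
    exact ZeroOne.multiCactus_of_bad rfl hc
      (ZeroOne.bl_iff_bc.2 (ZeroOne.bc_of_bridgeless hconn hbridgeless)) hbad
  · rintro ⟨W, H, green, hH, ⟨e⟩⟩ hG
    have : Fintype W := Fintype.ofEquiv V e.toEquiv
    exact ZeroOne.not_good_of_omc hH (hG.of_iso e.symm)
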